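/- Let s ∈ (5/6, 1) and let ε > 0 be sufficiently small. For every B > 0 there is a constant C = C(s, ε, B) such that: for every T ≥ 1, every Schwartz initial datum φ₀ on ℝ³ with ‖φ₀‖_{H^s(ℝ³)} ≤ B, and every solution φ of the cubic defocussing NLS on ℝ³ × [0, T] with data φ₀, one has ‖φ(·, T)‖_{H^s(ℝ³)} ≤ C (1 + T)^{(1−s)/(6(s−5/6)) + ε}. (Main theorem, n = 3: global-in-time polynomial bound on the H^s norm for s > 5/6.) -/

import Mathlib

open MeasureTheory Complex Set
open scoped FourierTransform BigOperators RealInnerProductSpace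

noncomputable section

abbrev Rn (n : ℕ) := EuclideanSpace ℝ (Fin n)

/-- Japanese bracket of a vector. -/
def jap {n : ℕ} (ξ : Rn n) : ℝ := Real.sqrt (1 + ‖ξ‖ ^ 2)

/-- Japanese bracket of a real number. -/
def japR (x : ℝ) : ℝ := Real.sqrt (1 + x ^ 2)

/-- Inhomogeneous Sobolev norm ‖⟨ξ⟩^s f̂‖_{L²}. -/
def sobNorm (n : ℕ) (s : ℝ) (f : Rn n → ℂ) : ℝ :=
  (∫ ξ : Rn n, jap ξ ^ (2 * s) * ‖𝓕 f ξ‖ ^ 2) ^ (1/2 : ℝ)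

/-- Homogeneous Sobolev norm ‖|ξ|^s f̂‖_{L²}. -/
def sobNormHom (n : ℕ) (s : ℝ) (f : Rn n → ℂ) : ℝ :=
  (∫ ξ : Rn n, ‖ξ‖ ^ (2 * s) * ‖𝓕 f ξ‖ ^ 2) ^ (1/2 : ℝ)

/-- L^p norm on ℝⁿ. -/
def lpNorm (n : ℕ) (p : ℝ) (f : Rn n → ℂ) : ℝ :=
  (∫ x : Rn n, ‖f x‖ ^ p) ^ (1/p)

/-- Laplacian: sum of second partial derivatives. -/
def laplacian {n : ℕ} (f : Rn n → ℂ) (x : Rn n) : ℂ :=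
  ∑ i : Fin n, fderiv ℝ (fun y => fderiv ℝ f y (EuclideanSpace.single i 1)) x
    (EuclideanSpace.single i 1)

/-- Complex gradient as a vector in Euclidean space. -/
def gradC {n : ℕ} (f : Rn n → ℂ) (x : Rn n) : EuclideanSpace ℂ (Fin n) :=
  (WithLp.equiv 2 (Fin n → ℂ)).symm fun i => fderiv ℝ f x (EuclideanSpace.single i 1)

/-- φ is a solution of the cubic defocussing NLS on ℝⁿ × [0,T] with data φ₀:
smooth, Schwartz in x uniformly for t ∈ [0,T] (with all derivatives),
satisfying i∂ₜφ + Δφ = |φ|²φ and φ(·,0) = φ₀. -/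
def IsNLSSolution (n : ℕ) (T : ℝ) (φ : Rn n → ℝ → ℂ) (φ₀ : Rn n → ℂ) : Prop :=
  ContDiff ℝ (⊤ : ℕ∞) (fun p : Rn n × ℝ => φ p.1 p.2) ∧
  (∀ k l : ℕ, ∃ C : ℝ, ∀ t ∈ Icc (0:ℝ) T, ∀ x : Rn n,
      ‖x‖ ^ k * ‖iteratedFDeriv ℝ l (fun y => φ y t) x‖ ≤ C) ∧
  (∀ x : Rn n, ∀ t ∈ Icc (0:ℝ) T,
      Complex.I * deriv (fun t' => φ x t') t + laplacian (fun y => φ y t) x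
        = (‖φ x t‖ : ℂ) ^ 2 * φ x t) ∧
  (∀ x : Rn n, φ x 0 = φ₀ x)

/-- The energy E(f) = ∫ (1/2)|∇f|² + (1/4)|f|⁴. -/
def energy {n : ℕ} (f : Rn n → ℂ) : ℝ :=
  ∫ x : Rn n, ((1/2 : ℝ) * ∑ i : Fin n, ‖fderiv ℝ f x (EuclideanSpace.single i 1)‖ ^ 2
    + (1/4 : ℝ) * ‖f x‖ ^ 4)

/-- m₁ is a smooth, radially symmetric, nonincreasing multiplier with
m₁ = 1 on the unit ball, m₁(ξ) = |ξ|^{-(1-s)} for |ξ| ≥ 2, 0 < m₁ ≤ 1. -/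
def IsAdmissibleMultiplier (n : ℕ) (s : ℝ) (m₁ : Rn n → ℝ) : Prop :=
  ContDiff ℝ (⊤ : ℕ∞) m₁ ∧
  (∀ ξ : Rn n, 0 < m₁ ξ ∧ m₁ ξ ≤ 1) ∧
  (∀ ξ η : Rn n, ‖ξ‖ = ‖η‖ → m₁ ξ = m₁ η) ∧
  (∀ ξ η : Rn n, ‖ξ‖ ≤ ‖η‖ → m₁ η ≤ m₁ ξ) ∧
  (∀ ξ : Rn n, ‖ξ‖ ≤ 1 → m₁ ξ = 1) ∧
  (∀ ξ : Rn n, 2 ≤ ‖ξ‖ → m₁ ξ = ‖ξ‖ ^ (-(1 - s)))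

/-- The rescaled multiplier m_N(ξ) = m₁(ξ/N). -/
def mN {n : ℕ} (m₁ : Rn n → ℝ) (N : ℝ) (ξ : Rn n) : ℝ := m₁ (N⁻¹ • ξ)

/-- The smoothing operator I_N with Fourier multiplier m_N. -/
def Iop {n : ℕ} (m₁ : Rn n → ℝ) (N : ℝ) (f : Rn n → ℂ) : Rn n → ℂ :=
  fun x => 𝓕⁻ (fun ξ => (mN m₁ N ξ : ℂ) * 𝓕 f ξ) x

/-- The spatial multiplier ⟨∇⟩^s. -/
def japMul (n : ℕ) (s : ℝ) (f : Rn n → ℂ) : Rn n → ℂ :=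
  fun x => 𝓕⁻ (fun ξ => ((jap ξ ^ s : ℝ) : ℂ) * 𝓕 f ξ) x

/-- Sharp Littlewood–Paley projection onto {M ≤ ⟨ξ⟩ ≤ 2M}. -/
def LP (n : ℕ) (M : ℝ) (f : Rn n → ℂ) : Rn n → ℂ :=
  fun x => 𝓕⁻ (fun ξ => if M ≤ jap ξ ∧ jap ξ ≤ 2 * M then 𝓕 f ξ else 0) x

/-- Space-time Fourier transform ψ̃(ξ,τ). -/
def stFourier (n : ℕ) {E : Type*} [NormedAddCommGroup E] [NormedSpace ℂ E]
    (ψ : Rn n → ℝ → E) (ξ : Rn n) (τ : ℝ) : E :=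
  ∫ x : Rn n, ∫ t : ℝ,
    Complex.exp (Complex.I * ((-2 * Real.pi * (⟪x, ξ⟫ + t * τ) : ℝ) : ℂ)) • ψ x t

/-- The X_{s,b} norm ‖⟨ξ⟩^s ⟨τ-|ξ|²⟩^b ψ̃‖_{L²}. -/
def XNorm (n : ℕ) {E : Type*} [NormedAddCommGroup E] [NormedSpace ℂ E]
    (s b : ℝ) (ψ : Rn n → ℝ → E) : ℝ :=
  (∫ ξ : Rn n, ∫ τ : ℝ,
    jap ξ ^ (2 * s) * japR (τ - ‖ξ‖ ^ 2) ^ (2 * b) * ‖stFourier n ψ ξ τ‖ ^ 2) ^ (1/2 : ℝ)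

/-- The restricted norm X^δ_{s,b}: infimum over Schwartz extensions off ℝⁿ × [0,δ]. -/
def XRNorm (n : ℕ) {E : Type*} [NormedAddCommGroup E] [NormedSpace ℂ E]
    (s b δ : ℝ) (f : Rn n → ℝ → E) : ℝ :=
  sInf { r : ℝ | ∃ ψ : SchwartzMap (Rn n × ℝ) E,
    (∀ x : Rn n, ∀ t ∈ Icc (0:ℝ) δ, ψ (x, t) = f x t) ∧
    r = XNorm n s b (fun x t => ψ (x, t)) }

/-- Space-time L^p norm on ℝⁿ × ℝ. -/
def lpNormST (n : ℕ) {E : Type*} [NormedAddCommGroup E] (p : ℝ) (F : Rn n → ℝ → E) : ℝ :=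
  (∫ t : ℝ, ∫ x : Rn n, ‖F x t‖ ^ p) ^ (1/p)

/-- Space-time L^p norm on ℝⁿ × [0,δ]. -/
def lpNormSTt (n : ℕ) {E : Type*} [NormedAddCommGroup E] (p δ : ℝ) (F : Rn n → ℝ → E) : ℝ :=
  (∫ t in Icc (0:ℝ) δ, ∫ x : Rn n, ‖F x t‖ ^ p) ^ (1/p)

open scoped ComplexConjugate

lemma jap_sq {n : ℕ} (ξ : Rn n) : jap ξ ^ 2 = 1 + ‖ξ‖ ^ 2 :=
  Real.sq_sqrt (by positivity)

lemma one_le_jap {n : ℕ} (ξ : Rn n) : 1 ≤ jap ξ :=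
  Real.one_le_sqrt.2 (by nlinarith [sq_nonneg ‖ξ‖])

lemma jap_pos {n : ℕ} (ξ : Rn n) : 0 < jap ξ := zero_lt_one.trans_le (one_le_jap ξ)

lemma norm_le_jap {n : ℕ} (ξ : Rn n) : ‖ξ‖ ≤ jap ξ :=
  Real.le_sqrt_of_sq_le (by linarith)

@[fun_prop]
lemma continuous_jap {n : ℕ} : Continuous (jap : Rn n → ℝ) := by
  unfold jap; fun_prop

@[fun_prop]
lemma measurable_jap {n : ℕ} : Measurable (jap : Rn n → ℝ) := continuous_jap.measurable

lemma jap_neg {n : ℕ} (ξ : Rn n) : jap (-ξ) = jap ξ := by simp [jap]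

lemma jap_le_add_norm {n : ℕ} (ξ η : Rn n) : jap (ξ + η) ≤ jap ξ + ‖η‖ := by
  have h1 := norm_add_le ξ η
  have h2 := norm_le_jap ξ
  apply Real.sqrt_le_iff.2
  refine ⟨by positivity [jap_pos ξ], ?_⟩
  have h3 : ‖ξ + η‖ ^ 2 ≤ (‖ξ‖ + ‖η‖) ^ 2 := by gcongr
  nlinarith [jap_sq ξ, norm_nonneg η, norm_nonneg ξ]

lemma jap_add_le {n : ℕ} (ξ η : Rn n) : jap (ξ + η) ≤ jap ξ + jap η :=
  (jap_le_add_norm ξ η).trans (by gcongr; exact norm_le_jap η)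

lemma jap_sub_le {n : ℕ} (ξ η : Rn n) : jap (ξ - η) ≤ jap ξ + jap η := by
  simpa [sub_eq_add_neg, jap_neg] using jap_add_le ξ (-η)

lemma jap_add_sub_le {n : ℕ} (a b c : Rn n) : jap (a + b - c) ≤ jap a + jap b + jap c :=
  (jap_sub_le _ _).trans (by gcongr; exact jap_add_le a b)

lemma jap_rpow_neg_eq {n : ℕ} (ξ : Rn n) (r : ℝ) :
    jap ξ ^ (-r) = (1 + ‖ξ‖ ^ 2) ^ (-r / 2) := by
  rw [jap, Real.sqrt_eq_rpow, ← Real.rpow_mul (by positivity)]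
  congr 1; ring

lemma integrable_jap_rpow {r : ℝ} (hr : 3 < r) : Integrable fun ξ : Rn 3 => jap ξ ^ (-r) := by
  simp_rw [jap_rpow_neg_eq]
  exact integrable_rpow_neg_one_add_norm_sq (by simpa using hr)

lemma lintegral_jap_rpow_lt_top {r : ℝ} (hr : 3 < r) :
    ∫⁻ ξ : Rn 3, ENNReal.ofReal (jap ξ ^ (-r)) < ⊤ :=
  (integrable_jap_rpow hr).lintegral_lt_top

/-- An integrable majorant of the resonance weight. -/
def resKer (δ Ω : ℝ) : ℝ := (1 + |Ω|) ^ (-(1 + δ))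

lemma resKer_pos (δ Ω : ℝ) : 0 < resKer δ Ω := by unfold resKer; positivity

lemma resKer_le_one {δ : ℝ} (hδ : 0 < δ) (Ω : ℝ) : resKer δ Ω ≤ 1 :=
  Real.rpow_le_one_of_one_le_of_nonpos (by linarith [abs_nonneg Ω]) (by linarith)

@[fun_prop]
lemma measurable_resKer (δ : ℝ) : Measurable (resKer δ) := by unfold resKer; fun_prop

lemma lintegral_resKer_lt_top {δ : ℝ} (hδ : 0 < δ) :
    ∫⁻ u, ENNReal.ofReal (resKer δ u) < ⊤ :=
  (integrable_one_add_norm (E := ℝ) (μ := volume) (r := 1 + δ)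
    (by simpa using hδ)).lintegral_lt_top

lemma setLIntegral_abs_mul_resKer_le (δ A : ℝ) {s : Set ℝ} (hs : MeasurableSet s)
    (hinj : InjOn (fun y : ℝ => 8 * Real.pi ^ 2 * y ^ 2) s) :
    ∫⁻ y in s, ENNReal.ofReal (|y| * resKer δ (8 * Real.pi ^ 2 * y ^ 2 - A))
      ≤ ∫⁻ u, ENNReal.ofReal (resKer δ u) := by
  have key := lintegral_image_eq_lintegral_abs_deriv_mul (f := fun y : ℝ => 8 * Real.pi ^ 2 * y ^ 2)
    (f' := fun y => 8 * Real.pi ^ 2 * (2 * y)) hs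
    (fun x _ => by simpa using ((hasDerivAt_pow 2 x).const_mul (8 * Real.pi ^ 2)).hasDerivWithinAt)
    hinj (fun u => ENNReal.ofReal (resKer δ (u - A)))
  calc _ ≤ ∫⁻ y in s, ENNReal.ofReal |8 * Real.pi ^ 2 * (2 * y)|
            * ENNReal.ofReal (resKer δ (8 * Real.pi ^ 2 * y ^ 2 - A)) := by
        refine lintegral_mono fun y => ?_
        rw [← ENNReal.ofReal_mul (abs_nonneg _)]
        refine ENNReal.ofReal_le_ofReal ?_
        refine mul_le_mul_of_nonneg_right ?_ (resKer_pos _ _).le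
        · rw [abs_mul, abs_of_pos (by positivity : 0 < 8 * Real.pi ^ 2), abs_mul, abs_two]
          nlinarith [Real.pi_gt_three, abs_nonneg y, mul_nonneg (sub_nonneg.2 Real.pi_gt_three.le)
            (abs_nonneg y), mul_nonneg (sq_nonneg (Real.pi - 3)) (abs_nonneg y)]
    _ = ∫⁻ u in (fun y : ℝ => 8 * Real.pi ^ 2 * y ^ 2) '' s,
          ENNReal.ofReal (resKer δ (u - A)) := key.symm
    _ ≤ ∫⁻ u, ENNReal.ofReal (resKer δ (u - A)) := setLIntegral_le_lintegral _ _
    _ = _ := lintegral_sub_right_eq_self (fun u => ENNReal.ofReal (resKer δ u)) A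

lemma exists_lintegral_one_add_abs_mul_resKer_le {δ : ℝ} (hδ : 0 < δ) :
    ∃ C < (⊤ : ENNReal), ∀ A : ℝ,
      ∫⁻ y : ℝ, ENNReal.ofReal ((1 + |y|) * resKer δ (8 * Real.pi ^ 2 * y ^ 2 - A)) ≤ C := by
  set I := ∫⁻ u, ENNReal.ofReal (resKer δ u) with hI
  have hIt : I < ⊤ := lintegral_resKer_lt_top hδ
  refine ⟨4 + 2 * (I + I), ?_, fun A => ?_⟩
  · finiteness
  set g : ℝ → ENNReal := fun y => ENNReal.ofReal (|y| * resKer δ (8 * Real.pi ^ 2 * y ^ 2 - A))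
  have hg : Measurable g := by fun_prop
  have hinj : ∀ s : Set ℝ, (∀ x ∈ s, ∀ y ∈ s, 0 < x + y ∨ x + y < 0) →
      InjOn (fun y : ℝ => 8 * Real.pi ^ 2 * y ^ 2) s := by
    intro s hs x hx y hy hxy
    have h1 : x ^ 2 = y ^ 2 := mul_left_cancel₀ (by positivity) hxy
    have h2 : (x - y) * (x + y) = 0 := by linear_combination h1
    rcases mul_eq_zero.1 h2 with h | h
    · linarith
    · rcases hs x hx y hy with h3 | h3 <;> linarith
  have h1 : ∫⁻ y in Ioi 0, g y ≤ I := setLIntegral_abs_mul_resKer_le δ A measurableSet_Ioi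
    (hinj _ fun x hx y hy => Or.inl (add_pos hx hy))
  have h2 : ∫⁻ y in Iio 0, g y ≤ I := setLIntegral_abs_mul_resKer_le δ A measurableSet_Iio
    (hinj _ fun x hx y hy => Or.inr (add_neg hx hy))
  have h3 : ∫⁻ y, g y ≤ I + I := by
    calc ∫⁻ y, g y = (∫⁻ y in Ioi 0, g y) + ∫⁻ y in Iic 0, g y := by
          rw [← compl_Ioi, lintegral_add_compl _ measurableSet_Ioi]
      _ = (∫⁻ y in Ioi 0, g y) + ∫⁻ y in Iio 0, g y := by rw [setLIntegral_congr Iio_ae_eq_Iic]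
      _ ≤ I + I := add_le_add h1 h2
  calc _ ≤ ∫⁻ y, ((Icc (-1 : ℝ) 1).indicator (fun _ => 2) y + 2 * g y) := by
        refine lintegral_mono fun y => ?_
        have hk1 := resKer_le_one hδ (8 * Real.pi ^ 2 * y ^ 2 - A)
        have hk0 := resKer_pos δ (8 * Real.pi ^ 2 * y ^ 2 - A)
        by_cases hy : |y| ≤ 1
        · rw [indicator_of_mem (show y ∈ Icc (-1 : ℝ) 1 from abs_le.1 hy)]
          refine le_add_right ?_
          refine ENNReal.ofReal_le_of_le_toReal ?_
          norm_num
          nlinarith [abs_nonneg y]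
        · refine le_add_left ?_
          rw [← ENNReal.ofReal_ofNat 2, ← ENNReal.ofReal_mul (by norm_num)]
          refine ENNReal.ofReal_le_ofReal ?_
          push Not at hy
          nlinarith
    _ = 4 + 2 * ∫⁻ y, g y := by
        rw [lintegral_add_left (by measurability), lintegral_const_mul _ hg,
          lintegral_indicator_const measurableSet_Icc]
        norm_num
    _ ≤ _ := by gcongr

/-- The coordinates of a vector of `ℝ³` other than the `i`-th one. -/
def dropCoord (i : Fin 3) (v : Rn 3) : Fin 2 → ℝ := fun j => v (i.succAbove j)

@[fun_prop]
lemma measurable_dropCoord (i : Fin 3) : Measurable (dropCoord i) := by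
  unfold dropCoord; fun_prop

lemma lintegral_dropCoord (i : Fin 3) {F : ℝ × (Fin 2 → ℝ) → ENNReal} (hF : Measurable F) :
    ∫⁻ v : Rn 3, F (v i, dropCoord i v) = ∫⁻ w, ∫⁻ y, F (y, w) := by
  have h1 := EuclideanSpace.volume_preserving_symm_measurableEquiv_toLp (Fin 3)
  have h2 := volume_preserving_piFinSuccAbove (fun _ : Fin 3 => ℝ) i
  calc ∫⁻ v : Rn 3, F (v i, dropCoord i v) = ∫⁻ z, F z := (h2.comp h1).lintegral_comp hF
    _ = _ := by rw [Measure.volume_eq_prod, lintegral_prod_symm _ hF.aemeasurable]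

lemma norm_sq_eq_add_dropCoord (i : Fin 3) (v : Rn 3) :
    ‖v‖ ^ 2 = v i ^ 2 + ∑ j, dropCoord i v j ^ 2 := by
  rw [EuclideanSpace.real_norm_sq_eq, Fin.sum_univ_succAbove _ i]; rfl

lemma norm_dropCoord_le (i : Fin 3) (v : Rn 3) : ‖dropCoord i v‖ ≤ ‖v‖ := by
  refine (pi_norm_le_iff_of_nonneg (norm_nonneg _)).2 fun j => ?_
  exact PiLp.norm_apply_le v _

/-- An integrable weight on the plane. -/
def planeWt (δ : ℝ) (w : Fin 2 → ℝ) : ℝ := (1 + ‖w‖ ^ 2) ^ (-(1 + δ))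

lemma planeWt_nonneg (δ : ℝ) (w : Fin 2 → ℝ) : 0 ≤ planeWt δ w := by unfold planeWt; positivity

@[fun_prop]
lemma measurable_planeWt (δ : ℝ) : Measurable (planeWt δ) := by unfold planeWt; fun_prop

lemma lintegral_planeWt_lt_top {δ : ℝ} (hδ : 0 < δ) :
    ∫⁻ w, ENNReal.ofReal (planeWt δ w) < ⊤ := by
  have h := integrable_rpow_neg_one_add_norm_sq (E := Fin 2 → ℝ) (μ := volume) (r := 2 + 2 * δ)
    (by simpa using hδ)
  have h2 : (fun x : Fin 2 → ℝ => (1 + ‖x‖ ^ 2) ^ (-(2 + 2 * δ) / 2)) = planeWt δ := by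
    ext w; unfold planeWt; congr 1; ring
  rw [h2] at h
  exact h.lintegral_lt_top

lemma jap_rpow_le_planeWt {δ : ℝ} (hδ : 0 < δ) (i : Fin 3) (v : Rn 3) :
    jap v ^ (-(2 + 2 * δ)) ≤ planeWt δ (dropCoord i v) := by
  rw [jap_rpow_neg_eq, planeWt, show -(2 + 2 * δ) / 2 = -(1 + δ) by ring]
  refine Real.rpow_le_rpow_of_nonpos (by positivity) ?_ (by linarith)
  gcongr
  exact norm_dropCoord_le i v

lemma exists_lintegral_slice_le {δ : ℝ} (hδ : 0 < δ) : ∃ C < (⊤ : ENNReal), ∀ (A : ℝ) (i : Fin 3)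
    (g : (Fin 2 → ℝ) → ENNReal), Measurable g →
    ∫⁻ ρ : Rn 3, ENNReal.ofReal ((1 + |ρ i|) * resKer δ (8 * Real.pi ^ 2 * ‖ρ‖ ^ 2 - A))
      * g (dropCoord i ρ) ≤ C * ∫⁻ w, g w := by
  obtain ⟨C, hC, h⟩ := exists_lintegral_one_add_abs_mul_resKer_le hδ
  refine ⟨C, hC, fun A i g hg => ?_⟩
  set F : ℝ × (Fin 2 → ℝ) → ENNReal := fun z => ENNReal.ofReal ((1 + |z.1|) *
    resKer δ (8 * Real.pi ^ 2 * z.1 ^ 2 - (A - 8 * Real.pi ^ 2 * ∑ j, z.2 j ^ 2))) * g z.2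
  have hF : Measurable F := by fun_prop
  calc _ = ∫⁻ v : Rn 3, F (v i, dropCoord i v) := by
        refine lintegral_congr fun v => ?_
        simp only [F]
        rw [norm_sq_eq_add_dropCoord i v]
        congr 4; ring
    _ = ∫⁻ w, ∫⁻ y, F (y, w) := lintegral_dropCoord i hF
    _ ≤ ∫⁻ w, C * g w := by
        refine lintegral_mono fun w => ?_
        simp only [F]
        rw [lintegral_mul_const _ (by fun_prop)]
        gcongr
        exact h _
    _ = _ := lintegral_const_mul _ hg

/-- The square of the ratio weight of a pair of frequency magnitudes. -/
def ratioSq (δ x y : ℝ) : ℝ := max x y / min x y ^ (2 + 2 * δ)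

lemma ratioSq_comm (δ x y : ℝ) : ratioSq δ x y = ratioSq δ y x := by
  unfold ratioSq; rw [max_comm, min_comm]

@[fun_prop]
lemma measurable_ratioSq {α : Type*} [MeasurableSpace α] (δ : ℝ) {f g : α → ℝ} (hf : Measurable f)
    (hg : Measurable g) : Measurable fun a => ratioSq δ (f a) (g a) := by
  unfold ratioSq; fun_prop

lemma exists_norm_le_two_mul_abs (ρ : Rn 3) : ∃ i, ‖ρ‖ ≤ 2 * |ρ i| := by
  obtain ⟨i, hi⟩ := Finite.exists_max fun i => |ρ i|
  refine ⟨i, ?_⟩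
  have h0 := abs_nonneg (ρ i)
  refine le_of_sq_le_sq ?_ (by positivity)
  rw [EuclideanSpace.real_norm_sq_eq]
  calc ∑ j, ρ j ^ 2 ≤ ∑ _j : Fin 3, |ρ i| ^ 2 := by
        refine Finset.sum_le_sum fun j _ => ?_
        exact sq_le_sq' (by linarith [neg_abs_le (ρ j), hi j]) ((le_abs_self _).trans (hi j))
    _ ≤ (2 * |ρ i|) ^ 2 := by simp only [Finset.sum_const, Finset.card_fin, nsmul_eq_mul]; push_cast; nlinarith

lemma ratioSq_le_of_jap_le {δ : ℝ} (hδ : 0 < δ) (hδ1 : δ ≤ 1) (η ρ : Rn 3)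
    (hle : jap η ≤ jap (η - (2 : ℝ) • ρ)) :
    ∃ i, ratioSq δ (jap η) (jap (η - (2 : ℝ) • ρ)) ≤
      32 * ((1 + |ρ i|) * (planeWt δ (dropCoord i η) + planeWt δ (dropCoord i ρ))) := by
  obtain ⟨i, hi⟩ := exists_norm_le_two_mul_abs ρ
  refine ⟨i, ?_⟩
  set x := jap η
  have hx : 1 ≤ x := one_le_jap η
  have hx0 : 0 < x := jap_pos η
  have hy : jap (η - (2 : ℝ) • ρ) ≤ x + 2 * ‖ρ‖ := by
    have := jap_le_add_norm η (-((2 : ℝ) • ρ))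
    rwa [norm_neg, norm_smul, Real.norm_two, ← sub_eq_add_neg] at this
  rw [ratioSq, max_eq_right hle, min_eq_left hle, div_eq_mul_inv, ← Real.rpow_neg hx0.le]
  have ha : 0 ≤ |ρ i| := abs_nonneg _
  have hp1 := planeWt_nonneg δ (dropCoord i η)
  have hp2 := planeWt_nonneg δ (dropCoord i ρ)
  rcases le_total x (2 * ‖ρ‖) with h | h
  · calc _ ≤ (32 * (1 + |ρ i|)) * planeWt δ (dropCoord i η) := by
          gcongr
          · linarith
          · exact jap_rpow_le_planeWt hδ i η
      _ ≤ _ := by nlinarith [mul_nonneg ha hp2]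
  · have hj : jap ρ ≤ 2 * x := by
      have := jap_le_add_norm 0 ρ
      simp [jap] at this
      simp [jap]
      linarith
    have hj2 : jap ρ ≤ 1 + 2 * |ρ i| := by
      have := jap_le_add_norm 0 ρ
      simp [jap] at this
      simp [jap]
      linarith
    have hj0 := jap_pos ρ
    have e1 : x ^ (-(1 + 2 * δ)) ≤ (jap ρ / 2) ^ (-(1 + 2 * δ)) :=
      Real.rpow_le_rpow_of_nonpos (by positivity) (by linarith) (by linarith)
    have e2 : (jap ρ / 2) ^ (-(1 + 2 * δ)) ≤ 8 * (jap ρ ^ (-(1 + 2 * δ))) := by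
      rw [Real.div_rpow hj0.le (by norm_num), div_eq_mul_inv, ← Real.rpow_neg (by norm_num), neg_neg,
        mul_comm]
      gcongr
      calc (2 : ℝ) ^ (1 + 2 * δ) ≤ 2 ^ (3 : ℝ) :=
            Real.rpow_le_rpow_of_exponent_le (by norm_num) (by linarith)
        _ = 8 := by norm_num
    have e3 : jap ρ ^ (-(1 + 2 * δ)) = jap ρ * jap ρ ^ (-(2 + 2 * δ)) := by
      rw [← Real.rpow_one_add' hj0.le (by linarith)]; congr 1; ring
    calc _ ≤ (2 * x) * x ^ (-(2 + 2 * δ)) := by gcongr; linarith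
      _ = 2 * x ^ (-(1 + 2 * δ)) := by
        rw [mul_assoc, ← Real.rpow_one_add' hx0.le (by linarith)]; congr 2; ring
      _ ≤ 2 * (8 * (jap ρ * jap ρ ^ (-(2 + 2 * δ)))) := by rw [← e3]; gcongr; exact e1.trans e2
      _ ≤ 2 * (8 * ((2 * (1 + |ρ i|)) * planeWt δ (dropCoord i ρ))) := by
        gcongr
        · linarith
        · exact jap_rpow_le_planeWt hδ i ρ
      _ ≤ _ := by nlinarith [mul_nonneg ha hp1]

lemma ratioSq_le {δ : ℝ} (hδ : 0 < δ) (hδ1 : δ ≤ 1) (ξ ρ : Rn 3) :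
    ratioSq δ (jap (ξ + ρ)) (jap (ξ - ρ)) ≤ ∑ i, 32 * ((1 + |ρ i|) *
      (planeWt δ (dropCoord i (ξ + ρ)) + planeWt δ (dropCoord i (ξ - ρ))
        + planeWt δ (dropCoord i ρ))) := by
  have key : ∀ i, ∀ a b c : ℝ, 0 ≤ a → 0 ≤ b → 0 ≤ c → ∀ f : Fin 3 → ℝ,
      0 ≤ f i → 32 * (f i * a) ≤ 32 * (f i * (a + b + c)) := by
    intro i a b c ha hb hc f hf
    gcongr; linarith
  have hn : ∀ i, 0 ≤ 32 * ((1 + |ρ i|) *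
      (planeWt δ (dropCoord i (ξ + ρ)) + planeWt δ (dropCoord i (ξ - ρ))
        + planeWt δ (dropCoord i ρ))) := by
    intro i
    have h1 := planeWt_nonneg δ (dropCoord i (ξ + ρ))
    have h2 := planeWt_nonneg δ (dropCoord i (ξ - ρ))
    have h3 := planeWt_nonneg δ (dropCoord i ρ)
    positivity
  obtain ⟨i, hi⟩ : ∃ i, ratioSq δ (jap (ξ + ρ)) (jap (ξ - ρ)) ≤ 32 * ((1 + |ρ i|) *
      (planeWt δ (dropCoord i (ξ + ρ)) + planeWt δ (dropCoord i (ξ - ρ))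
        + planeWt δ (dropCoord i ρ))) := by
    rcases le_total (jap (ξ + ρ)) (jap (ξ - ρ)) with h | h
    · have e : ξ - ρ = (ξ + ρ) - (2 : ℝ) • ρ := by rw [two_smul]; abel
      rw [e] at h ⊢
      obtain ⟨i, hi⟩ := ratioSq_le_of_jap_le hδ hδ1 (ξ + ρ) ρ h
      refine ⟨i, hi.trans ?_⟩
      gcongr
      linarith [planeWt_nonneg δ (dropCoord i (ξ + ρ - (2 : ℝ) • ρ))]
    · have e : ξ + ρ = (ξ - ρ) - (2 : ℝ) • (-ρ) := by rw [two_smul]; abel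
      rw [e] at h ⊢
      rw [ratioSq_comm]
      obtain ⟨i, hi⟩ := ratioSq_le_of_jap_le hδ hδ1 (ξ - ρ) (-ρ) h
      refine ⟨i, hi.trans ?_⟩
      have e2 : planeWt δ (dropCoord i (-ρ)) = planeWt δ (dropCoord i ρ) := by
        have : dropCoord i (-ρ) = -dropCoord i ρ := rfl
        rw [this, planeWt, planeWt, norm_neg]
      rw [e2]
      simp only [PiLp.neg_apply, abs_neg]
      gcongr
      linarith [planeWt_nonneg δ (dropCoord i (ξ - ρ - (2 : ℝ) • -ρ))]
  exact hi.trans (Finset.single_le_sum (f := fun i => 32 * ((1 + |ρ i|) *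
      (planeWt δ (dropCoord i (ξ + ρ)) + planeWt δ (dropCoord i (ξ - ρ))
        + planeWt δ (dropCoord i ρ)))) (fun i _ => hn i) (Finset.mem_univ i))

lemma exists_lintegral_ratioSq_mul_resKer_le {δ : ℝ} (hδ : 0 < δ) (hδ1 : δ ≤ 1) :
    ∃ C < (⊤ : ENNReal), ∀ (A : ℝ) (ξ : Rn 3),
    ∫⁻ η : Rn 3, ENNReal.ofReal (ratioSq δ (jap η) (jap (ξ - η)) *
      resKer δ (4 * Real.pi ^ 2 * (‖η‖ ^ 2 + ‖ξ - η‖ ^ 2) - A)) ≤ C := by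
  obtain ⟨C, hC, h⟩ := exists_lintegral_slice_le hδ
  set I := ∫⁻ w, ENNReal.ofReal (planeWt δ w)
  have hI : I < ⊤ := lintegral_planeWt_lt_top hδ
  refine ⟨3 * (32 * (C * I + C * I + C * I)), by finiteness, fun A ξ => ?_⟩
  set ζ : Rn 3 := (2⁻¹ : ℝ) • ξ
  have hζ : ξ = ζ + ζ := by rw [← two_smul ℝ ζ, smul_inv_smul₀ two_ne_zero]
  set A' := A - 8 * Real.pi ^ 2 * ‖ζ‖ ^ 2
  set G : Fin 3 → Rn 3 → ENNReal := fun i ρ =>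
    ENNReal.ofReal ((1 + |ρ i|) * resKer δ (8 * Real.pi ^ 2 * ‖ρ‖ ^ 2 - A'))
  have hG : ∀ i, Measurable (G i) := fun i => by fun_prop
  have hT : ∀ (i : Fin 3) (w : Fin 2 → ℝ), ∫⁻ ρ, G i ρ * ENNReal.ofReal (planeWt δ (w + dropCoord i ρ))
      ≤ C * I := fun i w => by
    refine (h A' i (fun v => ENNReal.ofReal (planeWt δ (w + v))) (by fun_prop)).trans_eq ?_
    rw [lintegral_add_left_eq_self (fun v => ENNReal.ofReal (planeWt δ v))]
  have hT2 : ∀ (i : Fin 3) (w : Fin 2 → ℝ), ∫⁻ ρ, G i ρ * ENNReal.ofReal (planeWt δ (w - dropCoord i ρ))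
      ≤ C * I := fun i w => by
    refine (h A' i (fun v => ENNReal.ofReal (planeWt δ (w - v))) (by fun_prop)).trans_eq ?_
    rw [lintegral_sub_left_eq_self (fun v => ENNReal.ofReal (planeWt δ v))]
  calc _ = ∫⁻ ρ : Rn 3, ENNReal.ofReal (ratioSq δ (jap (ζ + ρ)) (jap (ζ - ρ)) *
      resKer δ (8 * Real.pi ^ 2 * ‖ρ‖ ^ 2 - A')) := by
        rw [← lintegral_add_left_eq_self _ ζ]
        refine lintegral_congr fun ρ => ?_
        have e : ξ - (ζ + ρ) = ζ - ρ := by rw [hζ]; abel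
        have e2 := parallelogram_law_with_norm ℝ ζ ρ
        rw [e]
        congr 3
        simp only [A']
        nlinarith
    _ ≤ ∫⁻ ρ : Rn 3, ∑ i, 32 * (G i ρ * ENNReal.ofReal (planeWt δ (dropCoord i ζ + dropCoord i ρ))
          + G i ρ * ENNReal.ofReal (planeWt δ (dropCoord i ζ - dropCoord i ρ))
          + G i ρ * ENNReal.ofReal (planeWt δ (0 + dropCoord i ρ))) := by
        refine lintegral_mono fun ρ => ?_
        have hk := resKer_pos δ (8 * Real.pi ^ 2 * ‖ρ‖ ^ 2 - A')
        have hw := planeWt_nonneg δ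
        simp only [G, zero_add]
        have e : ∀ X a b c : ℝ, 0 ≤ X → 0 ≤ a → 0 ≤ b → 0 ≤ c →
            32 * (ENNReal.ofReal X * ENNReal.ofReal a + ENNReal.ofReal X * ENNReal.ofReal b
              + ENNReal.ofReal X * ENNReal.ofReal c) = ENNReal.ofReal (32 * (X * (a + b + c))) := by
          intro X a b c hX ha hb hc
          rw [ENNReal.ofReal_mul (by norm_num), ENNReal.ofReal_mul hX, ENNReal.ofReal_add
            (by positivity) hc, ENNReal.ofReal_add ha hb, ENNReal.ofReal_ofNat]
          ring
        have hX : ∀ i, 0 ≤ (1 + |ρ i|) * resKer δ (8 * Real.pi ^ 2 * ‖ρ‖ ^ 2 - A') := fun i => by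
          positivity
        simp_rw [e _ _ _ _ (hX _) (hw _) (hw _) (hw _)]
        rw [← ENNReal.ofReal_sum_of_nonneg fun i _ => by
          have := hX i
          have h1 := hw (dropCoord i ζ + dropCoord i ρ)
          have h2 := hw (dropCoord i ζ - dropCoord i ρ)
          have h3 := hw (dropCoord i ρ)
          positivity]
        refine ENNReal.ofReal_le_ofReal ?_
        refine (mul_le_mul_of_nonneg_right (ratioSq_le hδ hδ1 ζ ρ) hk.le).trans_eq ?_
        rw [Finset.sum_mul]
        refine Finset.sum_congr rfl fun i _ => ?_
        have e1 : dropCoord i (ζ + ρ) = dropCoord i ζ + dropCoord i ρ := rfl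
        have e2 : dropCoord i (ζ - ρ) = dropCoord i ζ - dropCoord i ρ := rfl
        rw [e1, e2]
        ring
    _ = ∑ i, 32 * ((∫⁻ ρ, G i ρ * ENNReal.ofReal (planeWt δ (dropCoord i ζ + dropCoord i ρ)))
          + (∫⁻ ρ, G i ρ * ENNReal.ofReal (planeWt δ (dropCoord i ζ - dropCoord i ρ)))
          + ∫⁻ ρ, G i ρ * ENNReal.ofReal (planeWt δ (0 + dropCoord i ρ))) := by
        rw [lintegral_finsetSum _ (fun i _ => by fun_prop)]
        refine Finset.sum_congr rfl fun i _ => ?_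
        rw [lintegral_const_mul _ (by fun_prop), lintegral_add_left (by fun_prop),
          lintegral_add_left (by fun_prop)]
    _ ≤ ∑ _i : Fin 3, 32 * (C * I + C * I + C * I) := by
        refine Finset.sum_le_sum fun i _ => ?_
        gcongr
        · exact hT _ _
        · exact hT2 _ _
        · exact hT _ _
    _ = _ := by simp

/-- The gain from integrating an oscillation of frequency `Ω` over a unit time interval. -/
def resWt (Ω : ℝ) : ℝ := (max 1 |Ω|)⁻¹

lemma resWt_pos (Ω : ℝ) : 0 < resWt Ω := by unfold resWt; positivity

lemma resKer_neg (δ Ω : ℝ) : resKer δ (-Ω) = resKer δ Ω := by simp [resKer]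

@[fun_prop]
lemma continuous_resWt : Continuous resWt := by
  unfold resWt
  exact Continuous.inv₀ (by fun_prop) fun x => by positivity

lemma resWt_le_resKer {δ Ω X : ℝ} (hδ : 0 < δ) (hδ1 : δ ≤ 1) (hX : 1 ≤ X)
    (hΩ : |Ω| ≤ 80 * X ^ 2) : resWt Ω ≤ 162 * (X ^ (2 * δ) * resKer δ Ω) := by
  have h0 := abs_nonneg Ω
  have h1 : resWt Ω ≤ 2 * (1 + |Ω|)⁻¹ := by
    rw [resWt, inv_le_iff_one_le_mul₀ (by positivity), mul_assoc, ← div_eq_inv_mul,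
      ← mul_div_assoc, le_div_iff₀ (by positivity)]
    linarith [le_max_left 1 |Ω|, le_max_right 1 |Ω|]
  have h2 : (1 + |Ω|)⁻¹ = (1 + |Ω|) ^ δ * resKer δ Ω := by
    rw [resKer, ← Real.rpow_add (by positivity), ← Real.rpow_neg_one]; congr 1; ring
  have h3 : (1 + |Ω|) ^ δ ≤ 81 * X ^ (2 * δ) := by
    calc (1 + |Ω|) ^ δ ≤ (81 * X ^ 2) ^ δ := by
          gcongr; nlinarith
      _ = 81 ^ δ * X ^ (2 * δ) := by
          rw [Real.mul_rpow (by norm_num) (by positivity), Real.rpow_mul (by positivity),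
            Real.rpow_two]
      _ ≤ 81 ^ (1 : ℝ) * X ^ (2 * δ) := by gcongr; norm_num
      _ = _ := by rw [Real.rpow_one]
  calc _ ≤ 2 * ((1 + |Ω|) ^ δ * resKer δ Ω) := by rw [← h2]; exact h1
    _ ≤ 2 * ((81 * X ^ (2 * δ)) * resKer δ Ω) := by
        gcongr; exact (resKer_pos _ _).le
    _ = _ := by ring

lemma rpow_mul_resWt_le_aux {δ X p Y q Ω : ℝ} (hδ : 0 < δ) (hδ1 : δ ≤ 1 / 4) (hp : 1 ≤ p)
    (hpX : p ≤ X) (hq : 1 ≤ q) (hqY : q ≤ Y) (hYX : Y ≤ X) (hX : X ≤ p + q + Y)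
    (hΩ : |Ω| = |4 * Real.pi ^ 2 * (X ^ 2 + p ^ 2 - Y ^ 2 - q ^ 2)|) :
    X ^ (3 - 4 * δ) * resWt Ω ≤ 1296 * (X * p * (Y * q) *
      (√(X / p ^ (2 + 2 * δ)) * √(Y / q ^ (2 + 2 * δ)) * resKer δ Ω
        + (Y * q) ^ (-(3 + 4 * δ) / 2))) := by
  have hp0 : 0 < p := by linarith
  have hq0 : 0 < q := by linarith
  have hX1 : 1 ≤ X := by linarith
  have hX0 : 0 < X := by linarith
  have hY0 : 0 < Y := by linarith
  have hk := resKer_pos δ Ω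
  have hpi : 4 * Real.pi ^ 2 ≤ 40 := by
    have := Real.pi_lt_d2
    nlinarith [Real.pi_gt_three]
  have hpi1 : 1 ≤ 4 * Real.pi ^ 2 := by nlinarith [Real.pi_gt_three]
  have hsq : ∀ x y : ℝ, 0 < x → 0 < y →
      √(x / y ^ (2 + 2 * δ)) = x ^ (1 / 2 : ℝ) * y ^ (-(1 + δ)) := by
    intro x y hx hy
    rw [Real.sqrt_eq_rpow, Real.div_rpow hx.le (by positivity), ← Real.rpow_mul hy.le, div_eq_mul_inv,
      ← Real.rpow_neg hy.le]
    congr 2; ring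
  have hyk : 0 ≤ (Y * q) ^ (-(3 + 4 * δ) / 2) := by positivity
  rcases le_total p (2 * Y) with h | h
  · have hXY : X ≤ 4 * Y := by linarith
    have hΩ2 : |Ω| ≤ 80 * X ^ 2 := by
      rw [hΩ, abs_mul, abs_of_pos (by positivity : 0 < 4 * Real.pi ^ 2)]
      have : |X ^ 2 + p ^ 2 - Y ^ 2 - q ^ 2| ≤ 2 * X ^ 2 := by
        rw [abs_le]; constructor <;> nlinarith
      calc _ ≤ 40 * (2 * X ^ 2) := by gcongr
        _ = _ := by ring
    have hw := resWt_le_resKer hδ (by linarith) hX1 hΩ2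
    have e1 : X * p * (Y * q) * (√(X / p ^ (2 + 2 * δ)) * √(Y / q ^ (2 + 2 * δ)))
        = (X ^ (3 / 2 : ℝ) * Y ^ (3 / 2 : ℝ)) * (p ^ (-δ) * q ^ (-δ)) := by
      rw [hsq _ _ hX0 hp0, hsq _ _ hY0 hq0]
      have a1 : ∀ x : ℝ, 0 < x → x ^ (3 / 2 : ℝ) = x * x ^ (1 / 2 : ℝ) := fun x hx => by
        rw [← Real.rpow_one_add' hx.le (by norm_num)]; norm_num
      have a2 : ∀ x : ℝ, 0 < x → x ^ (-δ) = x * x ^ (-(1 + δ)) := fun x hx => by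
        rw [← Real.rpow_one_add' hx.le (by linarith)]; congr 1; ring
      rw [a1 X hX0, a1 Y hY0, a2 p hp0, a2 q hq0]; ring
    have e2 : X ^ 3 / 8 ≤ X ^ (3 / 2 : ℝ) * Y ^ (3 / 2 : ℝ) := by
      have : (X / 4) ^ (3 / 2 : ℝ) ≤ Y ^ (3 / 2 : ℝ) := by gcongr; linarith
      have h8 : (4 : ℝ) ^ (3 / 2 : ℝ) = 8 := by
        rw [show (4 : ℝ) = 2 ^ (2 : ℝ) by norm_num, ← Real.rpow_mul (by norm_num)]; norm_num
      calc X ^ 3 / 8 = X ^ (3 / 2 : ℝ) * (X / 4) ^ (3 / 2 : ℝ) := by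
            rw [Real.div_rpow hX0.le (by norm_num), h8, ← mul_div_assoc, ← Real.rpow_add hX0]
            norm_num
        _ ≤ _ := by gcongr
    have e3 : X ^ (-2 * δ) ≤ p ^ (-δ) * q ^ (-δ) := by
      calc X ^ (-2 * δ) = X ^ (-δ) * X ^ (-δ) := by rw [← Real.rpow_add hX0]; congr 1; ring
        _ ≤ _ := by
          gcongr ?_ * ?_
          · exact Real.rpow_le_rpow_of_nonpos hp0 hpX (by linarith)
          · exact Real.rpow_le_rpow_of_nonpos hq0 (by linarith) (by linarith)
    calc _ ≤ X ^ (3 - 4 * δ) * (162 * (X ^ (2 * δ) * resKer δ Ω)) := by gcongr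
      _ = 1296 * ((X ^ 3 / 8) * X ^ (-2 * δ) * resKer δ Ω) := by
        have : X ^ (3 - 4 * δ) * X ^ (2 * δ) = X ^ 3 * X ^ (-2 * δ) := by
          rw [← Real.rpow_add hX0, ← Real.rpow_natCast, ← Real.rpow_add hX0]
          congr 1; push_cast; ring
        linear_combination 162 * resKer δ Ω * this
      _ ≤ 1296 * ((X ^ (3 / 2 : ℝ) * Y ^ (3 / 2 : ℝ)) * (p ^ (-δ) * q ^ (-δ)) * resKer δ Ω) := by
        gcongr
      _ = 1296 * (X * p * (Y * q) * (√(X / p ^ (2 + 2 * δ)) * √(Y / q ^ (2 + 2 * δ)) *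
            resKer δ Ω)) := by rw [← e1]; ring
      _ ≤ _ := by gcongr; linarith
  · have hw : resWt Ω ≤ (X ^ 2)⁻¹ := by
      rw [resWt]
      gcongr
      refine le_max_of_le_right ?_
      rw [hΩ, abs_mul, abs_of_pos (by positivity : 0 < 4 * Real.pi ^ 2)]
      have : X ^ 2 ≤ |X ^ 2 + p ^ 2 - Y ^ 2 - q ^ 2| := le_abs.2 (Or.inl (by nlinarith))
      nlinarith
    have e1 : Y * q * (Y * q) ^ (-(3 + 4 * δ) / 2) = (Y * q) ^ (-(1 + 4 * δ) / 2) := by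
      rw [← Real.rpow_one_add' (by positivity) (by linarith)]; congr 1; ring
    have e2 : X ^ (-(1 + 4 * δ)) ≤ (Y * q) ^ (-(1 + 4 * δ) / 2) := by
      calc X ^ (-(1 + 4 * δ)) = (X ^ 2) ^ (-(1 + 4 * δ) / 2) := by
            rw [← Real.rpow_two, ← Real.rpow_mul hX0.le]; congr 1; ring
        _ ≤ _ := Real.rpow_le_rpow_of_nonpos (by positivity) (by nlinarith) (by linarith)
    have e3 : X ^ (3 - 4 * δ) * (X ^ 2)⁻¹ = X * X * X ^ (-(1 + 4 * δ)) := by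
      rw [← Real.rpow_natCast X 2, ← Real.rpow_neg hX0.le, ← Real.rpow_add hX0]
      rw [← sq, ← Real.rpow_natCast X 2, ← Real.rpow_add hX0]; congr 1; push_cast; ring
    calc _ ≤ X ^ (3 - 4 * δ) * (X ^ 2)⁻¹ := by gcongr
      _ = X * X * X ^ (-(1 + 4 * δ)) := e3
      _ ≤ X * (1296 * p) * (Y * q) ^ (-(1 + 4 * δ) / 2) := by gcongr; linarith
      _ = 1296 * (X * p * (Y * q) * (Y * q) ^ (-(3 + 4 * δ) / 2)) := by rw [← e1]; ring
      _ ≤ _ := by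
        gcongr
        have : 0 ≤ √(X / p ^ (2 + 2 * δ)) * √(Y / q ^ (2 + 2 * δ)) * resKer δ Ω := by positivity
        linarith

lemma rpow_mul_resWt_le {δ a b c e : ℝ} (hδ : 0 < δ) (hδ1 : δ ≤ 1 / 4) (ha : 1 ≤ a) (hb : 1 ≤ b)
    (hc : 1 ≤ c) (he : 1 ≤ e) (h1 : a ≤ b + c + e) (h2 : b ≤ a + c + e) (h3 : c ≤ a + b + e)
    (h4 : e ≤ a + b + c) (Ω : ℝ) (hΩ : Ω = 4 * Real.pi ^ 2 * (a ^ 2 + b ^ 2 - c ^ 2 - e ^ 2)) :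
    (max (max a b) (max c e)) ^ (3 - 4 * δ) * resWt Ω ≤ 1296 * (a * b * (c * e) *
      (√(ratioSq δ a b) * √(ratioSq δ c e) * resKer δ Ω
        + (c * e) ^ (-(3 + 4 * δ) / 2) + (a * b) ^ (-(3 + 4 * δ) / 2))) := by
  have n1 : 0 ≤ (c * e) ^ (-(3 + 4 * δ) / 2) := by positivity
  have n2 : 0 ≤ (a * b) ^ (-(3 + 4 * δ) / 2) := by positivity
  have m1 := max_mul_min a b
  have m2 := max_mul_min c e
  have s1 : max a b ^ 2 + min a b ^ 2 = a ^ 2 + b ^ 2 := by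
    linear_combination (max a b + min a b + (a + b)) * max_add_min a b - 2 * m1
  have s2 : max c e ^ 2 + min c e ^ 2 = c ^ 2 + e ^ 2 := by
    linear_combination (max c e + min c e + (c + e)) * max_add_min c e - 2 * m2
  rcases le_total (max c e) (max a b) with h | h
  · have hm : max a b ≤ min a b + min c e + max c e := by
      linarith [max_add_min c e, max_add_min a b, show max a b ≤ min a b + (c + e) by
        rcases le_total a b with h | h <;> simp [h] <;> linarith]
    have := rpow_mul_resWt_le_aux hδ hδ1 (le_min ha hb) min_le_max (le_min hc he) min_le_max h hm
      (Ω := Ω) (by rw [hΩ]; congr 2; linarith)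
    rw [m1, m2] at this
    rw [max_eq_left h]
    refine this.trans ?_
    have hab : 0 ≤ a * b * (c * e) := by positivity
    refine mul_le_mul_of_nonneg_left (mul_le_mul_of_nonneg_left ?_ hab) (by norm_num)
    rw [ratioSq, ratioSq]
    linarith
  · have hm : max c e ≤ min c e + min a b + max a b := by
      linarith [max_add_min c e, max_add_min a b, show max c e ≤ min c e + (a + b) by
        rcases le_total c e with h | h <;> simp [h] <;> linarith]
    have := rpow_mul_resWt_le_aux hδ hδ1 (le_min hc he) min_le_max (le_min ha hb) min_le_max h hm
      (Ω := Ω) (by rw [hΩ, ← abs_neg]; congr 1; linear_combination 4 * Real.pi ^ 2 * (s1 - s2))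
    rw [m1, m2] at this
    rw [max_eq_right h]
    refine this.trans ?_
    have hab : 0 ≤ a * b * (c * e) := by positivity
    rw [mul_comm (c * e)]
    refine mul_le_mul_of_nonneg_left (mul_le_mul_of_nonneg_left ?_ hab) (by norm_num)
    rw [ratioSq, ratioSq]
    rw [mul_comm √_ √_]
    linarith

lemma lintegral_mul_sq_le {α : Type*} [MeasurableSpace α] (μ : Measure α) {f g : α → ENNReal}
    (hf : AEMeasurable f μ) (hg : AEMeasurable g μ) :
    (∫⁻ x, f x * g x ∂μ) ^ 2 ≤ (∫⁻ x, f x ^ 2 ∂μ) * ∫⁻ x, g x ^ 2 ∂μ := by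
  have h := ENNReal.lintegral_mul_le_Lp_mul_Lq μ (p := 2) (q := 2) (by norm_num [Real.holderConjugate_iff])
    hf hg
  have e : ∀ x : ENNReal, (x ^ (1 / 2 : ℝ)) ^ 2 = x := fun x => by
    rw [← ENNReal.rpow_two, ← ENNReal.rpow_mul]; norm_num
  calc _ ≤ _ := pow_le_pow_left' h 2
    _ = _ := by rw [mul_pow, e, e]; simp

lemma sq_add_le_of_sq_le {x y A B : ENNReal} (hx : x ^ 2 ≤ A) (hy : y ^ 2 ≤ B) :
    (x + y) ^ 2 ≤ 4 * (A + B) := by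
  rcases le_total x y with h | h
  · calc (x + y) ^ 2 ≤ (y + y) ^ 2 := by gcongr
      _ = 4 * y ^ 2 := by ring
      _ ≤ _ := by gcongr; exact hy.trans le_add_self
  · calc (x + y) ^ 2 ≤ (x + x) ^ 2 := by gcongr
      _ = 4 * x ^ 2 := by ring
      _ ≤ _ := by gcongr; exact hx.trans le_self_add

section triple
variable {α β γ : Type*} [MeasureSpace α] [MeasureSpace β] [MeasureSpace γ]
  [SFinite (volume : Measure α)] [SFinite (volume : Measure β)] [SFinite (volume : Measure γ)]

omit [SFinite (volume : Measure α)] in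
lemma lintegral_triple {F : α → β → γ → ENNReal}
    (hF : Measurable fun z : α × β × γ => F z.1 z.2.1 z.2.2) :
    ∫⁻ z : α × β × γ, F z.1 z.2.1 z.2.2 = ∫⁻ x, ∫⁻ y, ∫⁻ z, F x y z := by
  rw [Measure.volume_eq_prod, lintegral_prod _ hF.aemeasurable]
  refine lintegral_congr fun x => ?_
  rw [Measure.volume_eq_prod, lintegral_prod]
  exact (hF.comp (measurable_prodMk_left (x := x))).aemeasurable

omit [SFinite (volume : Measure α)] in
lemma lintegral_triple_mul_sq_le {f g : α → β → γ → ENNReal}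
    (hf : Measurable fun z : α × β × γ => f z.1 z.2.1 z.2.2)
    (hg : Measurable fun z : α × β × γ => g z.1 z.2.1 z.2.2) :
    (∫⁻ x, ∫⁻ y, ∫⁻ z, f x y z * g x y z) ^ 2
      ≤ (∫⁻ x, ∫⁻ y, ∫⁻ z, f x y z ^ 2) * ∫⁻ x, ∫⁻ y, ∫⁻ z, g x y z ^ 2 := by
  rw [← lintegral_triple (hf.mul hg), ← lintegral_triple (hf.pow_const 2),
    ← lintegral_triple (hg.pow_const 2)]
  exact lintegral_mul_sq_le _ hf.aemeasurable hg.aemeasurable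

/-- Rotate the order of integration in a triple integral. -/
lemma lintegral_triple_rotate {F : α → β → γ → ENNReal}
    (hF : Measurable fun z : α × β × γ => F z.1 z.2.1 z.2.2) :
    ∫⁻ x, ∫⁻ y, ∫⁻ z, F x y z = ∫⁻ z, ∫⁻ x, ∫⁻ y, F x y z := by
  calc _ = ∫⁻ x, ∫⁻ z, ∫⁻ y, F x y z := by
        refine lintegral_congr fun x => ?_
        refine lintegral_lintegral_swap ?_
        exact (hF.comp (measurable_prodMk_left (x := x))).aemeasurable
    _ = _ := by
        refine lintegral_lintegral_swap (Measurable.aemeasurable ?_)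
        refine Measurable.lintegral_prod_right' (f := fun p : (α × γ) × β => F p.1.1 p.2 p.1.2) ?_
        exact hF.comp (f := fun p : (α × γ) × β => (p.1.1, p.2, p.1.2)) (by fun_prop)

end triple

/-- The largest magnitude among the four frequencies `ξ, a, a + c - ξ, c`. -/
def maxJap (ξ a c : Rn 3) : ℝ := max (max (jap ξ) (jap (a + c - ξ))) (max (jap a) (jap c))

/-- The resonance function of the cubic interaction. -/
def resPhase (ξ a c : Rn 3) : ℝ :=
  4 * Real.pi ^ 2 * (‖ξ‖ ^ 2 + ‖a + c - ξ‖ ^ 2 - ‖a‖ ^ 2 - ‖c‖ ^ 2)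

lemma measurable_maxJap : Measurable fun z : Rn 3 × Rn 3 × Rn 3 => maxJap z.1 z.2.1 z.2.2 := by
  unfold maxJap; fun_prop

lemma continuous_resPhase : Continuous fun z : Rn 3 × Rn 3 × Rn 3 => resPhase z.1 z.2.1 z.2.2 := by
  unfold resPhase; fun_prop

/-- The squared `L²` norm of `w • f`. -/
def wnormSq (w : Rn 3 → ℝ) (f : Rn 3 → ENNReal) : ENNReal := ∫⁻ ξ, (ENNReal.ofReal (w ξ) * f ξ) ^ 2

lemma lintegral_shift_sq (f : Rn 3 → ENNReal) (b : Rn 3) :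
    ∫⁻ x, f (b - x) ^ 2 = ∫⁻ x, f x ^ 2 :=
  lintegral_sub_left_eq_self (fun x => f x ^ 2) b

lemma lintegral_triple_nonres_left_le {a₁ a₂ a₃ a₄ w : Rn 3 → ENNReal} (h1 : Measurable a₁)
    (h2 : Measurable a₂) (h3 : Measurable a₃) (h4 : Measurable a₄) (hw : Measurable w) :
    (∫⁻ ξ, ∫⁻ a, ∫⁻ c, a₁ ξ * a₂ a * a₃ (a + c - ξ) * a₄ c * (w a * w c)) ^ 2
      ≤ (∫⁻ x, w x ^ 2) ^ 2 * ((∫⁻ x, a₁ x ^ 2) * (∫⁻ x, a₂ x ^ 2) * (∫⁻ x, a₃ x ^ 2)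
        * (∫⁻ x, a₄ x ^ 2)) := by
  have hf := lintegral_triple_mul_sq_le (α := Rn 3) (β := Rn 3) (γ := Rn 3)
    (f := fun ξ a c => a₁ ξ * a₂ a * w c) (g := fun ξ a c => a₃ (a + c - ξ) * a₄ c * w a)
    (by fun_prop) (by fun_prop)
  have e1 : ∫⁻ ξ, ∫⁻ a, ∫⁻ c, (a₁ ξ * a₂ a * w c) ^ 2
      = (∫⁻ x, a₁ x ^ 2) * (∫⁻ x, a₂ x ^ 2) * ∫⁻ x, w x ^ 2 := by
    simp_rw [mul_pow]
    simp_rw [lintegral_const_mul _ (hw.pow_const 2)]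
    have (ξ : Rn 3) : ∫⁻ a, a₁ ξ ^ 2 * a₂ a ^ 2 * ∫⁻ x, w x ^ 2
        = a₁ ξ ^ 2 * (∫⁻ x, a₂ x ^ 2) * ∫⁻ x, w x ^ 2 := by
      rw [lintegral_mul_const _ (by fun_prop), lintegral_const_mul _ (by fun_prop)]
    simp_rw [this]
    rw [lintegral_mul_const _ (by fun_prop), lintegral_mul_const _ (by fun_prop)]
  have e2 : ∫⁻ ξ, ∫⁻ a, ∫⁻ c, (a₃ (a + c - ξ) * a₄ c * w a) ^ 2
      = (∫⁻ x, a₃ x ^ 2) * (∫⁻ x, a₄ x ^ 2) * ∫⁻ x, w x ^ 2 := by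
    rw [← lintegral_triple_rotate (F := fun a c ξ => (a₃ (a + c - ξ) * a₄ c * w a) ^ 2) (by fun_prop)]
    simp_rw [mul_pow, mul_assoc]
    have : ∀ a c : Rn 3, ∫⁻ ξ, a₃ (a + c - ξ) ^ 2 * (a₄ c ^ 2 * w a ^ 2)
        = (∫⁻ x, a₃ x ^ 2) * (a₄ c ^ 2 * w a ^ 2) := fun a c => by
      rw [lintegral_mul_const _ (by fun_prop), lintegral_shift_sq]
    simp_rw [this]
    have h (a : Rn 3) : ∫⁻ c, (∫⁻ x, a₃ x ^ 2) * (a₄ c ^ 2 * w a ^ 2)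
        = (∫⁻ x, a₃ x ^ 2) * ((∫⁻ x, a₄ x ^ 2) * w a ^ 2) := by
      rw [lintegral_const_mul _ (by fun_prop), lintegral_mul_const _ (by fun_prop)]
    simp_rw [h]
    rw [lintegral_const_mul _ (by fun_prop), lintegral_const_mul _ (by fun_prop)]
  rw [e1, e2] at hf
  refine (le_of_eq ?_).trans (hf.trans_eq (by ring))
  congr 1
  refine lintegral_congr fun ξ => lintegral_congr fun a => lintegral_congr fun c => by ring

lemma lintegral_triple_nonres_right_le {a₁ a₂ a₃ a₄ w : Rn 3 → ENNReal} (h1 : Measurable a₁)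
    (h2 : Measurable a₂) (h3 : Measurable a₃) (h4 : Measurable a₄) (hw : Measurable w) :
    (∫⁻ ξ, ∫⁻ a, ∫⁻ c, a₁ ξ * a₂ a * a₃ (a + c - ξ) * a₄ c * (w ξ * w (a + c - ξ))) ^ 2
      ≤ (∫⁻ x, w x ^ 2) ^ 2 * ((∫⁻ x, a₁ x ^ 2) * (∫⁻ x, a₂ x ^ 2) * (∫⁻ x, a₃ x ^ 2)
        * (∫⁻ x, a₄ x ^ 2)) := by
  have hs : ∀ (f : Rn 3 → ENNReal) (a ξ : Rn 3), ∫⁻ c, f (a + c - ξ) ^ 2 = ∫⁻ x, f x ^ 2 := by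
    intro f a ξ
    rw [← lintegral_add_left_eq_self (fun x => f x ^ 2) (a - ξ)]
    refine lintegral_congr fun c => ?_
    congr 2; abel
  have hf := lintegral_triple_mul_sq_le (α := Rn 3) (β := Rn 3) (γ := Rn 3)
    (f := fun ξ a c => w (a + c - ξ) * (a₁ ξ * a₂ a)) (g := fun ξ a c => a₃ (a + c - ξ) * (w ξ * a₄ c))
    (by fun_prop) (by fun_prop)
  have e1 : ∫⁻ ξ, ∫⁻ a, ∫⁻ c, (w (a + c - ξ) * (a₁ ξ * a₂ a)) ^ 2
      = (∫⁻ x, a₁ x ^ 2) * (∫⁻ x, a₂ x ^ 2) * ∫⁻ x, w x ^ 2 := by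
    have : ∀ ξ a : Rn 3, ∫⁻ c, (w (a + c - ξ) * (a₁ ξ * a₂ a)) ^ 2
        = (∫⁻ x, w x ^ 2) * a₁ ξ ^ 2 * a₂ a ^ 2 := fun ξ a => by
      simp_rw [mul_pow]
      rw [lintegral_mul_const _ (by fun_prop), hs]; ring
    simp_rw [this]
    simp_rw [lintegral_const_mul _ (h2.pow_const 2)]
    rw [lintegral_mul_const _ (by fun_prop), lintegral_const_mul _ (by fun_prop)]; ring
  have e2 : ∫⁻ ξ, ∫⁻ a, ∫⁻ c, (a₃ (a + c - ξ) * (w ξ * a₄ c)) ^ 2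
      = (∫⁻ x, a₃ x ^ 2) * (∫⁻ x, a₄ x ^ 2) * ∫⁻ x, w x ^ 2 := by
    have hm : ∀ ξ c : Rn 3, ∫⁻ a, (a₃ (a + c - ξ) * (w ξ * a₄ c)) ^ 2
        = (∫⁻ x, a₃ x ^ 2) * w ξ ^ 2 * a₄ c ^ 2 := fun ξ c => by
      simp_rw [mul_pow]
      rw [lintegral_mul_const _ (by fun_prop), ← hs a₃ c ξ]
      simp_rw [add_comm c]; ring
    have hsw : ∀ ξ : Rn 3, ∫⁻ a, ∫⁻ c, (a₃ (a + c - ξ) * (w ξ * a₄ c)) ^ 2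
        = ∫⁻ c, ∫⁻ a, (a₃ (a + c - ξ) * (w ξ * a₄ c)) ^ 2 := fun ξ =>
      lintegral_lintegral_swap (Measurable.aemeasurable (by fun_prop))
    simp_rw [hsw, hm, lintegral_const_mul _ (h4.pow_const 2)]
    rw [lintegral_mul_const _ (by fun_prop), lintegral_const_mul _ (by fun_prop)]; ring
  rw [e1, e2] at hf
  refine (le_of_eq ?_).trans (hf.trans_eq (by ring))
  congr 1
  refine lintegral_congr fun ξ => lintegral_congr fun a => lintegral_congr fun c => by ring

lemma exists_lintegral_triple_res_le {δ : ℝ} (hδ : 0 < δ) (hδ1 : δ ≤ 1) : ∃ C < (⊤ : ENNReal),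
    ∀ a₁ a₂ a₃ a₄ : Rn 3 → ENNReal, Measurable a₁ → Measurable a₂ → Measurable a₃ → Measurable a₄ →
    (∫⁻ ξ, ∫⁻ a, ∫⁻ c, a₁ ξ * a₂ a * a₃ (a + c - ξ) * a₄ c *
      ENNReal.ofReal (√(ratioSq δ (jap ξ) (jap (a + c - ξ))) * √(ratioSq δ (jap a) (jap c))
        * resKer δ (resPhase ξ a c))) ^ 2
      ≤ C * ((∫⁻ x, a₁ x ^ 2) * (∫⁻ x, a₂ x ^ 2) * (∫⁻ x, a₃ x ^ 2) * (∫⁻ x, a₄ x ^ 2)) := by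
  obtain ⟨C, hC, hS⟩ := exists_lintegral_ratioSq_mul_resKer_le hδ hδ1
  refine ⟨C ^ 2, by finiteness, fun a₁ a₂ a₃ a₄ h1 h2 h3 h4 => ?_⟩
  -- passage to the variables `(a + c, ξ, a)`
  have hchange : ∫⁻ ξ, ∫⁻ a, ∫⁻ c, a₁ ξ * a₂ a * a₃ (a + c - ξ) * a₄ c *
      ENNReal.ofReal (√(ratioSq δ (jap ξ) (jap (a + c - ξ))) * √(ratioSq δ (jap a) (jap c))
        * resKer δ (resPhase ξ a c))
      = ∫⁻ s, ∫⁻ ξ, ∫⁻ a, a₁ ξ * a₂ a * a₃ (s - ξ) * a₄ (s - a) *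
      ENNReal.ofReal (√(ratioSq δ (jap ξ) (jap (s - ξ))) * √(ratioSq δ (jap a) (jap (s - a)))
        * resKer δ (4 * Real.pi ^ 2 * (‖a‖ ^ 2 + ‖s - a‖ ^ 2)
          - 4 * Real.pi ^ 2 * (‖ξ‖ ^ 2 + ‖s - ξ‖ ^ 2))) := by
    rw [← lintegral_triple_rotate (F := fun ξ a s => a₁ ξ * a₂ a * a₃ (s - ξ) * a₄ (s - a) *
      ENNReal.ofReal (√(ratioSq δ (jap ξ) (jap (s - ξ))) * √(ratioSq δ (jap a) (jap (s - a)))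
        * resKer δ (4 * Real.pi ^ 2 * (‖a‖ ^ 2 + ‖s - a‖ ^ 2)
          - 4 * Real.pi ^ 2 * (‖ξ‖ ^ 2 + ‖s - ξ‖ ^ 2)))) (by fun_prop)]
    refine lintegral_congr fun ξ => lintegral_congr fun a => ?_
    conv_rhs => rw [← lintegral_add_left_eq_self _ a]
    refine lintegral_congr fun c => ?_
    rw [add_sub_cancel_left, resPhase, ← resKer_neg]
    congr 4
    ring
  rw [hchange]
  have hf := lintegral_triple_mul_sq_le (α := Rn 3) (β := Rn 3) (γ := Rn 3)
    (f := fun s ξ a => a₁ ξ * a₃ (s - ξ) * ENNReal.ofReal √(ratioSq δ (jap a) (jap (s - a)) *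
      resKer δ (4 * Real.pi ^ 2 * (‖a‖ ^ 2 + ‖s - a‖ ^ 2)
          - 4 * Real.pi ^ 2 * (‖ξ‖ ^ 2 + ‖s - ξ‖ ^ 2))))
    (g := fun s ξ a => a₂ a * a₄ (s - a) * ENNReal.ofReal √(ratioSq δ (jap ξ) (jap (s - ξ)) *
      resKer δ (4 * Real.pi ^ 2 * (‖ξ‖ ^ 2 + ‖s - ξ‖ ^ 2)
          - 4 * Real.pi ^ 2 * (‖a‖ ^ 2 + ‖s - a‖ ^ 2))))
    (by fun_prop) (by fun_prop)
  have hr0 : ∀ x y : Rn 3, 0 ≤ ratioSq δ (jap x) (jap y) := fun x y => by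
    have := jap_pos x
    have := jap_pos y
    have : 0 < min (jap x) (jap y) := lt_min ‹_› ‹_›
    unfold ratioSq; positivity
  have hsqrt : ∀ x : ℝ, 0 ≤ x → ENNReal.ofReal √x ^ 2 = ENNReal.ofReal x := fun x hx => by
    rw [← ENNReal.ofReal_pow (Real.sqrt_nonneg _), Real.sq_sqrt hx]
  have hI : ∀ b d : Rn 3 → ENNReal, Measurable b → Measurable d →
      ∫⁻ s, ∫⁻ ξ, ∫⁻ a, (b ξ * d (s - ξ) * ENNReal.ofReal √(ratioSq δ (jap a) (jap (s - a)) *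
      resKer δ (4 * Real.pi ^ 2 * (‖a‖ ^ 2 + ‖s - a‖ ^ 2)
          - 4 * Real.pi ^ 2 * (‖ξ‖ ^ 2 + ‖s - ξ‖ ^ 2)))) ^ 2
        ≤ C * ((∫⁻ x, b x ^ 2) * ∫⁻ x, d x ^ 2) := by
    intro b d hb hd
    calc _ ≤ ∫⁻ s, ∫⁻ ξ, b ξ ^ 2 * d (s - ξ) ^ 2 * C := by
          refine lintegral_mono fun s => lintegral_mono fun ξ => ?_
          simp_rw [mul_pow, hsqrt _ (mul_nonneg (hr0 _ _) (resKer_pos _ _).le)]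
          rw [lintegral_const_mul _ (by fun_prop)]
          gcongr
          exact hS _ _
      _ = ∫⁻ ξ, ∫⁻ s, b ξ ^ 2 * d (s - ξ) ^ 2 * C :=
          lintegral_lintegral_swap (Measurable.aemeasurable (by fun_prop))
      _ = ∫⁻ ξ, b ξ ^ 2 * (∫⁻ x, d x ^ 2) * C := by
          refine lintegral_congr fun ξ => ?_
          rw [lintegral_mul_const _ (by fun_prop), lintegral_const_mul _ (by fun_prop),
            lintegral_sub_right_eq_self (fun x => d x ^ 2) ξ]
      _ = _ := by
          rw [lintegral_mul_const _ (by fun_prop), lintegral_mul_const _ (by fun_prop), mul_comm]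
  have e1 := hI a₁ a₃ h1 h3
  have e2 := hI a₂ a₄ h2 h4
  have e3 : ∫⁻ s, ∫⁻ ξ, ∫⁻ a, (a₂ a * a₄ (s - a) * ENNReal.ofReal √(ratioSq δ (jap ξ) (jap (s - ξ)) *
      resKer δ (4 * Real.pi ^ 2 * (‖ξ‖ ^ 2 + ‖s - ξ‖ ^ 2)
          - 4 * Real.pi ^ 2 * (‖a‖ ^ 2 + ‖s - a‖ ^ 2)))) ^ 2
      = ∫⁻ s, ∫⁻ a, ∫⁻ ξ, (a₂ a * a₄ (s - a) * ENNReal.ofReal √(ratioSq δ (jap ξ) (jap (s - ξ)) *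
      resKer δ (4 * Real.pi ^ 2 * (‖ξ‖ ^ 2 + ‖s - ξ‖ ^ 2)
          - 4 * Real.pi ^ 2 * (‖a‖ ^ 2 + ‖s - a‖ ^ 2)))) ^ 2 :=
    lintegral_congr fun s => lintegral_lintegral_swap (Measurable.aemeasurable (by fun_prop))
  rw [← e3] at e2
  calc _ ≤ _ := (le_of_eq ?_).trans hf
    _ ≤ _ := mul_le_mul' e1 e2
    _ = _ := by ring
  congr 1
  refine lintegral_congr fun s => lintegral_congr fun ξ => lintegral_congr fun a => ?_
  have hk := fun Ω => (resKer_pos δ Ω).le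
  rw [← resKer_neg δ (4 * Real.pi ^ 2 * (‖ξ‖ ^ 2 + ‖s - ξ‖ ^ 2) - _), neg_sub]
  set k := resKer δ (4 * Real.pi ^ 2 * (‖a‖ ^ 2 + ‖s - a‖ ^ 2)
          - 4 * Real.pi ^ 2 * (‖ξ‖ ^ 2 + ‖s - ξ‖ ^ 2))
  have hk : 0 ≤ k := (resKer_pos _ _).le
  rw [Real.sqrt_mul (hr0 _ _), Real.sqrt_mul (hr0 _ _)]
  have : √(ratioSq δ (jap ξ) (jap (s - ξ))) * √(ratioSq δ (jap a) (jap (s - a))) * k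
      = (√(ratioSq δ (jap a) (jap (s - a))) * √k) * (√(ratioSq δ (jap ξ) (jap (s - ξ))) * √k) := by
    nth_rewrite 1 [← Real.mul_self_sqrt hk]; ring
  rw [this, ENNReal.ofReal_mul (by positivity)]
  ring

/-- The quadrilinear resonant form is bounded on `H¹`. -/
theorem exists_lintegral_quad_le {δ : ℝ} (hδ : 0 < δ) (hδ1 : δ ≤ 1 / 4) : ∃ C < (⊤ : ENNReal),
    ∀ b₁ b₂ b₃ b₄ : Rn 3 → ENNReal, Measurable b₁ → Measurable b₂ → Measurable b₃ → Measurable b₄ →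
    (∫⁻ ξ, ∫⁻ a, ∫⁻ c, b₁ ξ * b₂ a * b₃ (a + c - ξ) * b₄ c *
      ENNReal.ofReal (maxJap ξ a c ^ (3 - 4 * δ) * resWt (resPhase ξ a c))) ^ 2
      ≤ C * (wnormSq jap b₁ * wnormSq jap b₂ * wnormSq jap b₃ * wnormSq jap b₄) := by
  obtain ⟨C, hC, hres⟩ := exists_lintegral_triple_res_le hδ (by linarith)
  set w : Rn 3 → ENNReal := fun x => ENNReal.ofReal (jap x ^ (-(3 + 4 * δ) / 2)) with hw
  have hwm : Measurable w := by fun_prop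
  have hw2 : ∫⁻ x, w x ^ 2 < ⊤ := by
    refine lt_of_eq_of_lt ?_ (lintegral_jap_rpow_lt_top (r := 3 + 4 * δ) (by linarith))
    refine lintegral_congr fun x => ?_
    have := jap_pos x
    simp only [hw]
    rw [← ENNReal.ofReal_pow (by positivity), ← Real.rpow_natCast, ← Real.rpow_mul this.le]
    congr 2; push_cast; ring
  refine ⟨1296 ^ 2 * (4 * (4 * (C + (∫⁻ x, w x ^ 2) ^ 2) + (∫⁻ x, w x ^ 2) ^ 2)), by finiteness, ?_⟩
  intro b₁ b₂ b₃ b₄ h1 h2 h3 h4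
  set a₁ : Rn 3 → ENNReal := fun x => ENNReal.ofReal (jap x) * b₁ x
  set a₂ : Rn 3 → ENNReal := fun x => ENNReal.ofReal (jap x) * b₂ x
  set a₃ : Rn 3 → ENNReal := fun x => ENNReal.ofReal (jap x) * b₃ x
  set a₄ : Rn 3 → ENNReal := fun x => ENNReal.ofReal (jap x) * b₄ x
  have m1 : Measurable a₁ := by fun_prop
  have m2 : Measurable a₂ := by fun_prop
  have m3 : Measurable a₃ := by fun_prop
  have m4 : Measurable a₄ := by fun_prop
  set P := wnormSq jap b₁ * wnormSq jap b₂ * wnormSq jap b₃ * wnormSq jap b₄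
  have t1 := hres a₁ a₂ a₃ a₄ m1 m2 m3 m4
  have t2 := lintegral_triple_nonres_left_le m1 m2 m3 m4 hwm
  have t3 := lintegral_triple_nonres_right_le m1 m2 m3 m4 hwm
  have t := sq_add_le_of_sq_le (sq_add_le_of_sq_le t1 t2) t3
  have hpt : ∫⁻ ξ, ∫⁻ a, ∫⁻ c, b₁ ξ * b₂ a * b₃ (a + c - ξ) * b₄ c *
      ENNReal.ofReal (maxJap ξ a c ^ (3 - 4 * δ) * resWt (resPhase ξ a c))
      ≤ ∫⁻ ξ, ∫⁻ a, ∫⁻ c, 1296 * ((a₁ ξ * a₂ a * a₃ (a + c - ξ) * a₄ c *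
      ENNReal.ofReal (√(ratioSq δ (jap ξ) (jap (a + c - ξ))) * √(ratioSq δ (jap a) (jap c))
        * resKer δ (resPhase ξ a c)))
        + (a₁ ξ * a₂ a * a₃ (a + c - ξ) * a₄ c * (w a * w c))
        + (a₁ ξ * a₂ a * a₃ (a + c - ξ) * a₄ c * (w ξ * w (a + c - ξ)))) := by
    refine lintegral_mono fun ξ => lintegral_mono fun a => lintegral_mono fun c => ?_
    have j1 := jap_pos ξ
    have j2 := jap_pos a
    have j3 := jap_pos (a + c - ξ)
    have j4 := jap_pos c
    have hk := resKer_pos δ (resPhase ξ a c)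
    have hΩ : resPhase ξ a c = 4 * Real.pi ^ 2 *
        (jap ξ ^ 2 + jap (a + c - ξ) ^ 2 - jap a ^ 2 - jap c ^ 2) := by
      simp only [jap_sq, resPhase]; ring
    have h := rpow_mul_resWt_le hδ hδ1 (one_le_jap ξ) (one_le_jap (a + c - ξ)) (one_le_jap a)
      (one_le_jap c)
      (by have := jap_add_sub_le a c (a + c - ξ); rw [sub_sub_cancel] at this; linarith)
      (by linarith [jap_add_sub_le a c ξ])
      (by have := jap_add_sub_le ξ (a + c - ξ) c
          rw [show ξ + (a + c - ξ) - c = a by abel] at this; linarith)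
      (by have := jap_add_sub_le ξ (a + c - ξ) a
          rw [show ξ + (a + c - ξ) - a = c by abel] at this; linarith) _ hΩ
    rw [← maxJap] at h
    have h' := ENNReal.ofReal_le_ofReal h
    rw [ENNReal.ofReal_mul (p := (1296 : ℝ)) (by norm_num),
      ENNReal.ofReal_mul (p := jap ξ * jap (a + c - ξ) * (jap a * jap c)) (by positivity),
      ENNReal.ofReal_add (by positivity) (by positivity),
      ENNReal.ofReal_add (by positivity) (by positivity), Real.mul_rpow j2.le j4.le,
      Real.mul_rpow j1.le j3.le, ENNReal.ofReal_mul (p := jap a ^ _) (by positivity),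
      ENNReal.ofReal_mul (p := jap ξ ^ _) (by positivity),
      ENNReal.ofReal_mul (p := jap ξ * _) (by positivity), ENNReal.ofReal_mul j1.le,
      ENNReal.ofReal_mul j2.le, ENNReal.ofReal_ofNat] at h'
    refine (mul_le_mul_right h' _).trans_eq ?_
    simp only [a₁, a₂, a₃, a₄, hw]
    ring
  have hsum : ∫⁻ ξ, ∫⁻ a, ∫⁻ c, 1296 * ((a₁ ξ * a₂ a * a₃ (a + c - ξ) * a₄ c *
      ENNReal.ofReal (√(ratioSq δ (jap ξ) (jap (a + c - ξ))) * √(ratioSq δ (jap a) (jap c))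
        * resKer δ (resPhase ξ a c)))
        + (a₁ ξ * a₂ a * a₃ (a + c - ξ) * a₄ c * (w a * w c))
        + (a₁ ξ * a₂ a * a₃ (a + c - ξ) * a₄ c * (w ξ * w (a + c - ξ))))
      = 1296 * ((∫⁻ ξ, ∫⁻ a, ∫⁻ c, a₁ ξ * a₂ a * a₃ (a + c - ξ) * a₄ c *
      ENNReal.ofReal (√(ratioSq δ (jap ξ) (jap (a + c - ξ))) * √(ratioSq δ (jap a) (jap c))
        * resKer δ (resPhase ξ a c)))
        + (∫⁻ ξ, ∫⁻ a, ∫⁻ c, a₁ ξ * a₂ a * a₃ (a + c - ξ) * a₄ c * (w a * w c))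
        + ∫⁻ ξ, ∫⁻ a, ∫⁻ c, a₁ ξ * a₂ a * a₃ (a + c - ξ) * a₄ c * (w ξ * w (a + c - ξ))) := by
    have hr : Measurable fun z : Rn 3 × Rn 3 × Rn 3 => resPhase z.1 z.2.1 z.2.2 :=
      continuous_resPhase.measurable
    rw [← lintegral_triple (by fun_prop), ← lintegral_triple (by fun_prop),
      ← lintegral_triple (by fun_prop), ← lintegral_triple (by fun_prop),
      lintegral_const_mul _ (by fun_prop), lintegral_add_left (by fun_prop),
      lintegral_add_left (by fun_prop)]
  rw [hsum] at hpt
  calc _ ≤ _ := pow_le_pow_left' hpt 2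
    _ ≤ 1296 ^ 2 * _ := (mul_pow _ _ _).trans_le (mul_le_mul_right t _)
    _ = _ := by
      simp only [P, wnormSq, a₁, a₂, a₃, a₄]
      ring

/-- The cutoff weight, equal to `1` for `x ≤ M` and to `(M / x) ^ e` for `M ≤ x`. -/
def cut (M e x : ℝ) : ℝ := (min 1 (M / x)) ^ e

section cut
variable {M e x y : ℝ}

lemma cut_base_pos (hM : 0 < M) (hx : 0 < x) : 0 < min 1 (M / x) := lt_min one_pos (by positivity)

lemma cut_pos (hM : 0 < M) (hx : 0 < x) : 0 < cut M e x := Real.rpow_pos_of_pos (cut_base_pos hM hx) _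

lemma cut_le_one (hM : 0 < M) (hx : 0 < x) (he : 0 ≤ e) : cut M e x ≤ 1 :=
  Real.rpow_le_one (cut_base_pos hM hx).le (min_le_left _ _) he

lemma cut_anti (hM : 0 < M) (hx : 0 < x) (he : 0 ≤ e) (hxy : x ≤ y) : cut M e y ≤ cut M e x := by
  have := cut_base_pos hM (hx.trans_le hxy)
  unfold cut
  gcongr

lemma cut_anti_exp {r : ℝ} (hM : 0 < M) (hx : 0 < x) (he : e ≤ r) : cut M r x ≤ cut M e x :=
  Real.rpow_le_rpow_of_exponent_ge (cut_base_pos hM hx) (min_le_left _ _) he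

lemma cut_add (hM : 0 < M) (hx : 0 < x) (e r : ℝ) : cut M (e + r) x = cut M e x * cut M r x :=
  Real.rpow_add (cut_base_pos hM hx) _ _

lemma cut_eq_one (hx : 0 < x) (h : x ≤ M) : cut M e x = 1 := by
  rw [cut, min_eq_left ((one_le_div hx).2 h), Real.one_rpow]

lemma cut_eq_rpow (hx : 0 < x) (h : M ≤ x) : cut M e x = (M / x) ^ e := by
  rw [cut, min_eq_right ((div_le_one hx).2 h)]

lemma rpow_mul_cut_le (hM : 0 < M) (hx : 0 < x) (he : 0 ≤ e) : x ^ e * cut M e x ≤ M ^ e := by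
  rw [cut, ← Real.mul_rpow hx.le (cut_base_pos hM hx).le]
  refine Real.rpow_le_rpow (by have := cut_base_pos hM hx; positivity) ?_ he
  calc x * min 1 (M / x) ≤ x * (M / x) := by gcongr; exact min_le_right _ _
    _ = M := by field_simp

lemma mul_cut_mono (hM : 0 < M) (hx : 0 < x) (he : 0 ≤ e) (he1 : e ≤ 1) (hxy : x ≤ y) :
    x * cut M e x ≤ y * cut M e y := by
  have hy := hx.trans_le hxy
  have h1 : ∀ z : ℝ, 0 < z → z * cut M e z = z ^ (1 - e) * (min z M) ^ e := fun z hz => by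
    have : min z M = z * min 1 (M / z) := by
      rw [mul_min_of_nonneg _ _ hz.le, mul_one, mul_div_cancel₀ _ hz.ne']
    rw [this, Real.mul_rpow hz.le (cut_base_pos hM hz).le, ← mul_assoc, ← Real.rpow_add hz, cut]
    simp
  rw [h1 x hx, h1 y hy]
  have : 0 < min x M := lt_min hx hM
  gcongr

lemma cut_le_three_mul (hM : 0 < M) (hy : 0 < y) (hx : 0 < x) (he : 0 ≤ e) (he1 : e ≤ 1)
    (h : x ≤ 3 * y) : cut M e y ≤ 3 * cut M e x := by
  rcases le_total x y with hxy | hxy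
  · have := cut_anti hM hx he hxy
    have := cut_pos (e := e) hM hx
    linarith
  · have := mul_cut_mono hM hy he he1 hxy
    have h2 : x * cut M e x ≤ y * (3 * cut M e x) := by
      have := cut_pos (e := e) hM hx
      nlinarith
    exact le_of_mul_le_mul_left (this.trans h2) hy

end cut

@[fun_prop] lemma measurable_cut (M e : ℝ) : Measurable (cut M e) := by
  unfold cut; fun_prop

lemma continuous_cut_jap {M e : ℝ} (hM : 0 < M) :
    Continuous fun ξ : Rn 3 => cut M e (jap ξ) := by
  unfold cut
  have := continuous_jap (n := 3)
  refine Continuous.rpow_const ?_ fun ξ => Or.inl (cut_base_pos hM (jap_pos ξ)).ne'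
  exact continuous_const.min (continuous_const.div this fun ξ => (jap_pos ξ).ne')

section osc
variable {G G' : ℝ → ℂ} {a b : ℝ}

lemma norm_le_add_integral_deriv (hG : ContinuousOn G (Icc a b))
    (hd : ∀ t ∈ Ioo a b, HasDerivAt G (G' t) t) (hG' : Continuous G') {t : ℝ}
    (ht : t ∈ Icc a b) : ‖G t‖ ≤ ‖G a‖ + ∫ s in a..b, ‖G' s‖ := by
  have h := intervalIntegral.integral_eq_sub_of_hasDerivAt_of_le ht.1
    (hG.mono (Icc_subset_Icc_right ht.2)) (fun s hs => hd s ⟨hs.1, hs.2.trans_le ht.2⟩)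
    (hG'.intervalIntegrable _ _)
  have h1 : ‖∫ s in a..t, G' s‖ ≤ ∫ s in a..t, ‖G' s‖ :=
    intervalIntegral.norm_integral_le_integral_norm ht.1
  have h2 : ∫ s in a..t, ‖G' s‖ ≤ ∫ s in a..b, ‖G' s‖ :=
    intervalIntegral.integral_mono_interval le_rfl ht.1 ht.2 (.of_forall fun s => norm_nonneg _)
      (hG'.norm.intervalIntegrable _ _)
  rw [show G t = G a + ∫ s in a..t, G' s by rw [h]; ring]
  exact (norm_add_le _ _).trans (by linarith)

/-- An oscillatory integral over an interval of length at most one. -/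
lemma norm_integral_mul_exp_le (hab : a ≤ b) (hb : b - a ≤ 1) (hG : Continuous G)
    (hd : ∀ t ∈ Ioo a b, HasDerivAt G (G' t) t) (hG' : Continuous G') (Ω : ℝ) :
    ‖∫ t in a..b, G t * exp (I * (Ω * t : ℝ))‖
      ≤ 2 * resWt Ω * (‖G a‖ + ∫ t in a..b, ‖G' t‖) := by
  have hsup := fun t ht => norm_le_add_integral_deriv (t := t) hG.continuousOn hd hG' ht
  have hI : 0 ≤ ∫ t in a..b, ‖G' t‖ := intervalIntegral.integral_nonneg hab fun t _ => norm_nonneg _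
  set A := ‖G a‖ + ∫ t in a..b, ‖G' t‖ with hA
  have hA0 : 0 ≤ A := by positivity
  have he : ∀ t : ℝ, ‖exp (I * (Ω * t : ℝ))‖ = 1 := fun t => by
    rw [mul_comm, norm_exp_ofReal_mul_I]
  rcases le_or_gt |Ω| 1 with h | h
  · rw [resWt, max_eq_left h]
    refine (intervalIntegral.norm_integral_le_of_norm_le_const (C := A) fun t ht => ?_).trans ?_
    · rw [norm_mul, he, mul_one]
      rw [uIoc_of_le hab] at ht
      exact hsup t ⟨ht.1.le, ht.2⟩
    · rw [abs_of_nonneg (by linarith)]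
      nlinarith
  · rw [resWt, max_eq_right h.le]
    have hΩ : (Ω : ℂ) ≠ 0 := by
      rintro h0
      rw [Complex.ofReal_eq_zero] at h0
      norm_num [h0] at h
    have hE : ∀ t : ℝ, HasDerivAt (fun t : ℝ => exp (I * (Ω * t : ℝ)))
        (exp (I * (Ω * t : ℝ)) * (I * Ω)) t := fun t => by
      have h0 : HasDerivAt (fun t : ℝ => (I * (Ω * t : ℝ))) (I * Ω) t := by
        have := ((hasDerivAt_id t).const_mul Ω).ofReal_comp.const_mul I
        simpa using this
      exact h0.cexp
    have hcE : Continuous fun t : ℝ => exp (I * (Ω * t : ℝ)) := by fun_prop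
    have hFTC := intervalIntegral.integral_eq_sub_of_hasDerivAt_of_le hab
      (f := fun t => G t * exp (I * (Ω * t : ℝ)))
      (f' := fun t => G' t * exp (I * (Ω * t : ℝ)) + G t * (exp (I * (Ω * t : ℝ)) * (I * Ω)))
      (hG.mul hcE).continuousOn (fun t ht => (hd t ht).mul (hE t))
      (Continuous.intervalIntegrable (by fun_prop) _ _)
    rw [intervalIntegral.integral_add (Continuous.intervalIntegrable (by fun_prop) _ _)
      (Continuous.intervalIntegrable (by fun_prop) _ _)] at hFTC
    have h1 : ∫ t in a..b, G t * (exp (I * (Ω * t : ℝ)) * (I * Ω))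
        = (∫ t in a..b, G t * exp (I * (Ω * t : ℝ))) * (I * Ω) := by
      rw [← intervalIntegral.integral_mul_const]
      congr 1; ext t; ring
    rw [h1] at hFTC
    have h2 : ‖(∫ t in a..b, G t * exp (I * (Ω * t : ℝ))) * (I * Ω)‖ ≤ 2 * A := by
      rw [show (∫ t in a..b, G t * exp (I * (Ω * t : ℝ))) * (I * Ω)
        = (G b * exp (I * (Ω * b : ℝ)) - G a * exp (I * (Ω * a : ℝ)))
          - ∫ t in a..b, G' t * exp (I * (Ω * t : ℝ)) by rw [← hFTC]; ring]
      refine (norm_sub_le _ _).trans ?_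
      have h3 : ‖∫ t in a..b, G' t * exp (I * (Ω * t : ℝ))‖ ≤ ∫ t in a..b, ‖G' t‖ := by
        refine (intervalIntegral.norm_integral_le_integral_norm hab).trans_eq ?_
        congr 1; ext t; rw [norm_mul, he, mul_one]
      have h4 := norm_sub_le (G b * exp (I * (Ω * b : ℝ))) (G a * exp (I * (Ω * a : ℝ)))
      rw [norm_mul, norm_mul, he, he, mul_one, mul_one] at h4
      have := hsup b ⟨hab, le_rfl⟩
      linarith
    rw [norm_mul, norm_mul, norm_I, one_mul, norm_real, Real.norm_eq_abs] at h2
    rw [mul_comm (2 : ℝ), mul_assoc, inv_mul_eq_div, le_div_iff₀ (by linarith)]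
    exact h2

end osc

/-- Polynomial decay in frequency, uniformly in time. -/
def Decays (f : ℝ → Rn 3 → ℂ) : Prop :=
  ∀ k : ℕ, ∃ D : ℝ, ∀ t ξ, jap ξ ^ k * ‖f t ξ‖ ≤ D

/-- The trilinear convolution with symbol `σ`. -/
def triSym (σ : Rn 3 → Rn 3 → Rn 3 → ℝ) (f : Rn 3 → ℂ) (ξ : Rn 3) : ℂ :=
  ∫ w : Rn 3 × Rn 3, σ w.1 (w.1 + w.2 - ξ) w.2 *
    (f w.1 * conj (f (w.1 + w.2 - ξ)) * f w.2)

/-- The quadrilinear density. -/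
def quart (f₁ f₂ f₃ f₄ : Rn 3 → ℂ) (z : Rn 3 × Rn 3 × Rn 3) : ℂ :=
  conj (f₁ z.1) * f₂ z.2.1 * conj (f₃ (z.2.1 + z.2.2 - z.1)) * f₄ z.2.2

lemma integrable_inv_jap_pow : Integrable fun ξ : Rn 3 => (jap ξ ^ 4)⁻¹ := by
  have h := integrable_jap_rpow (r := 4) (by norm_num)
  refine h.congr (.of_forall fun ξ => ?_)
  simp only
  rw [Real.rpow_neg (jap_pos ξ).le]
  norm_cast

lemma integrable_inv_jap_pow_pair :
    Integrable fun w : Rn 3 × Rn 3 => ((jap w.1 * jap w.2) ^ 4)⁻¹ := by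
  refine (integrable_inv_jap_pow.mul_prod integrable_inv_jap_pow).congr (.of_forall fun w => ?_)
  simp only [mul_pow, mul_inv]

/-- Product of the brackets of the components. -/
def japTriple (z : Rn 3 × Rn 3 × Rn 3) : ℝ := jap z.1 * jap z.2.1 * jap z.2.2

lemma one_le_japTriple (z : Rn 3 × Rn 3 × Rn 3) : 1 ≤ japTriple z :=
  one_le_mul_of_one_le_of_one_le
    (one_le_mul_of_one_le_of_one_le (one_le_jap _) (one_le_jap _)) (one_le_jap _)

lemma japTriple_pos (z : Rn 3 × Rn 3 × Rn 3) : 0 < japTriple z :=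
  zero_lt_one.trans_le (one_le_japTriple z)

lemma integrable_inv_japTriple_pow :
    Integrable fun z : Rn 3 × Rn 3 × Rn 3 => (japTriple z ^ 4)⁻¹ := by
  refine (integrable_inv_jap_pow.mul_prod integrable_inv_jap_pow_pair).congr
    (.of_forall fun z => ?_)
  simp only [japTriple, mul_pow, mul_inv, mul_assoc]

lemma Decays.bound {f : ℝ → Rn 3 → ℂ} (hf : Decays f) : ∃ D, 0 ≤ D ∧ ∀ t ξ, ‖f t ξ‖ ≤ D := by
  obtain ⟨D, hD⟩ := hf 0
  refine ⟨D, ?_, fun t ξ => by simpa using hD t ξ⟩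
  simpa using (norm_nonneg _).trans (by simpa using hD 0 0)

lemma Decays.exists_nonneg {f : ℝ → Rn 3 → ℂ} (hf : Decays f) (k : ℕ) :
    ∃ D, 0 ≤ D ∧ ∀ t ξ, jap ξ ^ k * ‖f t ξ‖ ≤ D := by
  obtain ⟨D, hD⟩ := hf k
  have := jap_pos (0 : Rn 3)
  exact ⟨D, le_trans (by positivity) (hD 0 0), hD⟩

lemma Decays.mul_left {f : ℝ → Rn 3 → ℂ} (hf : Decays f) {g : Rn 3 → ℝ} {L : ℝ} {n : ℕ}
    (hg : ∀ ξ, |g ξ| ≤ L * jap ξ ^ n) : Decays fun t ξ => (g ξ : ℂ) * f t ξ := by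
  intro k
  obtain ⟨D, hD⟩ := hf (k + n)
  refine ⟨L * D, fun t ξ => ?_⟩
  have hj := jap_pos ξ
  have hL : 0 ≤ L := by
    have := (abs_nonneg _).trans (hg ξ)
    exact nonneg_of_mul_nonneg_left this (by positivity)
  rw [norm_mul, norm_real, Real.norm_eq_abs]
  calc jap ξ ^ k * (|g ξ| * ‖f t ξ‖) ≤ jap ξ ^ k * ((L * jap ξ ^ n) * ‖f t ξ‖) := by
        gcongr; exact hg ξ
    _ = L * (jap ξ ^ (k + n) * ‖f t ξ‖) := by ring
    _ ≤ L * D := by gcongr; exact hD t ξ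

lemma Decays.add {f g : ℝ → Rn 3 → ℂ} (hf : Decays f) (hg : Decays g) :
    Decays fun t ξ => f t ξ + g t ξ := by
  intro k
  obtain ⟨D, hD⟩ := hf k
  obtain ⟨E, hE⟩ := hg k
  refine ⟨D + E, fun t ξ => ?_⟩
  have hj := jap_pos ξ
  calc _ ≤ jap ξ ^ k * (‖f t ξ‖ + ‖g t ξ‖) := by gcongr; exact norm_add_le _ _
    _ ≤ _ := by rw [mul_add]; exact add_le_add (hD t ξ) (hE t ξ)

lemma Decays.const_mul {f : ℝ → Rn 3 → ℂ} (hf : Decays f) (c : ℂ) :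
    Decays fun t ξ => c * f t ξ := by
  intro k
  obtain ⟨D, hD⟩ := hf k
  refine ⟨‖c‖ * D, fun t ξ => ?_⟩
  rw [norm_mul, mul_left_comm]
  gcongr
  exact hD t ξ

/-- A pointwise bound for the trilinear density, integrable in the inner variables. -/
lemma Decays.trilinear {f : ℝ → Rn 3 → ℂ} (hf : Decays f) (k : ℕ) :
    ∃ D, 0 ≤ D ∧ ∀ t a b c, (jap a * jap b * jap c) ^ k * ‖f t a * conj (f t b) * f t c‖ ≤
      D * ((jap a * jap c) ^ 4)⁻¹ := by
  obtain ⟨D, hD0, hD⟩ := hf.exists_nonneg (k + 4)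
  obtain ⟨E, hE0, hE⟩ := hf.exists_nonneg k
  refine ⟨D * E * D, by positivity, fun t a b c => ?_⟩
  have ha := jap_pos a
  have hb := jap_pos b
  have hc := jap_pos c
  rw [← div_eq_mul_inv, le_div_iff₀ (by positivity), norm_mul, norm_mul, RCLike.norm_conj]
  calc _ = (jap a ^ (k + 4) * ‖f t a‖) * (jap b ^ k * ‖f t b‖) * (jap c ^ (k + 4) * ‖f t c‖) := by
        ring
    _ ≤ _ := by gcongr <;> first | exact hD t _ | exact hE t _

lemma decays_triSym {f : ℝ → Rn 3 → ℂ} (hf : Decays f) {σ : Rn 3 → Rn 3 → Rn 3 → ℝ} {L : ℝ}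
    (hσ : ∀ a b c, |σ a b c| ≤ L * (jap a * jap b * jap c)) :
    Decays fun t => triSym σ (f t) := by
  intro k
  obtain ⟨D, hD0, hD⟩ := hf.trilinear (k + 1)
  have hL : 0 ≤ L := by
    have := (abs_nonneg _).trans (hσ 0 0 0)
    have h0 := jap_pos (0 : Rn 3)
    exact nonneg_of_mul_nonneg_left this (by positivity)
  refine ⟨∫ w : Rn 3 × Rn 3, 3 ^ k * L * D * ((jap w.1 * jap w.2) ^ 4)⁻¹, fun t ξ => ?_⟩
  have hj := jap_pos ξ
  simp only [triSym]
  have : jap ξ ^ k * ‖∫ w : Rn 3 × Rn 3, σ w.1 (w.1 + w.2 - ξ) w.2 *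
      (f t w.1 * conj (f t (w.1 + w.2 - ξ)) * f t w.2)‖
      = ‖∫ w : Rn 3 × Rn 3, ((jap ξ ^ k : ℝ) : ℂ) * (σ w.1 (w.1 + w.2 - ξ) w.2 *
      (f t w.1 * conj (f t (w.1 + w.2 - ξ)) * f t w.2))‖ := by
    rw [integral_const_mul, norm_mul, norm_real, Real.norm_of_nonneg (by positivity)]
  rw [this]
  refine norm_integral_le_of_norm_le (integrable_inv_jap_pow_pair.const_mul _)
    (.of_forall fun w => ?_)
  set b := w.1 + w.2 - ξ
  have h1 := one_le_jap w.1
  have h2 := one_le_jap b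
  have h3 := one_le_jap w.2
  have hξ : jap ξ ≤ 3 * (jap w.1 * jap b * jap w.2) := by
    have e : ξ = w.1 + w.2 - b := by simp only [b]; abel
    have := jap_add_sub_le w.1 w.2 b
    rw [← e] at this
    have q1 : jap w.1 ≤ jap w.1 * jap b * jap w.2 := by
      rw [mul_assoc]; exact le_mul_of_one_le_right (by linarith) (one_le_mul_of_one_le_of_one_le h2 h3)
    have q2 : jap b ≤ jap w.1 * jap b * jap w.2 := by
      rw [mul_comm (jap w.1), mul_assoc]
      exact le_mul_of_one_le_right (by linarith) (one_le_mul_of_one_le_of_one_le h1 h3)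
    have q3 : jap w.2 ≤ jap w.1 * jap b * jap w.2 :=
      le_mul_of_one_le_left (by linarith) (one_le_mul_of_one_le_of_one_le h1 h2)
    linarith
  rw [norm_mul, norm_mul, norm_real, norm_real, Real.norm_of_nonneg (by positivity),
    Real.norm_eq_abs]
  have hw := hD t w.1 b w.2
  calc _ ≤ (3 * (jap w.1 * jap b * jap w.2)) ^ k * ((L * (jap w.1 * jap b * jap w.2)) *
        ‖f t w.1 * conj (f t b) * f t w.2‖) := by
        gcongr; exact hσ _ _ _
    _ = 3 ^ k * L * ((jap w.1 * jap b * jap w.2) ^ (k + 1) * ‖f t w.1 * conj (f t b) * f t w.2‖) := by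
        ring
    _ ≤ 3 ^ k * L * (D * ((jap w.1 * jap w.2) ^ 4)⁻¹) := by gcongr
    _ = _ := by ring

lemma measurable_triSym {f : ℝ → Rn 3 → ℂ} (hf : Continuous fun p : ℝ × Rn 3 => f p.1 p.2)
    {σ : Rn 3 → Rn 3 → Rn 3 → ℝ}
    (hσ : Measurable fun z : Rn 3 × Rn 3 × Rn 3 => σ z.1 z.2.1 z.2.2) :
    Measurable fun p : ℝ × Rn 3 => triSym σ (f p.1) p.2 := by
  refine StronglyMeasurable.measurable ?_
  refine StronglyMeasurable.integral_prod_right (f := fun (p : ℝ × Rn 3) (w : Rn 3 × Rn 3) =>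
    (σ w.1 (w.1 + w.2 - p.2) w.2 : ℂ) *
    (f p.1 w.1 * conj (f p.1 (w.1 + w.2 - p.2)) * f p.1 w.2)) ?_
  refine Measurable.stronglyMeasurable ?_
  refine Measurable.mul ?_ (Continuous.measurable ?_)
  · exact measurable_ofReal.comp (hσ.comp (f := fun z : (ℝ × Rn 3) × (Rn 3 × Rn 3) =>
      (z.2.1, z.2.1 + z.2.2 - z.1.2, z.2.2)) (by fun_prop))
  · have c1 : Continuous fun z : (ℝ × Rn 3) × (Rn 3 × Rn 3) => f z.1.1 z.2.1 :=
      hf.comp (f := fun z : (ℝ × Rn 3) × (Rn 3 × Rn 3) => (z.1.1, z.2.1)) (by fun_prop)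
    have c2 : Continuous fun z : (ℝ × Rn 3) × (Rn 3 × Rn 3) => f z.1.1 (z.2.1 + z.2.2 - z.1.2) :=
      hf.comp (f := fun z : (ℝ × Rn 3) × (Rn 3 × Rn 3) => (z.1.1, z.2.1 + z.2.2 - z.1.2))
        (by fun_prop)
    have c3 : Continuous fun z : (ℝ × Rn 3) × (Rn 3 × Rn 3) => f z.1.1 z.2.2 :=
      hf.comp (f := fun z : (ℝ × Rn 3) × (Rn 3 × Rn 3) => (z.1.1, z.2.2)) (by fun_prop)
    have := continuous_conj.comp c2
    exact (c1.mul this).mul c3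

lemma continuous_triSym_one {f : ℝ → Rn 3 → ℂ} (hf : Continuous fun p : ℝ × Rn 3 => f p.1 p.2)
    (hd : Decays f) :
    Continuous fun p : ℝ × Rn 3 => triSym (fun _ _ _ => 1) (f p.1) p.2 := by
  obtain ⟨D, hD0, hD⟩ := hd.trilinear 0
  refine continuous_of_dominated (F := fun (p : ℝ × Rn 3) (w : Rn 3 × Rn 3) =>
    ((1 : ℝ) : ℂ) * (f p.1 w.1 * conj (f p.1 (w.1 + w.2 - p.2)) * f p.1 w.2))
    (bound := fun w => D * ((jap w.1 * jap w.2) ^ 4)⁻¹) (fun p => ?_)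
    (fun p => .of_forall fun w => ?_) (integrable_inv_jap_pow_pair.const_mul _)
    (.of_forall fun w => ?_)
  · refine Continuous.aestronglyMeasurable ?_
    have c1 : Continuous fun w : Rn 3 × Rn 3 => f p.1 w.1 :=
      hf.comp (f := fun w : Rn 3 × Rn 3 => (p.1, w.1)) (by fun_prop)
    have c2 : Continuous fun w : Rn 3 × Rn 3 => f p.1 (w.1 + w.2 - p.2) :=
      hf.comp (f := fun w : Rn 3 × Rn 3 => (p.1, w.1 + w.2 - p.2)) (by fun_prop)
    have c3 : Continuous fun w : Rn 3 × Rn 3 => f p.1 w.2 :=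
      hf.comp (f := fun w : Rn 3 × Rn 3 => (p.1, w.2)) (by fun_prop)
    have := continuous_conj.comp c2
    exact continuous_const.mul ((c1.mul this).mul c3)
  · have := hD p.1 w.1 (w.1 + w.2 - p.2) w.2
    simpa using this
  · have c1 : Continuous fun p : ℝ × Rn 3 => f p.1 w.1 :=
      hf.comp (f := fun p : ℝ × Rn 3 => (p.1, w.1)) (by fun_prop)
    have c2 : Continuous fun p : ℝ × Rn 3 => f p.1 (w.1 + w.2 - p.2) :=
      hf.comp (f := fun p : ℝ × Rn 3 => (p.1, w.1 + w.2 - p.2)) (by fun_prop)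
    have c3 : Continuous fun p : ℝ × Rn 3 => f p.1 w.2 :=
      hf.comp (f := fun p : ℝ × Rn 3 => (p.1, w.2)) (by fun_prop)
    have := continuous_conj.comp c2
    exact continuous_const.mul ((c1.mul this).mul c3)

/-- Fourier-side description of a solution of the cubic equation on `[0, T]`. -/
structure CubicProfile (T : ℝ) (u : ℝ → Rn 3 → ℂ) : Prop where
  cont : Continuous fun p : ℝ × Rn 3 => u p.1 p.2
  decays : Decays u
  deriv : ∀ t ∈ Ioo 0 T, ∀ ξ, HasDerivAt (fun t => u t ξ)
    (-I * ((4 * Real.pi ^ 2 * ‖ξ‖ ^ 2 : ℝ) * u t ξ + triSym (fun _ _ _ => 1) (u t) ξ)) t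

/-- The quadrilinear density for nonnegative functions. -/
def quartE (f₁ f₂ f₃ f₄ : Rn 3 → ENNReal) (z : Rn 3 × Rn 3 × Rn 3) : ENNReal :=
  f₁ z.1 * f₂ z.2.1 * f₃ (z.2.1 + z.2.2 - z.1) * f₄ z.2.2

lemma enorm_quart (f₁ f₂ f₃ f₄ : Rn 3 → ℂ) (z : Rn 3 × Rn 3 × Rn 3) :
    ‖quart f₁ f₂ f₃ f₄ z‖ₑ
      = quartE (fun x => ‖f₁ x‖ₑ) (fun x => ‖f₂ x‖ₑ) (fun x => ‖f₃ x‖ₑ) (fun x => ‖f₄ x‖ₑ) z := by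
  simp only [quart, quartE, enorm_mul, RCLike.enorm_conj]

lemma measurable_quartE {α : Type*} [MeasurableSpace α] {f₁ f₂ f₃ f₄ : α → Rn 3 → ENNReal}
    (h₁ : Measurable fun p : α × Rn 3 => f₁ p.1 p.2) (h₂ : Measurable fun p : α × Rn 3 => f₂ p.1 p.2)
    (h₃ : Measurable fun p : α × Rn 3 => f₃ p.1 p.2)
    (h₄ : Measurable fun p : α × Rn 3 => f₄ p.1 p.2) :
    Measurable fun p : α × Rn 3 × Rn 3 × Rn 3 => quartE (f₁ p.1) (f₂ p.1) (f₃ p.1) (f₄ p.1) p.2 := by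
  have e1 := h₁.comp (f := fun p : α × Rn 3 × Rn 3 × Rn 3 => (p.1, p.2.1)) (by fun_prop)
  have e2 := h₂.comp (f := fun p : α × Rn 3 × Rn 3 × Rn 3 => (p.1, p.2.2.1)) (by fun_prop)
  have e3 := h₃.comp (f := fun p : α × Rn 3 × Rn 3 × Rn 3 => (p.1, p.2.2.1 + p.2.2.2 - p.2.1))
    (by fun_prop)
  have e4 := h₄.comp (f := fun p : α × Rn 3 × Rn 3 × Rn 3 => (p.1, p.2.2.2)) (by fun_prop)
  exact ((e1.mul e2).mul e3).mul e4

lemma continuous_quart {α : Type*} [TopologicalSpace α] {f₁ f₂ f₃ f₄ : α → Rn 3 → ℂ}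
    (h₁ : Continuous fun p : α × Rn 3 => f₁ p.1 p.2) (h₂ : Continuous fun p : α × Rn 3 => f₂ p.1 p.2)
    (h₃ : Continuous fun p : α × Rn 3 => f₃ p.1 p.2)
    (h₄ : Continuous fun p : α × Rn 3 => f₄ p.1 p.2) :
    Continuous fun p : α × Rn 3 × Rn 3 × Rn 3 => quart (f₁ p.1) (f₂ p.1) (f₃ p.1) (f₄ p.1) p.2 := by
  have e1 := continuous_conj.comp (h₁.comp
    (f := fun p : α × Rn 3 × Rn 3 × Rn 3 => (p.1, p.2.1)) (by fun_prop))
  have e2 := h₂.comp (f := fun p : α × Rn 3 × Rn 3 × Rn 3 => (p.1, p.2.2.1)) (by fun_prop)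
  have e3 := continuous_conj.comp (h₃.comp
    (f := fun p : α × Rn 3 × Rn 3 × Rn 3 => (p.1, p.2.2.1 + p.2.2.2 - p.2.1)) (by fun_prop))
  have e4 := h₄.comp (f := fun p : α × Rn 3 × Rn 3 × Rn 3 => (p.1, p.2.2.2)) (by fun_prop)
  exact ((e1.mul e2).mul e3).mul e4

lemma Decays.quart {f₁ f₂ f₃ f₄ : ℝ → Rn 3 → ℂ} (h₁ : Decays f₁) (h₂ : Decays f₂)
    (h₃ : Decays f₃) (h₄ : Decays f₄) (k : ℕ) :
    ∃ D, 0 ≤ D ∧ ∀ t z, japTriple z ^ k * ‖quart (f₁ t) (f₂ t) (f₃ t) (f₄ t) z‖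
      ≤ D * (japTriple z ^ 4)⁻¹ := by
  obtain ⟨D₁, p₁, hD₁⟩ := h₁.exists_nonneg (k + 4)
  obtain ⟨D₂, p₂, hD₂⟩ := h₂.exists_nonneg (k + 4)
  obtain ⟨D₃, p₃, hD₃⟩ := h₃.bound
  obtain ⟨D₄, p₄, hD₄⟩ := h₄.exists_nonneg (k + 4)
  refine ⟨D₁ * D₂ * D₃ * D₄, by positivity, fun t z => ?_⟩
  have j := japTriple_pos z
  have j1 := jap_pos z.1
  have j2 := jap_pos z.2.1
  have j3 := jap_pos z.2.2
  rw [← div_eq_mul_inv, le_div_iff₀ (by positivity), _root_.quart, norm_mul, norm_mul, norm_mul,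
    RCLike.norm_conj, RCLike.norm_conj, japTriple]
  calc _ = (jap z.1 ^ (k + 4) * ‖f₁ t z.1‖) * (jap z.2.1 ^ (k + 4) * ‖f₂ t z.2.1‖) *
      ‖f₃ t (z.2.1 + z.2.2 - z.1)‖ * (jap z.2.2 ^ (k + 4) * ‖f₄ t z.2.2‖) := by ring
    _ ≤ _ := by
      gcongr
      exacts [hD₁ t _, hD₂ t _, hD₃ t _, hD₄ t _]

lemma maxJap_le (ξ a c : Rn 3) : maxJap ξ a c ≤ 3 * japTriple (ξ, a, c) := by
  have h1 := one_le_jap ξ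
  have h2 := one_le_jap a
  have h3 := one_le_jap c
  have h := jap_add_sub_le a c ξ
  have q1 : jap ξ ≤ japTriple (ξ, a, c) := by
    simp only [japTriple]; rw [mul_assoc]
    exact le_mul_of_one_le_right (by linarith) (one_le_mul_of_one_le_of_one_le h2 h3)
  have q2 : jap a ≤ japTriple (ξ, a, c) := by
    simp only [japTriple]; rw [mul_comm (jap ξ), mul_assoc]
    exact le_mul_of_one_le_right (by linarith) (one_le_mul_of_one_le_of_one_le h1 h3)
  have q3 : jap c ≤ japTriple (ξ, a, c) :=
    le_mul_of_one_le_left (by linarith) (one_le_mul_of_one_le_of_one_le h1 h2)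
  unfold maxJap
  refine max_le (max_le ?_ ?_) (max_le ?_ ?_) <;> linarith

lemma one_le_maxJap (ξ a c : Rn 3) : 1 ≤ maxJap ξ a c :=
  (one_le_jap ξ).trans ((le_max_left _ _).trans (le_max_left _ _))

/-- The resonant kernel damped by a cutoff of the largest frequency. -/
def cutKer (δ M p r : ℝ) (z : Rn 3 × Rn 3 × Rn 3) : ℝ :=
  maxJap z.1 z.2.1 z.2.2 ^ (3 - 4 * δ) *
    (cut M p (maxJap z.1 z.2.1 z.2.2) ^ 3 * cut M r (maxJap z.1 z.2.1 z.2.2))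

lemma cutKer_nonneg {δ M p r : ℝ} (hM : 0 < M) (z : Rn 3 × Rn 3 × Rn 3) : 0 ≤ cutKer δ M p r z := by
  have h := zero_lt_one.trans_le (one_le_maxJap z.1 z.2.1 z.2.2)
  have := cut_pos (e := p) hM h
  have := cut_pos (e := r) hM h
  unfold cutKer; positivity

lemma cutKer_le {δ M p r : ℝ} (hδ : 0 < δ) (hM : 0 < M) (hp : 0 ≤ p) (hr : 0 ≤ r)
    (z : Rn 3 × Rn 3 × Rn 3) : cutKer δ M p r z ≤ 27 * japTriple z ^ 3 := by
  have h1 := one_le_maxJap z.1 z.2.1 z.2.2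
  have h := zero_lt_one.trans_le h1
  have := cut_pos (e := p) hM h
  have := cut_pos (e := r) hM h
  have h2 : maxJap z.1 z.2.1 z.2.2 ^ (3 - 4 * δ) ≤ maxJap z.1 z.2.1 z.2.2 ^ 3 := by
    rw [← Real.rpow_natCast]
    exact Real.rpow_le_rpow_of_exponent_le h1 (by push_cast; linarith)
  have h3 : cut M p (maxJap z.1 z.2.1 z.2.2) ^ 3 * cut M r (maxJap z.1 z.2.1 z.2.2) ≤ 1 :=
    mul_le_one₀ (pow_le_one₀ (cut_pos hM h).le (cut_le_one hM h hp)) (by positivity)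
      (cut_le_one hM h hr)
  calc cutKer δ M p r z ≤ maxJap z.1 z.2.1 z.2.2 ^ 3 * 1 := by
        unfold cutKer; gcongr
    _ ≤ (3 * japTriple z) ^ 3 * 1 := by gcongr; exact maxJap_le _ _ _
    _ = _ := by ring

@[fun_prop] lemma measurable_cutKer (δ M p r : ℝ) : Measurable (cutKer δ M p r) := by
  have := measurable_maxJap
  unfold cutKer; fun_prop

@[fun_prop] lemma measurable_resWt_resPhase :
    Measurable fun z : Rn 3 × Rn 3 × Rn 3 => resWt (resPhase z.1 z.2.1 z.2.2) :=
  (continuous_resWt.comp continuous_resPhase).measurable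

/-- The resonant form with cutoffs. -/
theorem exists_lintegral_cut_quad_le {δ : ℝ} (hδ : 0 < δ) (hδ1 : δ ≤ 1 / 4) :
    ∃ C < (⊤ : ENNReal), ∀ b₁ b₂ b₃ b₄ : Rn 3 → ENNReal, Measurable b₁ → Measurable b₂ →
    Measurable b₃ → Measurable b₄ → ∀ M e₁ e₂ e₃ e₄ : ℝ, 0 < M → 0 ≤ e₁ → 0 ≤ e₂ → 0 ≤ e₃ → 0 ≤ e₄ →
    (∫⁻ z : Rn 3 × Rn 3 × Rn 3, quartE b₁ b₂ b₃ b₄ z *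
      ENNReal.ofReal (maxJap z.1 z.2.1 z.2.2 ^ (3 - 4 * δ) *
      (cut M e₁ (maxJap z.1 z.2.1 z.2.2) * cut M e₂ (maxJap z.1 z.2.1 z.2.2) *
        cut M e₃ (maxJap z.1 z.2.1 z.2.2) * cut M e₄ (maxJap z.1 z.2.1 z.2.2)) *
        resWt (resPhase z.1 z.2.1 z.2.2))) ^ 2
      ≤ C * (wnormSq (fun x => jap x * cut M e₁ (jap x)) b₁ *
        wnormSq (fun x => jap x * cut M e₂ (jap x)) b₂ *
        wnormSq (fun x => jap x * cut M e₃ (jap x)) b₃ *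
        wnormSq (fun x => jap x * cut M e₄ (jap x)) b₄) := by
  obtain ⟨C, hC, h⟩ := exists_lintegral_quad_le hδ hδ1
  refine ⟨C, hC, fun b₁ b₂ b₃ b₄ h1 h2 h3 h4 M e₁ e₂ e₃ e₄ hM p1 p2 p3 p4 => ?_⟩
  have key := h (fun x => ENNReal.ofReal (cut M e₁ (jap x)) * b₁ x)
    (fun x => ENNReal.ofReal (cut M e₂ (jap x)) * b₂ x)
    (fun x => ENNReal.ofReal (cut M e₃ (jap x)) * b₃ x)
    (fun x => ENNReal.ofReal (cut M e₄ (jap x)) * b₄ x) (by fun_prop) (by fun_prop) (by fun_prop)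
    (by fun_prop)
  have hw : ∀ (e : ℝ) (b : Rn 3 → ENNReal), wnormSq jap (fun x => ENNReal.ofReal (cut M e (jap x)) * b x)
      = wnormSq (fun x => jap x * cut M e (jap x)) b := fun e b => by
    simp only [wnormSq]
    refine lintegral_congr fun x => ?_
    rw [ENNReal.ofReal_mul (jap_pos x).le, mul_assoc]
  rw [hw, hw, hw, hw] at key
  refine le_trans ?_ key
  have hm := measurable_maxJap
  have hr := measurable_resWt_resPhase
  rw [← lintegral_triple (by fun_prop)]
  refine pow_le_pow_left' (lintegral_mono fun z => ?_) 2
  set X := maxJap z.1 z.2.1 z.2.2 with hX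
  have l1 : jap z.1 ≤ X := (le_max_left _ _).trans (le_max_left _ _)
  have l3 : jap (z.2.1 + z.2.2 - z.1) ≤ X := (le_max_right _ _).trans (le_max_left _ _)
  have l2 : jap z.2.1 ≤ X := (le_max_left _ _).trans (le_max_right _ _)
  have l4 : jap z.2.2 ≤ X := (le_max_right _ _).trans (le_max_right _ _)
  have hX0 : 0 < X := (jap_pos _).trans_le l1
  have c1 := cut_anti hM (jap_pos _) p1 l1
  have c2 := cut_anti hM (jap_pos _) p2 l2
  have c3 := cut_anti hM (jap_pos _) p3 l3
  have c4 := cut_anti hM (jap_pos _) p4 l4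
  have q1 := cut_pos (e := e₁) hM hX0
  have q2 := cut_pos (e := e₂) hM hX0
  have q3 := cut_pos (e := e₃) hM hX0
  have q4 := cut_pos (e := e₄) hM hX0
  have hres := resWt_pos (resPhase z.1 z.2.1 z.2.2)
  calc _ = quartE b₁ b₂ b₃ b₄ z * (ENNReal.ofReal (cut M e₁ X) * ENNReal.ofReal (cut M e₂ X) *
        ENNReal.ofReal (cut M e₃ X) * ENNReal.ofReal (cut M e₄ X) *
        ENNReal.ofReal (X ^ (3 - 4 * δ) * resWt (resPhase z.1 z.2.1 z.2.2))) := by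
        rw [← ENNReal.ofReal_mul q1.le, ← ENNReal.ofReal_mul (by positivity),
          ← ENNReal.ofReal_mul (by positivity), ← ENNReal.ofReal_mul (by positivity)]
        congr 2; ring
    _ ≤ quartE b₁ b₂ b₃ b₄ z * (ENNReal.ofReal (cut M e₁ (jap z.1)) *
        ENNReal.ofReal (cut M e₂ (jap z.2.1)) *
        ENNReal.ofReal (cut M e₃ (jap (z.2.1 + z.2.2 - z.1))) * ENNReal.ofReal (cut M e₄ (jap z.2.2)) *
        ENNReal.ofReal (X ^ (3 - 4 * δ) * resWt (resPhase z.1 z.2.1 z.2.2))) := by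
        gcongr
    _ = _ := by simp only [quartE]; ring

/-- The cubic nonlinearity on the Fourier side. -/
abbrev cubicN (f : Rn 3 → ℂ) : Rn 3 → ℂ := triSym (fun _ _ _ => 1) f

/-- The pointwise extended norm of a function. -/
def absE (f : Rn 3 → ℂ) (x : Rn 3) : ENNReal := ‖f x‖ₑ

lemma hasDerivAt_quart {f₁ f₂ f₃ f₄ : ℝ → Rn 3 → ℂ} {g₁ g₂ g₃ g₄ : Rn 3 → ℂ} {t : ℝ}
    (h₁ : ∀ ξ, HasDerivAt (fun t => f₁ t ξ) (g₁ ξ) t)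
    (h₂ : ∀ ξ, HasDerivAt (fun t => f₂ t ξ) (g₂ ξ) t)
    (h₃ : ∀ ξ, HasDerivAt (fun t => f₃ t ξ) (g₃ ξ) t)
    (h₄ : ∀ ξ, HasDerivAt (fun t => f₄ t ξ) (g₄ ξ) t) (z : Rn 3 × Rn 3 × Rn 3) :
    HasDerivAt (fun t => quart (f₁ t) (f₂ t) (f₃ t) (f₄ t) z)
      (quart g₁ (f₂ t) (f₃ t) (f₄ t) z + quart (f₁ t) g₂ (f₃ t) (f₄ t) z
        + quart (f₁ t) (f₂ t) g₃ (f₄ t) z + quart (f₁ t) (f₂ t) (f₃ t) g₄ z) t := by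
  have conj_deriv : ∀ {f : ℝ → ℂ} {f' : ℂ}, HasDerivAt f f' t →
      HasDerivAt (fun s => conj (f s)) (conj f') t := fun h =>
    (conjCLE : ℂ ≃L[ℝ] ℂ).hasFDerivAt.comp_hasDerivAt t h
  have := (((conj_deriv (h₁ z.1)).mul (h₂ z.2.1)).mul (conj_deriv (h₃ (z.2.1 + z.2.2 - z.1)))).mul
    (h₄ z.2.2)
  refine this.congr_deriv ?_
  simp only [quart, Pi.mul_apply]
  ring

section
variable {T : ℝ} {u : ℝ → Rn 3 → ℂ}

lemma CubicProfile.cont_cubicN (h : CubicProfile T u) :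
    Continuous fun p : ℝ × Rn 3 => cubicN (u p.1) p.2 :=
  continuous_triSym_one h.cont h.decays

lemma CubicProfile.decays_cubicN (h : CubicProfile T u) : Decays fun t => cubicN (u t) :=
  decays_triSym h.decays (L := 1) fun a b c => by
    rw [abs_one, one_mul]
    exact one_le_mul_of_one_le_of_one_le
      (one_le_mul_of_one_le_of_one_le (one_le_jap _) (one_le_jap _)) (one_le_jap _)

/-- Modulation by the linear flow. -/
def unwind (f : ℝ → Rn 3 → ℂ) (t : ℝ) (ξ : Rn 3) : ℂ :=
  exp (I * ((4 * Real.pi ^ 2 * ‖ξ‖ ^ 2) * t : ℝ)) * f t ξ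

lemma absE_unwind (f : ℝ → Rn 3 → ℂ) (t : ℝ) : absE (unwind f t) = absE (f t) := by
  ext ξ
  simp only [absE, unwind]
  rw [enorm_mul, ← ofReal_norm, mul_comm I, norm_exp_ofReal_mul_I]
  simp

lemma continuous_unwind {f : ℝ → Rn 3 → ℂ} (hf : Continuous fun p : ℝ × Rn 3 => f p.1 p.2) :
    Continuous fun p : ℝ × Rn 3 => unwind f p.1 p.2 := by
  unfold unwind; fun_prop

lemma CubicProfile.hasDerivAt_unwind (h : CubicProfile T u) {t : ℝ} (ht : t ∈ Ioo 0 T) (ξ : Rn 3) :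
    HasDerivAt (fun t => unwind u t ξ) (unwind (fun s ξ => -I * cubicN (u s) ξ) t ξ) t := by
  have h0 : HasDerivAt (fun t : ℝ => I * ((4 * Real.pi ^ 2 * ‖ξ‖ ^ 2) * t : ℝ))
      (I * (4 * Real.pi ^ 2 * ‖ξ‖ ^ 2 : ℝ)) t := by
    have := ((hasDerivAt_id t).const_mul (4 * Real.pi ^ 2 * ‖ξ‖ ^ 2)).ofReal_comp.const_mul I
    simpa using this
  refine (h0.cexp.mul (h.deriv t ht ξ)).congr_deriv ?_
  simp only [unwind, cubicN]
  ring

lemma quart_unwind (t : ℝ) (z : Rn 3 × Rn 3 × Rn 3) :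
    quart (u t) (u t) (u t) (u t) z
      = quart (unwind u t) (unwind u t) (unwind u t) (unwind u t) z
        * exp (I * (resPhase z.1 z.2.1 z.2.2 * t : ℝ)) := by
  simp only [quart, unwind, map_mul, ← exp_conj, conj_I, conj_ofReal]
  set b := z.2.1 + z.2.2 - z.1
  have : exp (-I * ((4 * Real.pi ^ 2 * ‖z.1‖ ^ 2) * t : ℝ)) *
      exp (I * ((4 * Real.pi ^ 2 * ‖z.2.1‖ ^ 2) * t : ℝ)) *
      exp (-I * ((4 * Real.pi ^ 2 * ‖b‖ ^ 2) * t : ℝ)) *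
      exp (I * ((4 * Real.pi ^ 2 * ‖z.2.2‖ ^ 2) * t : ℝ)) *
      exp (I * (resPhase z.1 z.2.1 z.2.2 * t : ℝ)) = 1 := by
    rw [← exp_add, ← exp_add, ← exp_add, ← exp_add, ← exp_zero]
    congr 1
    simp only [resPhase, b]
    push_cast
    ring
  linear_combination (-(conj (u t z.1) * u t z.2.1 * conj (u t b) * u t z.2.2)) * this

/-- Sum over the four positions of the nonlinearity. -/
def quartSum (f g : Rn 3 → ENNReal) (z : Rn 3 × Rn 3 × Rn 3) : ENNReal :=
  quartE g f f f z + quartE f g f f z + quartE f f g f z + quartE f f f g z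

lemma CubicProfile.enorm_integral_quart_le (h : CubicProfile T u) {a b : ℝ} (ha : 0 ≤ a)
    (hab : a ≤ b) (hbT : b ≤ T) (hb : b - a ≤ 1) (z : Rn 3 × Rn 3 × Rn 3) :
    ‖∫ t in a..b, quart (u t) (u t) (u t) (u t) z‖ₑ
      ≤ 2 * ENNReal.ofReal (resWt (resPhase z.1 z.2.1 z.2.2)) *
        (quartE (absE (u a)) (absE (u a)) (absE (u a)) (absE (u a)) z
          + ∫⁻ t in Icc a b, quartSum (absE (u t)) (absE (cubicN (u t))) z) := by
  set f := unwind u with hf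
  set g := unwind (fun s ξ => -I * cubicN (u s) ξ) with hg
  have cf : Continuous fun p : ℝ × Rn 3 => f p.1 p.2 := continuous_unwind h.cont
  have cg : Continuous fun p : ℝ × Rn 3 => g p.1 p.2 :=
    continuous_unwind (continuous_const.mul h.cont_cubicN)
  have hz : Continuous fun t : ℝ => (t, z) := by fun_prop
  have c0 := (continuous_quart cf cf cf cf).comp hz
  have c1 := (continuous_quart cg cf cf cf).comp hz
  have c2 := (continuous_quart cf cg cf cf).comp hz
  have c3 := (continuous_quart cf cf cg cf).comp hz
  have c4 := (continuous_quart cf cf cf cg).comp hz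
  have cs : Continuous fun t => quart (g t) (f t) (f t) (f t) z + quart (f t) (g t) (f t) (f t) z
      + quart (f t) (f t) (g t) (f t) z + quart (f t) (f t) (f t) (g t) z :=
    ((c1.add c2).add c3).add c4
  have hosc := norm_integral_mul_exp_le hab hb c0
    (G' := fun t => quart (g t) (f t) (f t) (f t) z + quart (f t) (g t) (f t) (f t) z
      + quart (f t) (f t) (g t) (f t) z + quart (f t) (f t) (f t) (g t) z)
    (fun t ht => by
      have hd := fun ξ => h.hasDerivAt_unwind ⟨ha.trans_lt ht.1, ht.2.trans_le hbT⟩ ξ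
      exact hasDerivAt_quart hd hd hd hd z)
    cs (resPhase z.1 z.2.1 z.2.2)
  have e1 : ∀ t, absE (f t) = absE (u t) := absE_unwind u
  have e2 : ∀ t, absE (g t) = absE (cubicN (u t)) := fun t => by
    rw [hg, absE_unwind]
    ext ξ
    rw [absE, absE, enorm_mul, enorm_neg, ← ofReal_norm, norm_I, ENNReal.ofReal_one, one_mul]
  have e3 : ∀ f₁ f₂ f₃ f₄, ‖quart f₁ f₂ f₃ f₄ z‖ₑ = quartE (absE f₁) (absE f₂) (absE f₃) (absE f₄) z :=
    fun f₁ f₂ f₃ f₄ => enorm_quart f₁ f₂ f₃ f₄ z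
  rw [intervalIntegral.integral_congr (fun t _ => quart_unwind t z), ← ofReal_norm]
  refine (ENNReal.ofReal_le_ofReal hosc).trans ?_
  have hr := resWt_pos (resPhase z.1 z.2.1 z.2.2)
  rw [ENNReal.ofReal_mul (by positivity), ENNReal.ofReal_mul (by norm_num), ENNReal.ofReal_ofNat]
  refine mul_le_mul_right ?_ _
  rw [ENNReal.ofReal_add (norm_nonneg _)
    (intervalIntegral.integral_nonneg hab fun t _ => norm_nonneg _), ofReal_norm]
  refine add_le_add (le_of_eq ?_) ?_
  · simp only [Function.comp]
    rw [e3, e1]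
  · rw [intervalIntegral.integral_of_le hab, ← integral_Icc_eq_integral_Ioc,
      ofReal_integral_norm_eq_lintegral_enorm cs.continuousOn.integrableOn_Icc]
    refine lintegral_mono fun t => ?_
    rw [quartSum, ← e1, ← e2, ← e3, ← e3, ← e3, ← e3]
    refine (enorm_add_le _ _).trans (add_le_add_left ((enorm_add_le _ _).trans
      (add_le_add_left (enorm_add_le _ _) _)) _)

end

/-- The weight of one derivative damped above frequency `M`. -/
def cutW (M e : ℝ) (x : Rn 3) : ℝ := jap x * cut M e (jap x)

/-- Space-time weighted norm of the nonlinearity on a slab. -/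
def slabNorm (u : ℝ → Rn 3 → ℂ) (M r a b : ℝ) : ENNReal :=
  ∫⁻ t in Icc a b, wnormSq (cutW M r) (absE (cubicN (u t)))

lemma ENNReal.le_of_sq_le {q C A B : ENNReal} (h : q ^ 2 ≤ C * (A * B)) :
    q ≤ (C + 1) * (A + B) := by
  rw [← ENNReal.pow_le_pow_left_iff two_ne_zero]
  refine h.trans ?_
  calc C * (A * B) ≤ (C + 1) * (C + 1) * ((A + B) * (A + B)) := by
        gcongr ?_ * (?_ * ?_)
        · calc C ≤ C + 1 := le_self_add
            _ = 1 * (C + 1) := (one_mul _).symm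
            _ ≤ _ := by gcongr; exact le_add_self
        · exact le_self_add
        · exact le_add_self
    _ = _ := by ring

lemma wnormSq_mono {w w' : Rn 3 → ℝ} (h : ∀ x, w x ≤ w' x) (f : Rn 3 → ENNReal) :
    wnormSq w f ≤ wnormSq w' f := by
  refine lintegral_mono fun x => pow_le_pow_left' ?_ 2
  gcongr
  exact h x

lemma cutW_anti_exp {M e r : ℝ} (hM : 0 < M) (h : e ≤ r) (x : Rn 3) : cutW M r x ≤ cutW M e x :=
  mul_le_mul_of_nonneg_left (cut_anti_exp hM (jap_pos x) h) (jap_pos x).le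

lemma measurable_absE {α : Type*} [MeasurableSpace α] {f : α → Rn 3 → ℂ}
    (hf : Measurable fun p : α × Rn 3 => f p.1 p.2) :
    Measurable fun p : α × Rn 3 => absE (f p.1) p.2 := hf.enorm

/-- The resonant kernel with its decay in the phase. -/
def resCutKer (δ M p r : ℝ) (z : Rn 3 × Rn 3 × Rn 3) : ENNReal :=
  ENNReal.ofReal (cutKer δ M p r z * resWt (resPhase z.1 z.2.1 z.2.2))

@[fun_prop] lemma measurable_resCutKer (δ M p r : ℝ) : Measurable (resCutKer δ M p r) := by
  have := measurable_cutKer δ M p r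
  have := measurable_resWt_resPhase
  unfold resCutKer; fun_prop

lemma exists_lintegral_quartE_le {δ : ℝ} (hδ : 0 < δ) (hδ1 : δ ≤ 1 / 4) :
    ∃ C < (⊤ : ENNReal), ∀ f g : Rn 3 → ENNReal, Measurable f → Measurable g →
    ∀ M p r : ℝ, 0 < M → 0 ≤ p → 0 ≤ r → ∀ K A B : ENNReal, wnormSq (cutW M p) f ≤ K →
    K ^ 3 * wnormSq (cutW M r) g ≤ A * B →
    (∫⁻ z, quartE g f f f z * resCutKer δ M p r z) ≤ C * (A + B) ∧
    (∫⁻ z, quartE f g f f z * resCutKer δ M p r z) ≤ C * (A + B) ∧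
    (∫⁻ z, quartE f f g f z * resCutKer δ M p r z) ≤ C * (A + B) ∧
    (∫⁻ z, quartE f f f g z * resCutKer δ M p r z) ≤ C * (A + B) := by
  obtain ⟨C, hC, h⟩ := exists_lintegral_cut_quad_le hδ hδ1
  refine ⟨C + 1, by finiteness, fun f g hf hg M p r hM hp hr K A B hK hAB => ?_⟩
  refine ⟨ENNReal.le_of_sq_le ?_, ENNReal.le_of_sq_le ?_, ENNReal.le_of_sq_le ?_,
    ENNReal.le_of_sq_le ?_⟩
  · refine le_trans (le_of_eq ?_) ((h g f f f hg hf hf hf M r p p p hM hr hp hp hp).trans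
      (mul_le_mul_right (le_trans ?_ hAB) C))
    · congr 1; refine lintegral_congr fun z => ?_
      simp only [resCutKer, cutKer]; congr 2; ring
    · change wnormSq (cutW M r) g * wnormSq (cutW M p) f * wnormSq (cutW M p) f *
        wnormSq (cutW M p) f ≤ _
      calc _ = wnormSq (cutW M p) f ^ 3 * wnormSq (cutW M r) g := by ring
        _ ≤ _ := by gcongr
  · refine le_trans (le_of_eq ?_) ((h f g f f hf hg hf hf M p r p p hM hp hr hp hp).trans
      (mul_le_mul_right (le_trans ?_ hAB) C))
    · congr 1; refine lintegral_congr fun z => ?_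
      simp only [resCutKer, cutKer]; congr 2; ring
    · change wnormSq (cutW M p) f * wnormSq (cutW M r) g * wnormSq (cutW M p) f *
        wnormSq (cutW M p) f ≤ _
      calc _ = wnormSq (cutW M p) f ^ 3 * wnormSq (cutW M r) g := by ring
        _ ≤ _ := by gcongr
  · refine le_trans (le_of_eq ?_) ((h f f g f hf hf hg hf M p p r p hM hp hp hr hp).trans
      (mul_le_mul_right (le_trans ?_ hAB) C))
    · congr 1; refine lintegral_congr fun z => ?_
      simp only [resCutKer, cutKer]; congr 2; ring
    · change wnormSq (cutW M p) f * wnormSq (cutW M p) f * wnormSq (cutW M r) g *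
        wnormSq (cutW M p) f ≤ _
      calc _ = wnormSq (cutW M p) f ^ 3 * wnormSq (cutW M r) g := by ring
        _ ≤ _ := by gcongr
  · refine le_trans (le_of_eq ?_) ((h f f f g hf hf hf hg M p p p r hM hp hp hp hr).trans
      (mul_le_mul_right (le_trans ?_ hAB) C))
    · congr 1; refine lintegral_congr fun z => ?_
      simp only [resCutKer, cutKer]; congr 2; ring
    · change wnormSq (cutW M p) f * wnormSq (cutW M p) f * wnormSq (cutW M p) f *
        wnormSq (cutW M r) g ≤ _
      calc _ = wnormSq (cutW M p) f ^ 3 * wnormSq (cutW M r) g := by ring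
        _ ≤ _ := by gcongr

lemma measurable_quartSum {α : Type*} [MeasurableSpace α] {f g : α → Rn 3 → ENNReal}
    (hf : Measurable fun p : α × Rn 3 => f p.1 p.2) (hg : Measurable fun p : α × Rn 3 => g p.1 p.2) :
    Measurable fun p : α × Rn 3 × Rn 3 × Rn 3 => quartSum (f p.1) (g p.1) p.2 :=
  (((measurable_quartE hg hf hf hf).add (measurable_quartE hf hg hf hf)).add
    (measurable_quartE hf hf hg hf)).add (measurable_quartE hf hf hf hg)

/-- Time oscillation bounds the space-time integral of a quadrilinear form whose symbol is
dominated by the damped resonant kernel. -/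
theorem exists_enorm_integral_quart_le {δ : ℝ} (hδ : 0 < δ) (hδ1 : δ ≤ 1 / 4) :
    ∃ C < (⊤ : ENNReal), ∀ (T : ℝ) (u : ℝ → Rn 3 → ℂ), CubicProfile T u →
    ∀ (a b τ M p r Λ : ℝ) (K : ENNReal) (S : Rn 3 × Rn 3 × Rn 3 → ℝ), 0 ≤ a → a ≤ b → b ≤ T →
    0 < τ → b - a ≤ τ → τ ≤ 1 → 0 < M → 0 ≤ p → p ≤ r → 0 ≤ Λ →
    (∀ t ∈ Icc a b, wnormSq (cutW M p) (absE (u t)) ≤ K) →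
    Measurable S → (∀ z, |S z| ≤ Λ * cutKer δ M p r z) →
    ‖∫ t in a..b, ∫ z, (S z : ℂ) * quart (u t) (u t) (u t) (u t) z‖ₑ
      ≤ C * ENNReal.ofReal Λ * (K ^ 2 + ENNReal.ofReal τ * K * slabNorm u M r a b) := by
  obtain ⟨C, hC, hq⟩ := exists_lintegral_quartE_le hδ hδ1
  refine ⟨12 * C, by finiteness, fun T u h a b τ M p r Λ K S ha hab hbT hτ hbτ hτ1 hM hp hpr hΛ hK
    hS hSb => ?_⟩
  have hr : 0 ≤ r := hp.trans hpr
  have mu : Measurable fun q : ℝ × Rn 3 => absE (u q.1) q.2 := measurable_absE h.cont.measurable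
  have mN : Measurable fun q : ℝ × Rn 3 => absE (cubicN (u q.1)) q.2 :=
    measurable_absE (f := fun t => cubicN (u t)) h.cont_cubicN.measurable
  have mu' : ∀ t, Measurable (absE (u t)) := fun t => mu.comp (f := fun x => (t, x)) (by fun_prop)
  have mN' : ∀ t, Measurable (absE (cubicN (u t))) :=
    fun t => mN.comp (f := fun x => (t, x)) (by fun_prop)
  have cq := continuous_quart h.cont h.cont h.cont h.cont
  have hswap : ∫ t in a..b, ∫ z, (S z : ℂ) * quart (u t) (u t) (u t) (u t) z
      = ∫ z, (S z : ℂ) * ∫ t in a..b, quart (u t) (u t) (u t) (u t) z := by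
    rw [intervalIntegral_integral_swap]
    · simp_rw [intervalIntegral.integral_const_mul]
    · obtain ⟨D, hD0, hD⟩ := h.decays.quart h.decays h.decays h.decays 3
      have : IsFiniteMeasure (volume.restrict (uIoc a b)) := by
        rw [uIoc_of_le hab]; infer_instance
      have hi : Integrable (fun q : ℝ × Rn 3 × Rn 3 × Rn 3 =>
          (1 : ℝ) * (Λ * 27 * (D * (japTriple q.2 ^ 4)⁻¹)))
          ((volume.restrict (uIoc a b)).prod volume) := by
        refine Integrable.mul_prod (f := fun _ : ℝ => (1 : ℝ)) (integrable_const _)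
          ((integrable_inv_japTriple_pow.const_mul D).const_mul (Λ * 27))
      refine hi.mono' ?_ (.of_forall fun q => ?_)
      · refine Measurable.aestronglyMeasurable ?_
        have := cq.measurable
        simp only [Function.uncurry_def]
        fun_prop
      · simp only [Function.uncurry_def, norm_mul, norm_real, Real.norm_eq_abs, one_mul]
        have hJ := japTriple_pos q.2
        calc _ ≤ Λ * cutKer δ M p r q.2 * ‖quart (u q.1) (u q.1) (u q.1) (u q.1) q.2‖ := by
              gcongr; exact hSb _
          _ ≤ Λ * (27 * japTriple q.2 ^ 3) * ‖quart (u q.1) (u q.1) (u q.1) (u q.1) q.2‖ := by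
              gcongr; exact cutKer_le hδ hM hp hr q.2
          _ = Λ * 27 * (japTriple q.2 ^ 3 * ‖quart (u q.1) (u q.1) (u q.1) (u q.1) q.2‖) := by ring
          _ ≤ _ := mul_le_mul_of_nonneg_left (hD q.1 q.2) (by positivity)
  rw [hswap]
  refine (enorm_integral_le_lintegral_enorm _).trans ?_
  have mker := measurable_resCutKer δ M p r
  have mq0 : Measurable fun z => quartE (absE (u a)) (absE (u a)) (absE (u a)) (absE (u a)) z :=
    (measurable_quartE (f₁ := fun t => absE (u t)) (f₂ := fun t => absE (u t))
      (f₃ := fun t => absE (u t)) (f₄ := fun t => absE (u t)) mu mu mu mu).comp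
      (f := fun z => (a, z)) (by fun_prop)
  have mqs := measurable_quartSum (f := fun t => absE (u t)) (g := fun t => absE (cubicN (u t))) mu mN
  have mi : Measurable fun z => ∫⁻ t in Icc a b, quartSum (absE (u t)) (absE (cubicN (u t))) z :=
    Measurable.lintegral_prod_left' (f := fun q : ℝ × Rn 3 × Rn 3 × Rn 3 =>
      quartSum (absE (u q.1)) (absE (cubicN (u q.1))) q.2) mqs
  have step1 : (∫⁻ z, ‖(S z : ℂ) * ∫ t in a..b, quart (u t) (u t) (u t) (u t) z‖ₑ)
      ≤ 2 * ENNReal.ofReal Λ * ((∫⁻ z, quartE (absE (u a)) (absE (u a)) (absE (u a)) (absE (u a)) z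
          * resCutKer δ M p r z) + ∫⁻ z, (∫⁻ t in Icc a b,
            quartSum (absE (u t)) (absE (cubicN (u t))) z) * resCutKer δ M p r z) := by
    rw [← lintegral_add_left (by fun_prop), ← lintegral_const_mul _ (by fun_prop)]
    refine lintegral_mono fun z => ?_
    have hk := cutKer_nonneg (δ := δ) (p := p) (r := r) hM z
    rw [enorm_mul, ← ofReal_norm, norm_real, Real.norm_eq_abs, resCutKer, ENNReal.ofReal_mul hk]
    calc _ ≤ ENNReal.ofReal (Λ * cutKer δ M p r z) * _ :=
          mul_le_mul' (ENNReal.ofReal_le_ofReal (hSb z))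
            (h.enorm_integral_quart_le ha hab hbT (hbτ.trans hτ1) z)
      _ = _ := by rw [ENNReal.ofReal_mul hΛ]; ring
  refine step1.trans ?_
  have b1 : (∫⁻ z, quartE (absE (u a)) (absE (u a)) (absE (u a)) (absE (u a)) z
      * resCutKer δ M p r z) ≤ C * (K ^ 2 + K ^ 2) := by
    refine (hq (absE (u a)) (absE (u a)) (mu' a) (mu' a) M p r hM hp hr K (K ^ 2) (K ^ 2)
      (hK a ⟨le_rfl, hab⟩) ?_).1
    calc _ ≤ K ^ 3 * K := by
          gcongr
          exact (wnormSq_mono (cutW_anti_exp hM hpr) _).trans (hK a ⟨le_rfl, hab⟩)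
      _ = _ := by ring
  have b2 : (∫⁻ z, (∫⁻ t in Icc a b, quartSum (absE (u t)) (absE (cubicN (u t))) z)
      * resCutKer δ M p r z) ≤ 4 * C * (K ^ 2 + ENNReal.ofReal τ * K * slabNorm u M r a b) := by
    have hτ0 : ENNReal.ofReal τ ≠ 0 := by simpa using hτ
    calc _ = ∫⁻ t in Icc a b, ∫⁻ z, quartSum (absE (u t)) (absE (cubicN (u t))) z *
          resCutKer δ M p r z := by
          rw [lintegral_lintegral_swap]
          · refine lintegral_congr fun z => ?_
            rw [lintegral_mul_const]
            exact mqs.comp (f := fun t => (t, z)) (by fun_prop)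
          · exact (mqs.mul (mker.comp measurable_snd)).aemeasurable
      _ ≤ ∫⁻ t in Icc a b, 4 * C * ((ENNReal.ofReal τ)⁻¹ * K ^ 2 +
            ENNReal.ofReal τ * K * wnormSq (cutW M r) (absE (cubicN (u t)))) := by
          refine setLIntegral_mono' measurableSet_Icc fun t ht => ?_
          obtain ⟨i1, i2, i3, i4⟩ := hq (absE (u t)) (absE (cubicN (u t))) (mu' t) (mN' t) M p r hM hp
            hr K ((ENNReal.ofReal τ)⁻¹ * K ^ 2)
            (ENNReal.ofReal τ * K * wnormSq (cutW M r) (absE (cubicN (u t)))) (hK t ht) (by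
              refine le_of_eq ?_
              calc _ = (ENNReal.ofReal τ * (ENNReal.ofReal τ)⁻¹) * (K ^ 3 *
                    wnormSq (cutW M r) (absE (cubicN (u t)))) := by
                    rw [ENNReal.mul_inv_cancel hτ0 ENNReal.ofReal_ne_top, one_mul]
                _ = _ := by ring)
          have ma : ∀ {f₁ f₂ f₃ f₄ : Rn 3 → ENNReal}, Measurable f₁ → Measurable f₂ →
              Measurable f₃ → Measurable f₄ → Measurable fun z =>
              quartE f₁ f₂ f₃ f₄ z * resCutKer δ M p r z := fun h1 h2 h3 h4 => by
            unfold quartE; fun_prop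
          simp only [quartSum, add_mul]
          rw [lintegral_add_right _ (ma (mu' t) (mu' t) (mu' t) (mN' t)),
            lintegral_add_right _ (ma (mu' t) (mu' t) (mN' t) (mu' t)),
            lintegral_add_right _ (ma (mu' t) (mN' t) (mu' t) (mu' t))]
          refine (add_le_add (add_le_add (add_le_add i1 i2) i3) i4).trans (le_of_eq ?_)
          ring
      _ = 4 * C * ((ENNReal.ofReal τ)⁻¹ * K ^ 2 * ENNReal.ofReal (b - a) +
            ENNReal.ofReal τ * K * slabNorm u M r a b) := by
          have mw : Measurable fun t => wnormSq (cutW M r) (absE (cubicN (u t))) := by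
            refine Measurable.lintegral_prod_right' (f := fun q : ℝ × Rn 3 =>
              (ENNReal.ofReal (cutW M r q.2) * absE (cubicN (u q.1)) q.2) ^ 2) ?_
            have : Measurable (cutW M r) := by unfold cutW; fun_prop
            fun_prop
          rw [lintegral_const_mul _ (by fun_prop), lintegral_add_left (by fun_prop),
            lintegral_const_mul _ mw, setLIntegral_const, Real.volume_Icc]
          rfl
      _ ≤ _ := by
          gcongr
          calc _ ≤ (ENNReal.ofReal τ)⁻¹ * K ^ 2 * ENNReal.ofReal τ := by gcongr
            _ = (ENNReal.ofReal τ * (ENNReal.ofReal τ)⁻¹) * K ^ 2 := by ring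
            _ = _ := by rw [ENNReal.mul_inv_cancel hτ0 ENNReal.ofReal_ne_top, one_mul]
  set Y := ENNReal.ofReal τ * K * slabNorm u M r a b
  calc _ ≤ 2 * ENNReal.ofReal Λ * (C * (K ^ 2 + K ^ 2) + 4 * C * (K ^ 2 + Y)) := by gcongr
    _ = C * ENNReal.ofReal Λ * (12 * K ^ 2 + 8 * Y) := by ring
    _ ≤ C * ENNReal.ofReal Λ * (12 * K ^ 2 + 12 * Y) := by gcongr; norm_num
    _ = _ := by ring

/-- The bilinear correlation with symbol `k`. -/
def biSym (k : Rn 3 → Rn 3 → ℝ) (f : Rn 3 → ℂ) (ρ : Rn 3) : ℂ :=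
  ∫ l : Rn 3, k (ρ + l) l * (f (ρ + l) * conj (f l))

lemma measurePreserving_quad :
    MeasurePreserving (fun w : Rn 3 × Rn 3 × Rn 3 => (w.2.1, w.2.1 + w.1, w.2.2)) := by
  have h1 : MeasurePreserving (MeasurableEquiv.prodAssoc (α := Rn 3) (β := Rn 3) (γ := Rn 3)).symm :=
    (measurePreserving_prodAssoc (volume : Measure (Rn 3)) volume volume).symm _
  have h2 : MeasurePreserving (fun w : (Rn 3 × Rn 3) × Rn 3 => ((w.1.2, w.1.2 + w.1.1), w.2)) :=
    (measurePreserving_prod_add_swap (volume : Measure (Rn 3)) volume).prod (.id volume)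
  have h3 : MeasurePreserving (MeasurableEquiv.prodAssoc (α := Rn 3) (β := Rn 3) (γ := Rn 3)) :=
    measurePreserving_prodAssoc (volume : Measure (Rn 3)) volume volume
  exact h3.comp (h2.comp h1)

lemma integral_comp_of_measurePreserving {α : Type*} [MeasurableSpace α] {μ : Measure α} {g : α → α}
    (hg : MeasurePreserving g μ μ) {f : α → ℂ} (hf : AEStronglyMeasurable f μ) :
    ∫ x, f (g x) ∂μ = ∫ x, f x ∂μ := by
  have h := integral_map (f := f) hg.measurable.aemeasurable (by rw [hg.map_eq]; exact hf)
  rw [hg.map_eq] at h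
  exact h.symm

lemma continuous_slice {u : ℝ → Rn 3 → ℂ} (h : Continuous fun p : ℝ × Rn 3 => u p.1 p.2) (t : ℝ) :
    Continuous (u t) := h.comp (f := fun x => (t, x)) (by fun_prop)

section
variable {u : ℝ → Rn 3 → ℂ} (hc : Continuous fun p : ℝ × Rn 3 => u p.1 p.2) (hd : Decays u)
include hc hd

lemma integrable_mul_quart {S : Rn 3 × Rn 3 × Rn 3 → ℝ} (hS : Measurable S) {L : ℝ} {n : ℕ}
    (hSb : ∀ z, |S z| ≤ L * japTriple z ^ n) (t : ℝ) :
    Integrable fun z => (S z : ℂ) * quart (u t) (u t) (u t) (u t) z := by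
  obtain ⟨D, hD0, hD⟩ := hd.quart hd hd hd n
  have hL : 0 ≤ L := by
    have := (abs_nonneg _).trans (hSb 0)
    have h0 := japTriple_pos 0
    exact nonneg_of_mul_nonneg_left this (by positivity)
  have cq := ((continuous_quart hc hc hc hc).comp (f := fun z => (t, z)) (by fun_prop)).measurable
  refine ((integrable_inv_japTriple_pow.const_mul D).const_mul L).mono' ?_ (.of_forall fun z => ?_)
  · exact ((measurable_ofReal.comp hS).mul cq).aestronglyMeasurable
  · rw [norm_mul, norm_real, Real.norm_eq_abs]
    calc _ ≤ L * japTriple z ^ n * ‖quart (u t) (u t) (u t) (u t) z‖ := by gcongr; exact hSb z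
      _ = L * (japTriple z ^ n * ‖quart (u t) (u t) (u t) (u t) z‖) := by ring
      _ ≤ _ := mul_le_mul_of_nonneg_left (hD t z) hL

omit hc hd in
lemma jap_prod_le_japTriple (z : Rn 3 × Rn 3 × Rn 3) :
    jap z.2.1 * jap z.1 * (jap (z.2.1 + z.2.2 - z.1) * jap z.2.2) ≤ 3 * japTriple z ^ 2 := by
  have h := maxJap_le z.1 z.2.1 z.2.2
  have h3 : jap (z.2.1 + z.2.2 - z.1) ≤ maxJap z.1 z.2.1 z.2.2 :=
    (le_max_right _ _).trans (le_max_left _ _)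
  have := jap_pos z.1
  have := jap_pos z.2.1
  have := jap_pos z.2.2
  calc _ ≤ jap z.2.1 * jap z.1 * (3 * japTriple z * jap z.2.2) := by gcongr; exact h3.trans h
    _ = _ := by simp only [japTriple]; ring

/-- The squared norm of a correlation is a quadrilinear form. -/
theorem lintegral_biSym_sq {k : Rn 3 → Rn 3 → ℝ}
    (hk : Measurable fun z : Rn 3 × Rn 3 => k z.1 z.2) (hkb : ∀ a b, |k a b| ≤ jap a * jap b) (t : ℝ) :
    ∃ q : ℝ, 0 ≤ q ∧ (∫ z : Rn 3 × Rn 3 × Rn 3,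
      ((k z.2.1 z.1 * k (z.2.1 + z.2.2 - z.1) z.2.2 : ℝ) : ℂ) * quart (u t) (u t) (u t) (u t) z) = q ∧
      ∫⁻ ρ, ‖biSym k (u t) ρ‖ₑ ^ 2 = ENNReal.ofReal q := by
  set S : Rn 3 × Rn 3 × Rn 3 → ℝ := fun z => k z.2.1 z.1 * k (z.2.1 + z.2.2 - z.1) z.2.2 with hS
  have mS : Measurable S :=
    (hk.comp (f := fun z : Rn 3 × Rn 3 × Rn 3 => (z.2.1, z.1)) (by fun_prop)).mul
      (hk.comp (f := fun z : Rn 3 × Rn 3 × Rn 3 => (z.2.1 + z.2.2 - z.1, z.2.2)) (by fun_prop))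
  have hSb : ∀ z, |S z| ≤ 3 * japTriple z ^ 2 := fun z => by
    rw [hS, abs_mul]
    refine le_trans ?_ (jap_prod_le_japTriple z)
    have := jap_pos z.2.1
    have := jap_pos z.1
    gcongr <;> exact hkb _ _
  have hi := integrable_mul_quart hc hd mS hSb t
  set g : Rn 3 → Rn 3 → ℂ := fun ρ l => k (ρ + l) l * (u t (ρ + l) * conj (u t l)) with hg
  have hcomp : ∀ w : Rn 3 × Rn 3 × Rn 3,
      (S (w.2.1, w.2.1 + w.1, w.2.2) : ℂ) * quart (u t) (u t) (u t) (u t) (w.2.1, w.2.1 + w.1, w.2.2)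
        = g w.1 w.2.1 * conj (g w.1 w.2.2) := fun w => by
    simp only [hS, hg, quart, map_mul, conj_ofReal, conj_conj]
    rw [show w.2.1 + w.1 + w.2.2 - w.2.1 = w.1 + w.2.2 by abel, add_comm w.2.1 w.1]
    push_cast
    ring
  have hi2 : Integrable fun w : Rn 3 × Rn 3 × Rn 3 => g w.1 w.2.1 * conj (g w.1 w.2.2) := by
    have := measurePreserving_quad.integrable_comp_of_integrable hi
    exact this.congr (.of_forall hcomp)
  have e1 : (∫ z, (S z : ℂ) * quart (u t) (u t) (u t) (u t) z)
      = ∫ w : Rn 3 × Rn 3 × Rn 3, g w.1 w.2.1 * conj (g w.1 w.2.2) := by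
    rw [← integral_comp_of_measurePreserving measurePreserving_quad hi.aestronglyMeasurable]
    exact integral_congr_ae (.of_forall hcomp)
  have e2 : ∀ ρ, (∫ w : Rn 3 × Rn 3, g ρ w.1 * conj (g ρ w.2))
      = ((‖biSym k (u t) ρ‖ ^ 2 : ℝ) : ℂ) := fun ρ => by
    rw [Measure.volume_eq_prod, integral_prod_mul (g ρ) (fun l => conj (g ρ l)), integral_conj]
    change biSym k (u t) ρ * conj (biSym k (u t) ρ) = _
    rw [mul_conj, normSq_eq_norm_sq]
  have hi3 : Integrable fun ρ => ‖biSym k (u t) ρ‖ ^ 2 := by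
    have := hi2.integral_prod_left
    refine (this.congr (.of_forall e2)).re.congr (.of_forall fun ρ => ?_)
    simp
    norm_cast
  refine ⟨∫ ρ, ‖biSym k (u t) ρ‖ ^ 2, by positivity, ?_, ?_⟩
  · rw [e1, Measure.volume_eq_prod, integral_prod _ hi2, ← integral_complex_ofReal]
    exact integral_congr_ae (.of_forall e2)
  · rw [ofReal_integral_eq_lintegral_ofReal hi3 (.of_forall fun ρ => by positivity)]
    refine lintegral_congr fun ρ => ?_
    rw [ENNReal.ofReal_pow (norm_nonneg _), ofReal_norm]

lemma integrable_triSym {σ : Rn 3 → Rn 3 → Rn 3 → ℝ}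
    (hσ : Measurable fun z : Rn 3 × Rn 3 × Rn 3 => σ z.1 z.2.1 z.2.2) {L : ℝ}
    (hσb : ∀ a b c, |σ a b c| ≤ L * (jap a * jap b * jap c)) (t : ℝ) (ξ : Rn 3) :
    Integrable fun w : Rn 3 × Rn 3 => (σ w.1 (w.1 + w.2 - ξ) w.2 : ℂ) *
      (u t w.1 * conj (u t (w.1 + w.2 - ξ)) * u t w.2) := by
  obtain ⟨D, hD0, hD⟩ := hd.trilinear 1
  have hL : 0 ≤ L := by
    have := (abs_nonneg _).trans (hσb 0 0 0)
    have h0 := jap_pos (0 : Rn 3)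
    exact nonneg_of_mul_nonneg_left this (by positivity)
  refine ((integrable_inv_jap_pow_pair.const_mul D).const_mul L).mono' ?_ (.of_forall fun w => ?_)
  · have ct := continuous_slice hc t
    have m1 : Measurable fun w : Rn 3 × Rn 3 => σ w.1 (w.1 + w.2 - ξ) w.2 :=
      hσ.comp (f := fun w : Rn 3 × Rn 3 => (w.1, w.1 + w.2 - ξ, w.2)) (by fun_prop)
    have m2 : Continuous fun w : Rn 3 × Rn 3 => conj (u t (w.1 + w.2 - ξ)) :=
      continuous_conj.comp (by fun_prop)
    have m3 := m2.measurable
    have := ct.measurable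
    exact Measurable.aestronglyMeasurable (by fun_prop)
  · rw [norm_mul, norm_real, Real.norm_eq_abs]
    have := hD t w.1 (w.1 + w.2 - ξ) w.2
    rw [pow_one] at this
    calc _ ≤ L * (jap w.1 * jap (w.1 + w.2 - ξ) * jap w.2) *
          ‖u t w.1 * conj (u t (w.1 + w.2 - ξ)) * u t w.2‖ := by gcongr; exact hσb _ _ _
      _ ≤ _ := by rw [mul_assoc]; exact mul_le_mul_of_nonneg_left this hL

lemma triSym_eq_integral_biSym {σ : Rn 3 → Rn 3 → Rn 3 → ℝ}
    (hσ : Measurable fun z : Rn 3 × Rn 3 × Rn 3 => σ z.1 z.2.1 z.2.2) {L : ℝ}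
    (hσb : ∀ a b c, |σ a b c| ≤ L * (jap a * jap b * jap c)) (t : ℝ) (ξ : Rn 3) :
    triSym σ (u t) ξ = ∫ c, u t c * biSym (fun a b => σ a b c) (u t) (ξ - c) := by
  rw [triSym, Measure.volume_eq_prod, integral_prod_symm _ (integrable_triSym hc hd hσ hσb t ξ)]
  refine integral_congr_ae (.of_forall fun c => ?_)
  simp only [biSym]
  rw [← integral_const_mul, ← integral_add_left_eq_self _ (ξ - c)]
  refine integral_congr_ae (.of_forall fun l => ?_)
  simp only
  rw [show ξ - c + l + c - ξ = l by abel]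
  ring

omit hc hd in
lemma triSym_swap (σ : Rn 3 → Rn 3 → Rn 3 → ℝ) (f : Rn 3 → ℂ) (ξ : Rn 3) :
    triSym σ f ξ = triSym (fun a b c => σ c b a) f ξ := by
  simp only [triSym]
  rw [Measure.volume_eq_prod, ← integral_prod_swap]
  refine integral_congr_ae (.of_forall fun w => ?_)
  simp only [Prod.fst_swap, Prod.snd_swap]
  rw [add_comm w.2 w.1]
  ring

lemma triSym_add {σ₁ σ₂ : Rn 3 → Rn 3 → Rn 3 → ℝ}
    (h₁ : Measurable fun z : Rn 3 × Rn 3 × Rn 3 => σ₁ z.1 z.2.1 z.2.2)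
    (h₂ : Measurable fun z : Rn 3 × Rn 3 × Rn 3 => σ₂ z.1 z.2.1 z.2.2) {L₁ L₂ : ℝ}
    (b₁ : ∀ a b c, |σ₁ a b c| ≤ L₁ * (jap a * jap b * jap c))
    (b₂ : ∀ a b c, |σ₂ a b c| ≤ L₂ * (jap a * jap b * jap c)) (t : ℝ) (ξ : Rn 3) :
    triSym (fun a b c => σ₁ a b c + σ₂ a b c) (u t) ξ = triSym σ₁ (u t) ξ + triSym σ₂ (u t) ξ := by
  simp only [triSym]
  rw [← integral_add (integrable_triSym hc hd h₁ b₁ t ξ) (integrable_triSym hc hd h₂ b₂ t ξ)]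
  refine integral_congr_ae (.of_forall fun w => ?_)
  simp only
  push_cast
  ring

end

/-- One derivative damped above frequency `M`, as a function of the bracket. -/
def dampW (M r x : ℝ) : ℝ := x * cut M r x

lemma dampW_mono {M r x y : ℝ} (hM : 0 < M) (hr : 0 ≤ r) (hr1 : r ≤ 1) (hx : 0 < x) (h : x ≤ y) :
    dampW M r x ≤ dampW M r y := mul_cut_mono hM hx hr hr1 h

lemma dampW_le {M r x : ℝ} (hM : 0 < M) (hr : 0 ≤ r) (hx : 0 < x) : dampW M r x ≤ x :=
  mul_le_of_le_one_right hx.le (cut_le_one hM hx hr)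

lemma dampW_pos {M r x : ℝ} (hM : 0 < M) (hx : 0 < x) : 0 < dampW M r x :=
  mul_pos hx (cut_pos hM hx)

lemma dampW_sq_le {M p d ζ X : ℝ} (hM : 0 < M) (hp : 0 ≤ p) (hd : 0 ≤ d)
    (hζ : 0 < ζ) (h : ζ ≤ X) :
    dampW M (5 * p + 2 * d) X ^ 2 ≤ (M ^ (2 * d) * ζ ^ (-1 - d) * cut M p ζ ^ 2) *
      (X ^ (3 - d) * (cut M p X ^ 3 * cut M (5 * p + 2 * d) X)) := by
  have hX := hζ.trans_le h
  have e1 : cut M (5 * p + 2 * d) X = cut M p X ^ 5 * cut M (2 * d) X := by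
    rw [cut_add hM hX, show 5 * p = p + p + p + p + p by ring]
    simp only [cut_add hM hX]; ring
  have e2 : X ^ (2 : ℕ) = X ^ (-1 - d) * X ^ (2 * d) * X ^ (3 - d) := by
    rw [← Real.rpow_add hX, ← Real.rpow_add hX, ← Real.rpow_natCast]
    congr 1; push_cast; ring
  have c1 := cut_pos (e := p) hM hX
  have c2 := cut_pos (e := 2 * d) hM hX
  have c3 := cut_pos (e := p) hM hζ
  have h1 : X ^ (-1 - d) ≤ ζ ^ (-1 - d) := Real.rpow_le_rpow_of_nonpos hζ h (by linarith)
  have h2 := rpow_mul_cut_le hM hX (e := 2 * d) (by linarith)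
  have h3 := cut_anti hM hζ hp h
  rw [dampW, mul_pow, e2]
  nth_rewrite 1 [sq (cut M (5 * p + 2 * d) X)]
  nth_rewrite 1 [e1]
  set R := cut M (5 * p + 2 * d) X with hR
  have hR0 : 0 < R := cut_pos hM hX
  calc _ = (X ^ (-1 - d) * (X ^ (2 * d) * cut M (2 * d) X) * cut M p X ^ 2) *
        (X ^ (3 - d) * (cut M p X ^ 3 * R)) := by ring
    _ ≤ (ζ ^ (-1 - d) * M ^ (2 * d) * cut M p ζ ^ 2) *
        (X ^ (3 - d) * (cut M p X ^ 3 * R)) := by gcongr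
    _ = _ := by ring

/-- The maximum of three brackets. -/
def max3 (a b c : Rn 3) : ℝ := max (max (jap a) (jap b)) (jap c)

lemma max3_le (a b c : Rn 3) : max3 a b c ≤ jap a * jap b * jap c := by
  have h1 := one_le_jap a
  have h2 := one_le_jap b
  have h3 := one_le_jap c
  refine max_le (max_le ?_ ?_) ?_
  · rw [mul_assoc]; exact le_mul_of_one_le_right (by linarith) (one_le_mul_of_one_le_of_one_le h2 h3)
  · rw [mul_comm (jap a), mul_assoc]
    exact le_mul_of_one_le_right (by linarith) (one_le_mul_of_one_le_of_one_le h1 h3)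
  · exact le_mul_of_one_le_left (by linarith) (one_le_mul_of_one_le_of_one_le h1 h2)

lemma max3_pos (a b c : Rn 3) : 0 < max3 a b c :=
  (jap_pos a).trans_le ((le_max_left _ _).trans (le_max_left _ _))

@[fun_prop] lemma measurable_max3 :
    Measurable fun z : Rn 3 × Rn 3 × Rn 3 => max3 z.1 z.2.1 z.2.2 := by
  unfold max3; fun_prop

lemma measurable_biSym {f : ℝ → Rn 3 → ℂ} (hf : Continuous fun p : ℝ × Rn 3 => f p.1 p.2)
    {σ : Rn 3 → Rn 3 → Rn 3 → ℝ}
    (hσ : Measurable fun z : Rn 3 × Rn 3 × Rn 3 => σ z.1 z.2.1 z.2.2) :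
    Measurable fun p : ℝ × Rn 3 × Rn 3 => biSym (fun a b => σ a b p.2.1) (f p.1) p.2.2 := by
  refine StronglyMeasurable.measurable ?_
  refine StronglyMeasurable.integral_prod_right (f := fun (p : ℝ × Rn 3 × Rn 3) (l : Rn 3) =>
    (σ (p.2.2 + l) l p.2.1 : ℂ) * (f p.1 (p.2.2 + l) * conj (f p.1 l))) ?_
  refine Measurable.stronglyMeasurable ?_
  refine Measurable.mul ?_ (Continuous.measurable ?_)
  · exact measurable_ofReal.comp (hσ.comp (f := fun z : (ℝ × Rn 3 × Rn 3) × Rn 3 =>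
      (z.1.2.2 + z.2, z.2, z.1.2.1)) (by fun_prop))
  · have c1 : Continuous fun z : (ℝ × Rn 3 × Rn 3) × Rn 3 => f z.1.1 (z.1.2.2 + z.2) :=
      hf.comp (f := fun z : (ℝ × Rn 3 × Rn 3) × Rn 3 => (z.1.1, z.1.2.2 + z.2)) (by fun_prop)
    have c2 : Continuous fun z : (ℝ × Rn 3 × Rn 3) × Rn 3 => f z.1.1 z.2 :=
      hf.comp (f := fun z : (ℝ × Rn 3 × Rn 3) × Rn 3 => (z.1.1, z.2)) (by fun_prop)
    exact c1.mul (continuous_conj.comp c2)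

lemma cutW_pos {M e : ℝ} (hM : 0 < M) (x : Rn 3) : 0 < cutW M e x :=
  mul_pos (jap_pos x) (cut_pos hM (jap_pos x))

@[fun_prop] lemma measurable_cutW (M e : ℝ) : Measurable (cutW M e) := by
  unfold cutW; fun_prop

lemma integrable_biSym_form {u : ℝ → Rn 3 → ℂ} (hc : Continuous fun p : ℝ × Rn 3 => u p.1 p.2)
    (hd : Decays u) {S : Rn 3 × Rn 3 × Rn 3 → ℝ} (hS : Measurable S) {L : ℝ} {n : ℕ}
    (hSb : ∀ z, |S z| ≤ L * japTriple z ^ n) (a b : ℝ) :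
    IntervalIntegrable (fun t => ∫ z, (S z : ℂ) * quart (u t) (u t) (u t) (u t) z) volume a b := by
  obtain ⟨D, hD0, hD⟩ := hd.quart hd hd hd n
  have hL : 0 ≤ L := by
    have := (abs_nonneg _).trans (hSb 0)
    have h0 := japTriple_pos 0
    exact nonneg_of_mul_nonneg_left this (by positivity)
  have cq := (continuous_quart hc hc hc hc).measurable
  refine (intervalIntegrable_const (c := ∫ z, L * (D * (japTriple z ^ 4)⁻¹))).mono_fun ?_
    (.of_forall fun t => ?_)
  · refine StronglyMeasurable.aestronglyMeasurable ?_
    refine StronglyMeasurable.integral_prod_right (f := fun (t : ℝ) (z : Rn 3 × Rn 3 × Rn 3) =>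
      (S z : ℂ) * quart (u t) (u t) (u t) (u t) z) ?_
    exact ((measurable_ofReal.comp (hS.comp measurable_snd)).mul cq).stronglyMeasurable
  · refine le_trans (norm_integral_le_of_norm_le
      ((integrable_inv_japTriple_pow.const_mul D).const_mul L) (.of_forall fun z => ?_))
      (le_abs_self _)
    rw [norm_mul, norm_real, Real.norm_eq_abs]
    calc _ ≤ L * japTriple z ^ n * ‖quart (u t) (u t) (u t) (u t) z‖ := by gcongr; exact hSb z
      _ = L * (japTriple z ^ n * ‖quart (u t) (u t) (u t) (u t) z‖) := by ring
      _ ≤ _ := mul_le_mul_of_nonneg_left (hD t z) hL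

lemma exists_lintegral_triSym_le_of_support {δ : ℝ} (hδ : 0 < δ) (hδ1 : δ ≤ 1 / 4) :
    ∃ C < (⊤ : ENNReal), ∀ (T : ℝ) (u : ℝ → Rn 3 → ℂ), CubicProfile T u →
    ∀ (a b τ M p : ℝ) (K : ENNReal) (σ : Rn 3 → Rn 3 → Rn 3 → ℝ), 0 ≤ a → a ≤ b → b ≤ T →
    0 < τ → b - a ≤ τ → τ ≤ 1 → 0 < M → 0 ≤ p → 5 * p + 2 * (4 * δ) ≤ 1 →
    (∀ t ∈ Icc a b, wnormSq (cutW M p) (absE (u t)) ≤ K) →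
    (Measurable fun z : Rn 3 × Rn 3 × Rn 3 => σ z.1 z.2.1 z.2.2) →
    (∀ x y z, |σ x y z| ≤ dampW M (5 * p + 2 * (4 * δ)) (max3 x y z)) →
    (∀ x y z, σ x y z ≠ 0 → jap z ≤ max (jap x) (jap y)) →
    ∫⁻ t in Icc a b, ∫⁻ ξ, ‖triSym σ (u t) ξ‖ₑ ^ 2
      ≤ C * ENNReal.ofReal (M ^ (2 * (4 * δ))) * (K * (K ^ 2 + ENNReal.ofReal τ * K *
        slabNorm u M (5 * p + 2 * (4 * δ)) a b)) := by
  obtain ⟨C, hC, hQ⟩ := exists_enorm_integral_quart_le hδ hδ1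
  set d := 4 * δ with hd
  have hd0 : 0 < d := by positivity
  have hI := lintegral_jap_rpow_lt_top (r := 3 + d) (by linarith)
  set I0 := ∫⁻ ξ : Rn 3, ENNReal.ofReal (jap ξ ^ (-(3 + d))) with hI0
  refine ⟨C * I0, by finiteness, fun T u h a b τ M p K σ ha hab hbT hτ hbτ hτ1 hM hp hr1 hK hσ
    hσb hσs => ?_⟩
  set r := 5 * p + 2 * d with hr
  have hr0 : 0 ≤ r := by positivity
  have hσb' : ∀ x y z, |σ x y z| ≤ 1 * (jap x * jap y * jap z) := fun x y z => by
    rw [one_mul]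
    exact (hσb x y z).trans ((dampW_le hM hr0 (max3_pos _ _ _)).trans (max3_le x y z))
  have hσ2 : ∀ ζ x y, |σ x y ζ| ≤ dampW M r (max (jap x) (jap y)) := fun ζ x y => by
    by_cases h0 : σ x y ζ = 0
    · rw [h0, abs_zero]
      exact (dampW_pos hM ((jap_pos x).trans_le (le_max_left _ _))).le
    · have := hσs x y ζ h0
      have := hσb x y ζ
      rwa [max3, max_eq_left (hσs x y ζ h0)] at this
  have hσ3 : ∀ ζ x y, |σ x y ζ| ≤ jap x * jap y := fun ζ x y => by
    refine (hσ2 ζ x y).trans ((dampW_le hM hr0 ((jap_pos x).trans_le (le_max_left _ _))).trans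
      (max_le ?_ ?_))
    · exact le_mul_of_one_le_right (jap_pos x).le (one_le_jap y)
    · exact le_mul_of_one_le_left (jap_pos y).le (one_le_jap x)
  have hσm : ∀ ζ, Measurable fun z : Rn 3 × Rn 3 => σ z.1 z.2 ζ := fun ζ =>
    hσ.comp (f := fun z : Rn 3 × Rn 3 => (z.1, z.2, ζ)) (by fun_prop)
  set B : ℝ → Rn 3 → Rn 3 → ℂ := fun t ζ ρ => biSym (fun a b => σ a b ζ) (u t) ρ with hB
  have mB : Measurable fun q : ℝ × Rn 3 × Rn 3 => B q.1 q.2.1 q.2.2 := measurable_biSym h.cont hσ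
  set w := cutW M p with hw
  have mw : Measurable w := measurable_cutW M p
  have hwp : ∀ x, 0 < w x := cutW_pos hM
  set Y := K ^ 2 + ENNReal.ofReal τ * K * slabNorm u M r a b with hY
  have hquad : ∀ ζ, (∫⁻ t in Icc a b, ∫⁻ ρ, ‖B t ζ ρ‖ₑ ^ 2) ≤
      C * ENNReal.ofReal (M ^ (2 * d) * jap ζ ^ (-1 - d) * cut M p (jap ζ) ^ 2) * Y := fun ζ => by
    set S : Rn 3 × Rn 3 × Rn 3 → ℝ := fun z => σ z.2.1 z.1 ζ * σ (z.2.1 + z.2.2 - z.1) z.2.2 ζ with hS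
    have mS : Measurable S :=
      ((hσm ζ).comp (f := fun z : Rn 3 × Rn 3 × Rn 3 => (z.2.1, z.1)) (by fun_prop)).mul
        ((hσm ζ).comp (f := fun z : Rn 3 × Rn 3 × Rn 3 => (z.2.1 + z.2.2 - z.1, z.2.2))
          (by fun_prop))
    have hc1 := cut_pos (e := p) hM (jap_pos ζ)
    have hjζ := jap_pos ζ
    have hSb : ∀ z, |S z| ≤ (M ^ (2 * d) * jap ζ ^ (-1 - d) * cut M p (jap ζ) ^ 2) *
        cutKer δ M p r z := fun z => by
      set X := maxJap z.1 z.2.1 z.2.2 with hX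
      have l1 : jap z.1 ≤ X := (le_max_left _ _).trans (le_max_left _ _)
      have l3 : jap (z.2.1 + z.2.2 - z.1) ≤ X := (le_max_right _ _).trans (le_max_left _ _)
      have l2 : jap z.2.1 ≤ X := (le_max_left _ _).trans (le_max_right _ _)
      have l4 : jap z.2.2 ≤ X := (le_max_right _ _).trans (le_max_right _ _)
      by_cases h0 : σ z.2.1 z.1 ζ = 0
      · have := cutKer_nonneg (δ := δ) (p := p) (r := r) hM z
        simp only [hS, h0, zero_mul, abs_zero]
        positivity
      have hζX : jap ζ ≤ X := (hσs _ _ _ h0).trans (max_le l2 l1)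
      have hd1 := dampW_sq_le hM hp hd0.le (jap_pos ζ) hζX
      refine le_trans ?_ hd1
      rw [hS, abs_mul, sq]
      have := dampW_pos (r := r) hM (hjζ.trans_le hζX)
      gcongr
      · exact (hσ2 _ _ _).trans (dampW_mono hM hr0 hr1 ((jap_pos z.1).trans_le (le_max_right _ _))
          (max_le l2 l1))
      · exact (hσ2 _ _ _).trans (dampW_mono hM hr0 hr1 ((jap_pos z.2.2).trans_le (le_max_right _ _))
          (max_le l3 l4))
    have key := hQ T u h a b τ M p r (M ^ (2 * d) * jap ζ ^ (-1 - d) * cut M p (jap ζ) ^ 2) K S ha hab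
      hbT hτ hbτ hτ1 hM hp (by linarith) (by positivity) hK mS hSb
    refine le_trans (le_of_eq ?_) key
    choose q hq0 hq1 hq2 using lintegral_biSym_sq h.cont h.decays (hσm ζ) (hσ3 ζ)
    have hii := integrable_biSym_form h.cont h.decays mS (L := 3) (n := 2) (fun z => by
      rw [hS, abs_mul]
      refine le_trans ?_ (jap_prod_le_japTriple z)
      have := jap_pos z.2.1
      have := jap_pos z.1
      gcongr <;> exact hσ3 _ _ _) a b
    have e0 : (fun t => ∫ z, (S z : ℂ) * quart (u t) (u t) (u t) (u t) z) = fun t => (q t : ℂ) :=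
      funext fun t => hq1 t
    rw [e0] at hii ⊢
    rw [intervalIntegral.integral_of_le hab, ← integral_Icc_eq_integral_Ioc, integral_complex_ofReal,
      ← ofReal_norm, norm_real, Real.norm_of_nonneg (integral_nonneg hq0),
      ofReal_integral_eq_lintegral_ofReal _ (.of_forall hq0)]
    · exact lintegral_congr fun t => hq2 t
    · rw [intervalIntegrable_iff_integrableOn_Icc_of_le hab] at hii
      simpa using hii.re
  have hCS : ∀ t ∈ Icc a b, (∫⁻ ξ, ‖triSym σ (u t) ξ‖ₑ ^ 2) ≤
      K * ∫⁻ c, ENNReal.ofReal (w c)⁻¹ ^ 2 * ∫⁻ ρ, ‖B t c ρ‖ₑ ^ 2 := fun t ht => by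
    have mBt : Measurable fun q : Rn 3 × Rn 3 => B t q.1 q.2 :=
      mB.comp (f := fun q : Rn 3 × Rn 3 => (t, q.1, q.2)) (by fun_prop)
    have mut1 : Measurable (absE (u t)) := (continuous_slice h.cont t).measurable.enorm
    have hpt : ∀ ξ, ‖triSym σ (u t) ξ‖ₑ ^ 2 ≤
        K * ∫⁻ c, (ENNReal.ofReal (w c)⁻¹ * ‖B t c (ξ - c)‖ₑ) ^ 2 := fun ξ => by
      have mb : Measurable fun c => B t c (ξ - c) :=
        mBt.comp (f := fun c => (c, ξ - c)) (by fun_prop)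
      rw [triSym_eq_integral_biSym h.cont h.decays hσ hσb' t ξ]
      calc _ ≤ (∫⁻ c, (ENNReal.ofReal (w c) * absE (u t) c) *
            (ENNReal.ofReal (w c)⁻¹ * ‖B t c (ξ - c)‖ₑ)) ^ 2 := by
            refine pow_le_pow_left' ((enorm_integral_le_lintegral_enorm _).trans
              (le_of_eq (lintegral_congr fun c => ?_))) 2
            have : ENNReal.ofReal (w c) * ENNReal.ofReal (w c)⁻¹ = 1 := by
              rw [← ENNReal.ofReal_mul (hwp c).le, mul_inv_cancel₀ (hwp c).ne', ENNReal.ofReal_one]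
            rw [enorm_mul]
            calc _ = (ENNReal.ofReal (w c) * ENNReal.ofReal (w c)⁻¹) * (absE (u t) c * ‖B t c (ξ - c)‖ₑ) := by
                  rw [this, one_mul]; rfl
              _ = _ := by ring
        _ ≤ _ := by
            refine (lintegral_mul_sq_le volume (by fun_prop) (by fun_prop)).trans ?_
            exact mul_le_mul_left (hK t ht) _
    calc _ ≤ ∫⁻ ξ, K * ∫⁻ c, (ENNReal.ofReal (w c)⁻¹ * ‖B t c (ξ - c)‖ₑ) ^ 2 := lintegral_mono hpt
      _ = K * ∫⁻ ξ, ∫⁻ c, (ENNReal.ofReal (w c)⁻¹ * ‖B t c (ξ - c)‖ₑ) ^ 2 := by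
          rw [lintegral_const_mul]
          refine Measurable.lintegral_prod_right' (f := fun q : Rn 3 × Rn 3 =>
            (ENNReal.ofReal (w q.2)⁻¹ * ‖B t q.2 (q.1 - q.2)‖ₑ) ^ 2) ?_
          have := mBt.comp (f := fun q : Rn 3 × Rn 3 => (q.2, q.1 - q.2)) (by fun_prop)
          fun_prop
      _ = _ := by
          rw [lintegral_lintegral_swap]
          · congr 1
            refine lintegral_congr fun c => ?_
            have := lintegral_sub_right_eq_self (μ := volume)
              (fun ρ => (ENNReal.ofReal (w c)⁻¹ * ‖B t c ρ‖ₑ) ^ 2) c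
            rw [this]
            simp_rw [mul_pow]
            rw [lintegral_const_mul]
            have := mBt.comp (f := fun ρ : Rn 3 => (c, ρ)) (by fun_prop)
            fun_prop
          · have := mBt.comp (f := fun q : Rn 3 × Rn 3 => (q.2, q.1 - q.2)) (by fun_prop)
            refine Measurable.aemeasurable ?_
            simp only [Function.uncurry_def]
            fun_prop
  have mBs : Measurable fun q : ℝ × Rn 3 => ∫⁻ ρ, ‖B q.1 q.2 ρ‖ₑ ^ 2 := by
    refine Measurable.lintegral_prod_right' (f := fun q : (ℝ × Rn 3) × Rn 3 =>
      ‖B q.1.1 q.1.2 q.2‖ₑ ^ 2) ?_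
    have := mB.comp (f := fun q : (ℝ × Rn 3) × Rn 3 => (q.1.1, q.1.2, q.2)) (by fun_prop)
    fun_prop
  calc _ ≤ ∫⁻ t in Icc a b, K * ∫⁻ c, ENNReal.ofReal (w c)⁻¹ ^ 2 * ∫⁻ ρ, ‖B t c ρ‖ₑ ^ 2 :=
        setLIntegral_mono' measurableSet_Icc hCS
    _ = K * ∫⁻ t in Icc a b, ∫⁻ c, ENNReal.ofReal (w c)⁻¹ ^ 2 * ∫⁻ ρ, ‖B t c ρ‖ₑ ^ 2 := by
        rw [lintegral_const_mul]
        exact Measurable.lintegral_prod_right' (f := fun q : ℝ × Rn 3 =>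
          ENNReal.ofReal (w q.2)⁻¹ ^ 2 * ∫⁻ ρ, ‖B q.1 q.2 ρ‖ₑ ^ 2) (by fun_prop)
    _ = K * ∫⁻ c, ENNReal.ofReal (w c)⁻¹ ^ 2 * ∫⁻ t in Icc a b, ∫⁻ ρ, ‖B t c ρ‖ₑ ^ 2 := by
        rw [lintegral_lintegral_swap]
        · congr 1
          refine lintegral_congr fun c => ?_
          rw [lintegral_const_mul]
          exact mBs.comp (f := fun t => (t, c)) (by fun_prop)
        · refine Measurable.aemeasurable ?_
          simp only [Function.uncurry_def]
          fun_prop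
    _ ≤ K * ∫⁻ c, ENNReal.ofReal (w c)⁻¹ ^ 2 *
          (C * ENNReal.ofReal (M ^ (2 * d) * jap c ^ (-1 - d) * cut M p (jap c) ^ 2) * Y) := by
        gcongr with c
        exact hquad c
    _ = K * ∫⁻ c, C * ENNReal.ofReal (M ^ (2 * d)) * Y * ENNReal.ofReal (jap c ^ (-(3 + d))) := by
        congr 1
        refine lintegral_congr fun c => ?_
        have hc := jap_pos c
        have hcc := cut_pos (e := p) hM hc
        rw [← ENNReal.ofReal_pow (by have := hwp c; positivity)]
        calc _ = C * Y * (ENNReal.ofReal ((w c)⁻¹ ^ 2) *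
              ENNReal.ofReal (M ^ (2 * d) * jap c ^ (-1 - d) * cut M p (jap c) ^ 2)) := by ring
          _ = C * Y * (ENNReal.ofReal (M ^ (2 * d)) * ENNReal.ofReal (jap c ^ (-(3 + d)))) := by
              rw [← ENNReal.ofReal_mul (by have := hwp c; positivity),
                ← ENNReal.ofReal_mul (by positivity)]
              congr 2
              have e : jap c ^ (-1 - d) = jap c ^ (-(3 + d)) * jap c ^ 2 := by
                rw [← Real.rpow_natCast, ← Real.rpow_add hc]; congr 1; push_cast; ring
              rw [e, hw, cutW]
              field_simp
          _ = _ := by ring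
    _ = _ := by
        rw [lintegral_const_mul _ (by fun_prop)]
        ring

lemma triSym_const_mul (L : ℝ) (σ : Rn 3 → Rn 3 → Rn 3 → ℝ) (f : Rn 3 → ℂ) (ξ : Rn 3) :
    triSym (fun a b c => L * σ a b c) f ξ = L * triSym σ f ξ := by
  simp only [triSym]
  rw [← integral_const_mul]
  refine integral_congr_ae (.of_forall fun w => ?_)
  simp only
  push_cast
  ring

lemma max3_swap (a b c : Rn 3) : max3 c b a = max3 a b c := by
  simp only [max3]
  rw [max_assoc, max_comm (jap b), max_comm (jap c), max_comm (jap a)]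

theorem exists_lintegral_triSym_le {δ : ℝ} (hδ : 0 < δ) (hδ1 : δ ≤ 1 / 4) :
    ∃ C < (⊤ : ENNReal), ∀ (T : ℝ) (u : ℝ → Rn 3 → ℂ), CubicProfile T u →
    ∀ (a b τ M p L : ℝ) (K : ENNReal) (σ : Rn 3 → Rn 3 → Rn 3 → ℝ), 0 ≤ a → a ≤ b → b ≤ T →
    0 < τ → b - a ≤ τ → τ ≤ 1 → 0 < M → 0 ≤ p → 5 * p + 2 * (4 * δ) ≤ 1 → 0 < L →
    (∀ t ∈ Icc a b, wnormSq (cutW M p) (absE (u t)) ≤ K) →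
    (Measurable fun z : Rn 3 × Rn 3 × Rn 3 => σ z.1 z.2.1 z.2.2) →
    (∀ x y z, |σ x y z| ≤ L * dampW M (5 * p + 2 * (4 * δ)) (max3 x y z)) →
    ∫⁻ t in Icc a b, ∫⁻ ξ, ‖triSym σ (u t) ξ‖ₑ ^ 2
      ≤ C * ENNReal.ofReal (L ^ 2) * ENNReal.ofReal (M ^ (2 * (4 * δ))) *
        (K * (K ^ 2 + ENNReal.ofReal τ * K * slabNorm u M (5 * p + 2 * (4 * δ)) a b)) := by
  obtain ⟨C, hC, hα⟩ := exists_lintegral_triSym_le_of_support hδ hδ1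
  refine ⟨8 * C, by finiteness, fun T u h a b τ M p L K σ ha hab hbT hτ hbτ hτ1 hM hp hr1 hL hK hσ
    hσb => ?_⟩
  set r := 5 * p + 2 * (4 * δ) with hr
  have hr0 : 0 ≤ r := by positivity
  set σ₁ : Rn 3 → Rn 3 → Rn 3 → ℝ := fun x y z =>
    if jap z ≤ max (jap x) (jap y) then L⁻¹ * σ x y z else 0 with hσ₁
  set σ₂ : Rn 3 → Rn 3 → Rn 3 → ℝ := fun x y z =>
    if jap z ≤ max (jap x) (jap y) then 0 else L⁻¹ * σ x y z with hσ₂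
  have hset : MeasurableSet {z : Rn 3 × Rn 3 × Rn 3 | jap z.2.2 ≤ max (jap z.1) (jap z.2.1)} :=
    measurableSet_le (by fun_prop) (by fun_prop)
  have m₁ : Measurable fun z : Rn 3 × Rn 3 × Rn 3 => σ₁ z.1 z.2.1 z.2.2 :=
    Measurable.ite hset (hσ.const_mul _) measurable_const
  have m₂ : Measurable fun z : Rn 3 × Rn 3 × Rn 3 => σ₂ z.1 z.2.1 z.2.2 :=
    Measurable.ite hset measurable_const (hσ.const_mul _)
  have hb : ∀ x y z, |L⁻¹ * σ x y z| ≤ dampW M r (max3 x y z) := fun x y z => by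
    rw [abs_mul, abs_of_pos (inv_pos.2 hL), inv_mul_le_iff₀ hL]
    exact hσb x y z
  have b₁ : ∀ x y z, |σ₁ x y z| ≤ dampW M r (max3 x y z) := fun x y z => by
    have := dampW_pos (r := r) hM (max3_pos x y z)
    simp only [hσ₁]
    split_ifs
    · exact hb x y z
    · rw [abs_zero]; exact this.le
  have b₂ : ∀ x y z, |σ₂ x y z| ≤ dampW M r (max3 x y z) := fun x y z => by
    have := dampW_pos (r := r) hM (max3_pos x y z)
    simp only [hσ₂]
    split_ifs
    · rw [abs_zero]; exact this.le
    · exact hb x y z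
  have s₁ : ∀ x y z, σ₁ x y z ≠ 0 → jap z ≤ max (jap x) (jap y) := fun x y z h0 => by
    by_contra hn
    exact h0 (if_neg hn)
  have s₂ : ∀ x y z, σ₂ z y x ≠ 0 → jap z ≤ max (jap x) (jap y) := fun x y z h0 => by
    by_contra hn
    refine h0 (if_pos ?_)
    push Not at hn
    exact (le_max_left _ _).trans (hn.le.trans (le_max_left _ _))
  have i₁ := hα T u h a b τ M p K σ₁ ha hab hbT hτ hbτ hτ1 hM hp hr1 hK m₁ b₁ s₁
  have i₂ := hα T u h a b τ M p K (fun x y z => σ₂ z y x) ha hab hbT hτ hbτ hτ1 hM hp hr1 hK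
    (m₂.comp (f := fun z : Rn 3 × Rn 3 × Rn 3 => (z.2.2, z.2.1, z.1)) (by fun_prop))
    (fun x y z => by rw [← max3_swap]; exact b₂ z y x) s₂
  have hlin : ∀ {σ : Rn 3 → Rn 3 → Rn 3 → ℝ}, (∀ x y z, |σ x y z| ≤ dampW M r (max3 x y z)) →
      ∀ x y z, |σ x y z| ≤ 1 * (jap x * jap y * jap z) := fun hh x y z => by
    rw [one_mul]
    exact (hh x y z).trans ((dampW_le hM hr0 (max3_pos _ _ _)).trans (max3_le x y z))
  have hsum : ∀ t ξ, ‖triSym σ (u t) ξ‖ₑ ^ 2 ≤ ENNReal.ofReal (L ^ 2) *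
      (4 * (‖triSym σ₁ (u t) ξ‖ₑ ^ 2 + ‖triSym (fun x y z => σ₂ z y x) (u t) ξ‖ₑ ^ 2)) := fun t ξ => by
    have e : σ = fun x y z => L * (σ₁ x y z + σ₂ x y z) := by
      ext x y z
      simp only [hσ₁, hσ₂]
      split_ifs <;> field_simp <;> ring
    rw [e, triSym_const_mul, triSym_add h.cont h.decays m₁ m₂ (hlin b₁) (hlin b₂), triSym_swap σ₂,
      enorm_mul, mul_pow, ENNReal.ofReal_pow hL.le, ← ofReal_norm, norm_real,
      Real.norm_of_nonneg hL.le]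
    gcongr
    exact (pow_le_pow_left' (enorm_add_le _ _) 2).trans (sq_add_le_of_sq_le le_rfl le_rfl)
  have mt : ∀ {σ : Rn 3 → Rn 3 → Rn 3 → ℝ},
      (Measurable fun z : Rn 3 × Rn 3 × Rn 3 => σ z.1 z.2.1 z.2.2) →
      Measurable fun q : ℝ × Rn 3 => ‖triSym σ (u q.1) q.2‖ₑ ^ 2 := fun hm =>
    (measurable_triSym h.cont hm).enorm.pow_const 2
  have mt' : ∀ {σ : Rn 3 → Rn 3 → Rn 3 → ℝ},
      (Measurable fun z : Rn 3 × Rn 3 × Rn 3 => σ z.1 z.2.1 z.2.2) → ∀ t,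
      Measurable fun ξ : Rn 3 => ‖triSym σ (u t) ξ‖ₑ ^ 2 := fun hm t =>
    (mt hm).comp (f := fun ξ => (t, ξ)) (by fun_prop)
  have mi : ∀ {σ : Rn 3 → Rn 3 → Rn 3 → ℝ},
      (Measurable fun z : Rn 3 × Rn 3 × Rn 3 => σ z.1 z.2.1 z.2.2) →
      Measurable fun t : ℝ => ∫⁻ ξ, ‖triSym σ (u t) ξ‖ₑ ^ 2 := fun hm =>
    Measurable.lintegral_prod_right' (mt hm)
  have m₃ : Measurable fun z : Rn 3 × Rn 3 × Rn 3 => σ₂ z.2.2 z.2.1 z.1 :=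
    m₂.comp (f := fun z : Rn 3 × Rn 3 × Rn 3 => (z.2.2, z.2.1, z.1)) (by fun_prop)
  calc _ ≤ ∫⁻ t in Icc a b, ∫⁻ ξ, ENNReal.ofReal (L ^ 2) *
      (4 * (‖triSym σ₁ (u t) ξ‖ₑ ^ 2 + ‖triSym (fun x y z => σ₂ z y x) (u t) ξ‖ₑ ^ 2)) :=
        lintegral_mono fun t => lintegral_mono fun ξ => hsum t ξ
    _ = ENNReal.ofReal (L ^ 2) * (4 * ((∫⁻ t in Icc a b, ∫⁻ ξ, ‖triSym σ₁ (u t) ξ‖ₑ ^ 2) +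
        ∫⁻ t in Icc a b, ∫⁻ ξ, ‖triSym (fun x y z => σ₂ z y x) (u t) ξ‖ₑ ^ 2)) := by
        have q1 := mi m₁
        have q2 := mi (σ := fun x y z => σ₂ z y x) m₃
        rw [← lintegral_add_left q1, ← lintegral_const_mul' _ _ (by finiteness),
          ← lintegral_const_mul' _ _ (by finiteness)]
        refine lintegral_congr fun t => ?_
        have r1 := mt' m₁ t
        have r2 := mt' (σ := fun x y z => σ₂ z y x) m₃ t
        rw [← lintegral_add_left r1, ← lintegral_const_mul' _ _ (by finiteness),
          ← lintegral_const_mul' _ _ (by finiteness)]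
    _ ≤ _ := by
        refine (mul_le_mul_right (mul_le_mul_right (add_le_add i₁ i₂) _) _).trans (le_of_eq ?_)
        ring

lemma cutW_add_sub_le {M r : ℝ} (hM : 0 < M) (hr : 0 ≤ r) (hr1 : r ≤ 1) (a b c : Rn 3) :
    |cutW M r (a - b + c)| ≤ 3 * dampW M r (max3 a b c) := by
  rw [abs_of_pos (cutW_pos hM _)]
  have hm := max3_pos a b c
  have h1 : jap (a - b + c) ≤ 3 * max3 a b c := by
    have := jap_add_sub_le a c b
    rw [show a + c - b = a - b + c by abel] at this
    have q1 : jap a ≤ max3 a b c := (le_max_left _ _).trans (le_max_left _ _)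
    have q2 : jap b ≤ max3 a b c := (le_max_right _ _).trans (le_max_left _ _)
    have q3 : jap c ≤ max3 a b c := le_max_right _ _
    linarith
  calc _ ≤ dampW M r (3 * max3 a b c) := dampW_mono hM hr hr1 (jap_pos _) h1
    _ ≤ 3 * max3 a b c * cut M r (max3 a b c) := by
        rw [dampW]
        gcongr
        exact cut_anti hM hm hr (by linarith)
    _ = _ := by rw [dampW]; ring

lemma enorm_triSym_cutW {M r : ℝ} (hM : 0 < M) (f : Rn 3 → ℂ) (ξ : Rn 3) :
    ‖triSym (fun a b c => cutW M r (a - b + c)) f ξ‖ₑ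
      = ENNReal.ofReal (cutW M r ξ) * absE (cubicN f) ξ := by
  have e : triSym (fun a b c => cutW M r (a - b + c)) f ξ = cutW M r ξ * cubicN f ξ := by
    simp only [cubicN, triSym]
    rw [← integral_const_mul]
    refine integral_congr_ae (.of_forall fun w => ?_)
    simp only
    rw [show w.1 - (w.1 + w.2 - ξ) + w.2 = ξ by abel]
    simp
  rw [e, enorm_mul, absE, ← ofReal_norm (cutW M r ξ : ℂ), norm_real,
    Real.norm_of_nonneg (cutW_pos hM ξ).le]

lemma Decays.wnormSq_le {f : ℝ → Rn 3 → ℂ} (hf : Decays f) :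
    ∃ D : ℝ, ∀ (w : Rn 3 → ℝ), (∀ x, |w x| ≤ jap x) → ∀ t,
      wnormSq w (absE (f t)) ≤ ENNReal.ofReal D := by
  obtain ⟨D, hD0, hD⟩ := hf.exists_nonneg 3
  have hi := integrable_inv_jap_pow.const_mul (D ^ 2)
  refine ⟨∫ ξ : Rn 3, D ^ 2 * (jap ξ ^ 4)⁻¹, fun w hw t => ?_⟩
  rw [ofReal_integral_eq_lintegral_ofReal hi
    (.of_forall fun ξ => by have := jap_pos ξ; positivity)]
  refine lintegral_mono fun ξ => ?_
  have hj := jap_pos ξ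
  have hw1 : w ξ ≤ jap ξ := (le_abs_self _).trans (hw ξ)
  have h2 : jap ξ * ‖f t ξ‖ ≤ D * (jap ξ ^ 2)⁻¹ := by
    rw [← div_eq_mul_inv, le_div_iff₀ (by positivity)]
    calc _ = jap ξ ^ 3 * ‖f t ξ‖ := by ring
      _ ≤ _ := hD t ξ
  calc (ENNReal.ofReal (w ξ) * absE (f t) ξ) ^ 2 ≤ (ENNReal.ofReal (jap ξ) * absE (f t) ξ) ^ 2 := by
        gcongr
    _ = ENNReal.ofReal ((jap ξ * ‖f t ξ‖) ^ 2) := by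
        rw [absE, ← ofReal_norm, ← ENNReal.ofReal_mul hj.le, ENNReal.ofReal_pow (by positivity)]
    _ ≤ ENNReal.ofReal ((D * (jap ξ ^ 2)⁻¹) ^ 2) := by gcongr
    _ = _ := by congr 1; rw [mul_pow, inv_pow, ← pow_mul]

lemma abs_cutW_le {M r : ℝ} (hM : 0 < M) (hr : 0 ≤ r) (x : Rn 3) : |cutW M r x| ≤ jap x := by
  rw [abs_of_pos (cutW_pos hM x)]
  exact mul_le_of_le_one_right (jap_pos x).le (cut_le_one hM (jap_pos x) hr)

lemma CubicProfile.slabNorm_lt_top {T : ℝ} {u : ℝ → Rn 3 → ℂ} (h : CubicProfile T u) {M r : ℝ}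
    (hM : 0 < M) (hr : 0 ≤ r) (a b : ℝ) : slabNorm u M r a b < ⊤ := by
  obtain ⟨D, hD⟩ := h.decays_cubicN.wnormSq_le
  calc slabNorm u M r a b ≤ ∫⁻ t in Icc a b, ENNReal.ofReal D :=
        lintegral_mono fun t => hD _ (abs_cutW_le hM hr) t
    _ < ⊤ := by
        rw [setLIntegral_const, Real.volume_Icc]
        finiteness

/-- On short slabs the quadrilinear and trilinear bounds close. -/
theorem exists_slab_estimates {δ : ℝ} (hδ : 0 < δ) (hδ1 : δ ≤ 1 / 4) :
    ∃ C : ℝ, 1 ≤ C ∧ ∀ (T : ℝ) (u : ℝ → Rn 3 → ℂ), CubicProfile T u →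
    ∀ (a b τ M p : ℝ) (K : ℝ), 0 ≤ a → a ≤ b → b ≤ T →
    0 < τ → b - a ≤ τ → τ ≤ 1 → 0 < M → 0 ≤ p → 5 * p + 2 * (4 * δ) ≤ 1 → 0 ≤ K →
    C * M ^ (2 * (4 * δ)) * τ * K ^ 2 ≤ 1 / 2 →
    (∀ t ∈ Icc a b, wnormSq (cutW M p) (absE (u t)) ≤ ENNReal.ofReal K) →
    (∀ (Λ : ℝ) (S : Rn 3 × Rn 3 × Rn 3 → ℝ), 0 ≤ Λ → Measurable S →
      (∀ z, |S z| ≤ Λ * cutKer δ M p (5 * p + 2 * (4 * δ)) z) →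
      ‖∫ t in a..b, ∫ z, (S z : ℂ) * quart (u t) (u t) (u t) (u t) z‖ ≤ C * Λ * K ^ 2) ∧
    (∀ (L : ℝ) (σ : Rn 3 → Rn 3 → Rn 3 → ℝ), 0 < L →
      (Measurable fun z : Rn 3 × Rn 3 × Rn 3 => σ z.1 z.2.1 z.2.2) →
      (∀ x y z, |σ x y z| ≤ L * dampW M (5 * p + 2 * (4 * δ)) (max3 x y z)) →
      ∫⁻ t in Icc a b, ∫⁻ ξ, ‖triSym σ (u t) ξ‖ₑ ^ 2
        ≤ ENNReal.ofReal (C * L ^ 2 * M ^ (2 * (4 * δ)) * K ^ 3)) := by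
  obtain ⟨C₁, hC₁, hQ⟩ := exists_enorm_integral_quart_le hδ hδ1
  obtain ⟨C₂, hC₂, hT⟩ := exists_lintegral_triSym_le hδ hδ1
  lift C₁ to NNReal using hC₁.ne with c₁
  lift C₂ to NNReal using hC₂.ne with c₂
  refine ⟨1 + 2 * c₁ + 9 * c₂, by linarith [c₁.coe_nonneg, c₂.coe_nonneg],
    fun T u h a b τ M p K ha hab hbT hτ hbτ hτ1 hM hp hr1 hK0 hsm hK => ?_⟩
  set C : ℝ := 1 + 2 * c₁ + 9 * c₂ with hC
  set r := 5 * p + 2 * (4 * δ) with hr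
  set D := M ^ (2 * (4 * δ)) with hD
  have hD0 : 0 < D := Real.rpow_pos_of_pos hM _
  have hr0 : 0 ≤ r := by positivity
  set Z := slabNorm u M r a b with hZ
  have hZt : Z < ⊤ := h.slabNorm_lt_top hM hr0 a b
  obtain ⟨y, hy⟩ : ∃ y : NNReal, Z = y := ⟨Z.toNNReal, (ENNReal.coe_toNNReal hZt.ne).symm⟩
  have hy0 : (0 : ℝ) ≤ y := y.2
  have hc₁ : (0 : ℝ) ≤ c₁ := c₁.2
  have hc₂ : (0 : ℝ) ≤ c₂ := c₂.2
  have real_form : ∀ L : ℝ, (c₂ : ENNReal) * ENNReal.ofReal (L ^ 2) * ENNReal.ofReal D *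
      (ENNReal.ofReal K * (ENNReal.ofReal K ^ 2 + ENNReal.ofReal τ * ENNReal.ofReal K * Z))
      = ENNReal.ofReal (c₂ * L ^ 2 * D * (K * (K ^ 2 + τ * K * y))) := fun L => by
    rw [hy, ← ENNReal.ofReal_coe_nnreal (p := y), ← ENNReal.ofReal_coe_nnreal (p := c₂),
      ← ENNReal.ofReal_mul (by positivity), ← ENNReal.ofReal_mul (by positivity),
      ← ENNReal.ofReal_pow hK0, ← ENNReal.ofReal_mul (by positivity),
      ← ENNReal.ofReal_mul (by positivity), ← ENNReal.ofReal_add (by positivity) (by positivity),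
      ← ENNReal.ofReal_mul (by positivity), ← ENNReal.ofReal_mul (by positivity)]
  have hyb : (y : ℝ) ≤ c₂ * 3 ^ 2 * D * (K * (K ^ 2 + τ * K * y)) := by
    have := hT T u h a b τ M p 3 (ENNReal.ofReal K) (fun a b c => cutW M r (a - b + c)) ha hab hbT hτ
      hbτ hτ1 hM hp hr1 (by norm_num) hK (by fun_prop) (cutW_add_sub_le hM hr0 hr1)
    rw [real_form] at this
    have e : (∫⁻ t in Icc a b, ∫⁻ ξ, ‖triSym (fun a b c => cutW M r (a - b + c)) (u t) ξ‖ₑ ^ 2) = Z := by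
      rw [hZ, slabNorm]
      refine lintegral_congr fun t => lintegral_congr fun ξ => ?_
      rw [enorm_triSym_cutW hM]
    rw [e, hy, ← ENNReal.ofReal_coe_nnreal (p := y)] at this
    exact (ENNReal.ofReal_le_ofReal_iff (by positivity)).1 this
  have hτy : τ * K * y ≤ K ^ 2 := by
    have h9 : c₂ * 3 ^ 2 * D * τ * K ^ 2 ≤ 1 / 2 := le_trans (by
      gcongr
      linarith) hsm
    have h2 : (y : ℝ) ≤ 2 * (c₂ * 3 ^ 2 * D * K ^ 3) := by
      have : (c₂ * 3 ^ 2 * D * τ * K ^ 2) * y ≤ 1 / 2 * y := by gcongr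
      nlinarith
    calc τ * K * y ≤ τ * K * (2 * (c₂ * 3 ^ 2 * D * K ^ 3)) := by gcongr
      _ = (c₂ * 3 ^ 2 * D * τ * K ^ 2) * 2 * K ^ 2 := by ring
      _ ≤ 1 / 2 * 2 * K ^ 2 := by gcongr
      _ = K ^ 2 := by ring
  constructor
  · intro Λ S hΛ hS hSb
    have := hQ T u h a b τ M p r Λ (ENNReal.ofReal K) S ha hab hbT hτ hbτ hτ1 hM hp
      (by linarith) hΛ hK hS hSb
    have e : (c₁ : ENNReal) * ENNReal.ofReal Λ *
        (ENNReal.ofReal K ^ 2 + ENNReal.ofReal τ * ENNReal.ofReal K * Z)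
        = ENNReal.ofReal (c₁ * Λ * (K ^ 2 + τ * K * y)) := by
      rw [hy, ← ENNReal.ofReal_coe_nnreal (p := y), ← ENNReal.ofReal_coe_nnreal (p := c₁),
        ← ENNReal.ofReal_mul (by positivity), ← ENNReal.ofReal_pow hK0,
        ← ENNReal.ofReal_mul (by positivity), ← ENNReal.ofReal_mul (by positivity),
        ← ENNReal.ofReal_add (by positivity) (by positivity), ← ENNReal.ofReal_mul (by positivity)]
    rw [e, ← ofReal_norm, ENNReal.ofReal_le_ofReal_iff (by positivity)] at this
    refine this.trans ?_
    calc _ ≤ c₁ * Λ * (K ^ 2 + K ^ 2) := by gcongr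
      _ = (2 * c₁) * Λ * K ^ 2 := by ring
      _ ≤ _ := by gcongr; linarith
  · intro L σ hL hσ hσb
    refine (hT T u h a b τ M p L (ENNReal.ofReal K) σ ha hab hbT hτ hbτ hτ1 hM hp hr1 hL hK hσ
      hσb).trans ?_
    rw [real_form]
    refine ENNReal.ofReal_le_ofReal ?_
    calc _ ≤ c₂ * L ^ 2 * D * (K * (K ^ 2 + K ^ 2)) := by gcongr
      _ = (2 * c₂) * L ^ 2 * D * K ^ 3 := by ring
      _ ≤ _ := by gcongr; linarith

/-- The fundamental theorem of calculus under a dominated integral. -/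
lemma integral_sub_integral_of_hasDerivAt {α E : Type*} [TopologicalSpace α] [MeasurableSpace α]
    [BorelSpace α] [SecondCountableTopology α] [NormedAddCommGroup E] [NormedSpace ℝ E]
    [CompleteSpace E] [MeasurableSpace E] [BorelSpace E] [SecondCountableTopology E]
    {μ : Measure α} [SFinite μ] {F G : ℝ → α → E} (hF : Continuous fun p : ℝ × α => F p.1 p.2)
    (hG : Continuous fun p : ℝ × α => G p.1 p.2) {B₁ B₂ : α → ℝ} (hB₁ : Integrable B₁ μ)
    (hB₂ : Integrable B₂ μ) (bF : ∀ t x, ‖F t x‖ ≤ B₁ x) (bG : ∀ t x, ‖G t x‖ ≤ B₂ x) {a b : ℝ}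
    (hab : a ≤ b) (hd : ∀ t ∈ Ioo a b, ∀ x, HasDerivAt (fun t => F t x) (G t x) t) :
    (∫ x, F b x ∂μ) - ∫ x, F a x ∂μ = ∫ t in a..b, ∫ x, G t x ∂μ := by
  have hi : ∀ t, Integrable (F t) μ := fun t =>
    hB₁.mono' (hF.comp (f := fun x => (t, x)) (by fun_prop)).measurable.aestronglyMeasurable
      (.of_forall fun x => bF t x)
  have : IsFiniteMeasure (volume.restrict (uIoc a b)) := by
    rw [uIoc_of_le hab]; infer_instance
  rw [intervalIntegral_integral_swap, ← integral_sub (hi b) (hi a)]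
  · refine integral_congr_ae (.of_forall fun x => ?_)
    have c1 : Continuous fun t => F t x := hF.comp (f := fun t => (t, x)) (by fun_prop)
    have c2 : Continuous fun t => G t x := hG.comp (f := fun t => (t, x)) (by fun_prop)
    exact (intervalIntegral.integral_eq_sub_of_hasDerivAt_of_le hab c1.continuousOn
      (fun t ht => hd t ht x) (c2.intervalIntegrable a b)).symm
  · have h1 : Integrable (fun q : ℝ × α => (1 : ℝ) * B₂ q.2)
        ((volume.restrict (uIoc a b)).prod μ) :=
      Integrable.mul_prod (f := fun _ : ℝ => (1 : ℝ)) (integrable_const _) hB₂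
    refine h1.mono' hG.measurable.aestronglyMeasurable (.of_forall fun q => ?_)
    rw [one_mul]
    exact bG q.1 q.2

/-- The right-hand side of the evolution equation on the Fourier side. -/
def velo (u : ℝ → Rn 3 → ℂ) (t : ℝ) (ξ : Rn 3) : ℂ :=
  -I * ((4 * Real.pi ^ 2 * ‖ξ‖ ^ 2 : ℝ) * u t ξ + cubicN (u t) ξ)

lemma abs_laplace_le (ξ : Rn 3) : |4 * Real.pi ^ 2 * ‖ξ‖ ^ 2| ≤ 4 * Real.pi ^ 2 * jap ξ ^ 2 := by
  rw [abs_of_nonneg (by positivity), jap_sq]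
  gcongr
  linarith

section
variable {T : ℝ} {u : ℝ → Rn 3 → ℂ}

lemma CubicProfile.cont_velo (h : CubicProfile T u) :
    Continuous fun p : ℝ × Rn 3 => velo u p.1 p.2 := by
  have := h.cont
  have := h.cont_cubicN
  unfold velo
  fun_prop

lemma CubicProfile.decays_velo (h : CubicProfile T u) : Decays (velo u) :=
  ((h.decays.mul_left abs_laplace_le).add h.decays_cubicN).const_mul (-I)

lemma Decays.mul_bound {f g : ℝ → Rn 3 → ℂ} (hf : Decays f) (hg : Decays g) (n : ℕ) :
    ∃ D, 0 ≤ D ∧ ∀ t ξ, jap ξ ^ n * (‖f t ξ‖ * ‖g t ξ‖) ≤ D * (jap ξ ^ 4)⁻¹ := by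
  obtain ⟨D₁, p₁, hD₁⟩ := hf.exists_nonneg (n + 4)
  obtain ⟨D₂, p₂, hD₂⟩ := hg.bound
  refine ⟨D₁ * D₂, by positivity, fun t ξ => ?_⟩
  have j := jap_pos ξ
  rw [← div_eq_mul_inv, le_div_iff₀ (by positivity)]
  calc _ = (jap ξ ^ (n + 4) * ‖f t ξ‖) * ‖g t ξ‖ := by ring
    _ ≤ _ := by gcongr; exacts [hD₁ t ξ, hD₂ t ξ]

lemma inner_velo (t : ℝ) (ξ : Rn 3) :
    2 * ⟪u t ξ, velo u t ξ⟫ = 2 * (conj (u t ξ) * cubicN (u t) ξ).im := by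
  rw [Complex.inner, velo]
  congr 1
  simp only [mul_re, mul_im, neg_re, neg_im, I_re, I_im, conj_re, conj_im, add_re, add_im,
    ofReal_re, ofReal_im]
  ring

theorem CubicProfile.integral_weight_sub (h : CubicProfile T u) {w : Rn 3 → ℝ} (hw : Continuous w)
    {L : ℝ} {n : ℕ} (hwb : ∀ ξ, |w ξ| ≤ L * jap ξ ^ n) {a b : ℝ} (ha : 0 ≤ a) (hab : a ≤ b)
    (hbT : b ≤ T) :
    (∫ ξ, w ξ * ‖u b ξ‖ ^ 2) - ∫ ξ, w ξ * ‖u a ξ‖ ^ 2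
      = ∫ t in a..b, 2 * (∫ ξ, w ξ * (conj (u t ξ) * cubicN (u t) ξ)).im := by
  have hL : 0 ≤ L := nonneg_of_mul_nonneg_left ((abs_nonneg _).trans (hwb 0))
    (pow_pos (jap_pos _) _)
  obtain ⟨D₁, p₁, hD₁⟩ := h.decays.mul_bound h.decays n
  obtain ⟨D₂, p₂, hD₂⟩ := h.decays.mul_bound h.decays_velo n
  obtain ⟨D₃, p₃, hD₃⟩ := h.decays.mul_bound h.decays_cubicN n
  have cu := h.cont
  have cv := h.cont_velo
  have cN := h.cont_cubicN
  have key := integral_sub_integral_of_hasDerivAt (μ := volume) (F := fun t ξ => w ξ * ‖u t ξ‖ ^ 2)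
    (G := fun t ξ => w ξ * (2 * ⟪u t ξ, velo u t ξ⟫)) (by fun_prop) (by fun_prop)
    ((integrable_inv_jap_pow.const_mul D₁).const_mul L)
    (((integrable_inv_jap_pow.const_mul D₂).const_mul 2).const_mul L)
    (fun t ξ => by
      rw [norm_mul, Real.norm_eq_abs, Real.norm_of_nonneg (by positivity)]
      calc _ ≤ (L * jap ξ ^ n) * ‖u t ξ‖ ^ 2 := by gcongr; exact hwb ξ
        _ = L * (jap ξ ^ n * (‖u t ξ‖ * ‖u t ξ‖)) := by ring
        _ ≤ _ := mul_le_mul_of_nonneg_left (hD₁ t ξ) hL)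
    (fun t ξ => by
      rw [norm_mul, Real.norm_eq_abs, norm_mul, Real.norm_ofNat]
      have := jap_pos ξ
      calc _ ≤ (L * jap ξ ^ n) * (2 * (‖u t ξ‖ * ‖velo u t ξ‖)) := by
            gcongr
            exacts [hwb ξ, norm_inner_le_norm _ _]
        _ = L * (2 * (jap ξ ^ n * (‖u t ξ‖ * ‖velo u t ξ‖))) := by ring
        _ ≤ _ := mul_le_mul_of_nonneg_left (mul_le_mul_of_nonneg_left (hD₂ t ξ) zero_le_two) hL) hab
    (fun t ht ξ => ((h.deriv t ⟨ha.trans_lt ht.1, ht.2.trans_le hbT⟩ ξ).norm_sq).const_mul (w ξ))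
  rw [key]
  refine intervalIntegral.integral_congr fun t _ => ?_
  have hi : Integrable fun ξ => (w ξ : ℂ) * (conj (u t ξ) * cubicN (u t) ξ) := by
    refine ((integrable_inv_jap_pow.const_mul D₃).const_mul L).mono' ?_ (.of_forall fun ξ => ?_)
    · have c1 := continuous_slice cu t
      have c2 := continuous_slice (u := fun t => cubicN (u t)) cN t
      refine Measurable.aestronglyMeasurable (Continuous.measurable ?_)
      exact (continuous_ofReal.comp hw).mul ((continuous_conj.comp c1).mul c2)
    · rw [norm_mul, norm_mul, RCLike.norm_conj, norm_real, Real.norm_eq_abs]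
      calc _ ≤ (L * jap ξ ^ n) * (‖u t ξ‖ * ‖cubicN (u t) ξ‖) := by gcongr; exact hwb ξ
        _ = L * (jap ξ ^ n * (‖u t ξ‖ * ‖cubicN (u t) ξ‖)) := by ring
        _ ≤ _ := mul_le_mul_of_nonneg_left (hD₃ t ξ) hL
  have : (∫ ξ, (w ξ : ℂ) * (conj (u t ξ) * cubicN (u t) ξ)).im
      = ∫ ξ, ((w ξ : ℂ) * (conj (u t ξ) * cubicN (u t) ξ)).im := (integral_im hi).symm
  rw [this, ← integral_const_mul]
  refine integral_congr_ae (.of_forall fun ξ => ?_)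
  simp only
  rw [inner_velo, im_ofReal_mul]
  ring

lemma measurePreserving_conj_swap :
    MeasurePreserving (fun z : Rn 3 × Rn 3 × Rn 3 => (z.2.1 + z.2.2 - z.1, z.2.1, z.2.2)) := by
  have h1 : MeasurePreserving (fun q : (Rn 3 × Rn 3) × Rn 3 => (q.1, q.1.1 + q.1.2 - q.2))
      (volume.prod volume) (volume.prod volume) :=
    MeasurePreserving.skew_product (g := fun q : Rn 3 × Rn 3 => fun x => q.1 + q.2 - x)
      (MeasurePreserving.id volume) (by fun_prop)
      (.of_forall fun q => (Measure.measurePreserving_sub_left volume (q.1 + q.2)).map_eq)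
  exact (Measure.measurePreserving_swap.comp h1).comp Measure.measurePreserving_swap

lemma measurePreserving_plain_swap :
    MeasurePreserving (fun z : Rn 3 × Rn 3 × Rn 3 => (z.1, z.2.2, z.2.1)) :=
  (MeasurePreserving.id volume).prod Measure.measurePreserving_swap

lemma measurePreserving_pair_swap :
    MeasurePreserving (fun z : Rn 3 × Rn 3 × Rn 3 => (z.2.1, z.1, z.2.1 + z.2.2 - z.1)) := by
  have h1 : MeasurePreserving (fun q : (Rn 3 × Rn 3) × Rn 3 => (q.1.swap, q.1.2 + q.2 - q.1.1))
      (volume.prod volume) (volume.prod volume) :=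
    MeasurePreserving.skew_product (g := fun q : Rn 3 × Rn 3 => fun x => q.2 + x - q.1)
      Measure.measurePreserving_swap (by fun_prop)
      (.of_forall fun q => by
        have := (measurePreserving_add_left volume (q.2 - q.1)).map_eq
        rwa [show (fun x => q.2 - q.1 + x) = fun x => q.2 + x - q.1 by ext x : 1; abel] at this)
  have h2 : MeasurePreserving (MeasurableEquiv.prodAssoc : (Rn 3 × Rn 3) × Rn 3 ≃ᵐ _) :=
    measurePreserving_prodAssoc volume volume volume
  exact (h2.comp h1).comp h2.symm

end

section
variable {f₁ f₂ f₃ f₄ : ℝ → Rn 3 → ℂ} (c₁ : Continuous fun p : ℝ × Rn 3 => f₁ p.1 p.2)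
  (c₂ : Continuous fun p : ℝ × Rn 3 => f₂ p.1 p.2) (c₃ : Continuous fun p : ℝ × Rn 3 => f₃ p.1 p.2)
  (c₄ : Continuous fun p : ℝ × Rn 3 => f₄ p.1 p.2) (d₁ : Decays f₁) (d₂ : Decays f₂)
  (d₃ : Decays f₃) (d₄ : Decays f₄)
include c₁ c₂ c₃ c₄ d₁ d₂ d₃ d₄

lemma integrable_mul_quart_mixed {S : Rn 3 × Rn 3 × Rn 3 → ℝ} (hS : Measurable S)
    (hSb : ∀ z, |S z| ≤ 1) (t : ℝ) :
    Integrable fun z => (S z : ℂ) * quart (f₁ t) (f₂ t) (f₃ t) (f₄ t) z := by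
  obtain ⟨D, hD0, hD⟩ := d₁.quart d₂ d₃ d₄ 0
  have cq := ((continuous_quart c₁ c₂ c₃ c₄).comp (f := fun z => (t, z)) (by fun_prop)).measurable
  refine (integrable_inv_japTriple_pow.const_mul D).mono' ?_ (.of_forall fun z => ?_)
  · exact ((measurable_ofReal.comp hS).mul cq).aestronglyMeasurable
  · rw [norm_mul, norm_real, Real.norm_eq_abs]
    calc _ ≤ 1 * ‖quart (f₁ t) (f₂ t) (f₃ t) (f₄ t) z‖ := by gcongr; exact hSb z
      _ = japTriple z ^ 0 * ‖quart (f₁ t) (f₂ t) (f₃ t) (f₄ t) z‖ := by rw [pow_zero]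
      _ ≤ _ := hD t z

lemma integrable_quart_mixed (t : ℝ) : Integrable fun z => quart (f₁ t) (f₂ t) (f₃ t) (f₄ t) z := by
  have := integrable_mul_quart_mixed c₁ c₂ c₃ c₄ d₁ d₂ d₃ d₄ (S := fun _ => 1) measurable_const
    (fun _ => by simp) t
  simpa using this

end

section
variable {f g : ℝ → Rn 3 → ℂ} (cf : Continuous fun p : ℝ × Rn 3 => f p.1 p.2) (df : Decays f)
  (cg : Continuous fun p : ℝ × Rn 3 => g p.1 p.2) (dg : Decays g)
include cf df cg dg

lemma integral_mul_quart_eq_triSym {σ : Rn 3 → Rn 3 → Rn 3 → ℝ}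
    (hσ : Measurable fun z : Rn 3 × Rn 3 × Rn 3 => σ z.1 z.2.1 z.2.2)
    (hσb : ∀ a b c, |σ a b c| ≤ 1) (t : ℝ) :
    ∫ z : Rn 3 × Rn 3 × Rn 3, (σ z.2.1 (z.2.1 + z.2.2 - z.1) z.2.2 : ℂ) *
      quart (g t) (f t) (f t) (f t) z = ∫ ξ, conj (g t ξ) * triSym σ (f t) ξ := by
  have hi := integrable_mul_quart_mixed cg cf cf cf dg df df df
    (S := fun z => σ z.2.1 (z.2.1 + z.2.2 - z.1) z.2.2)
    (hσ.comp (f := fun z : Rn 3 × Rn 3 × Rn 3 => (z.2.1, z.2.1 + z.2.2 - z.1, z.2.2)) (by fun_prop))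
    (fun z => hσb _ _ _) t
  rw [Measure.volume_eq_prod, integral_prod _ hi]
  refine integral_congr_ae (.of_forall fun ξ => ?_)
  simp only [triSym]
  rw [← integral_const_mul]
  refine integral_congr_ae (.of_forall fun w => ?_)
  simp only [quart]
  ring

/-- The four terms in the time derivative of the quartic form have the same real part. -/
lemma integral_quart_derivative (t : ℝ) :
    (∫ z, (quart (g t) (f t) (f t) (f t) z + quart (f t) (g t) (f t) (f t) z
      + quart (f t) (f t) (g t) (f t) z + quart (f t) (f t) (f t) (g t) z)).re
      = 4 * (∫ z, quart (g t) (f t) (f t) (f t) z).re := by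
  have i1 := integrable_quart_mixed cg cf cf cf dg df df df t
  have i2 := integrable_quart_mixed cf cg cf cf df dg df df t
  have i3 := integrable_quart_mixed cf cf cg cf df df dg df t
  have i4 := integrable_quart_mixed cf cf cf cg df df df dg t
  have e3 : ∫ z, quart (f t) (f t) (g t) (f t) z = ∫ z, quart (g t) (f t) (f t) (f t) z := by
    rw [← integral_comp_of_measurePreserving measurePreserving_conj_swap i1.aestronglyMeasurable]
    refine integral_congr_ae (.of_forall fun z => ?_)
    simp only [quart, sub_sub_cancel]
    ring
  have e4 : ∫ z, quart (f t) (f t) (f t) (g t) z = ∫ z, quart (f t) (g t) (f t) (f t) z := by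
    rw [← integral_comp_of_measurePreserving measurePreserving_plain_swap i2.aestronglyMeasurable]
    refine integral_congr_ae (.of_forall fun z => ?_)
    simp only [quart, add_comm z.2.2]
    ring
  have e2 : ∫ z, quart (f t) (g t) (f t) (f t) z = conj (∫ z, quart (g t) (f t) (f t) (f t) z) := by
    rw [← integral_comp_of_measurePreserving measurePreserving_pair_swap i2.aestronglyMeasurable,
      ← integral_conj]
    refine integral_congr_ae (.of_forall fun z => ?_)
    simp only [quart, map_mul, conj_conj]
    rw [show z.1 + (z.2.1 + z.2.2 - z.1) - z.2.1 = z.2.2 by abel]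
    ring
  have i12 : Integrable fun z => quart (g t) (f t) (f t) (f t) z + quart (f t) (g t) (f t) (f t) z :=
    i1.add i2
  have i123 : Integrable fun z => quart (g t) (f t) (f t) (f t) z + quart (f t) (g t) (f t) (f t) z
      + quart (f t) (f t) (g t) (f t) z := i12.add i3
  rw [integral_add i123 i4, integral_add i12 i3, integral_add i1 i2, e4, e3, e2]
  simp only [add_re, conj_re]
  ring

theorem integral_quart_sub {a b : ℝ} (hab : a ≤ b)
    (hd : ∀ t ∈ Ioo a b, ∀ ξ, HasDerivAt (fun t => f t ξ) (g t ξ) t) :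
    (∫ z, quart (f b) (f b) (f b) (f b) z) - ∫ z, quart (f a) (f a) (f a) (f a) z
      = ∫ t in a..b, ∫ z, (quart (g t) (f t) (f t) (f t) z + quart (f t) (g t) (f t) (f t) z
      + quart (f t) (f t) (g t) (f t) z + quart (f t) (f t) (f t) (g t) z) := by
  obtain ⟨D, -, hD⟩ := df.quart df df df 0
  obtain ⟨D₁, -, hD₁⟩ := dg.quart df df df 0
  obtain ⟨D₂, -, hD₂⟩ := df.quart dg df df 0
  obtain ⟨D₃, -, hD₃⟩ := df.quart df dg df 0
  obtain ⟨D₄, -, hD₄⟩ := df.quart df df dg 0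
  simp only [pow_zero, one_mul] at hD hD₁ hD₂ hD₃ hD₄
  refine integral_sub_integral_of_hasDerivAt (continuous_quart cf cf cf cf)
    ((((continuous_quart cg cf cf cf).add (continuous_quart cf cg cf cf)).add
      (continuous_quart cf cf cg cf)).add (continuous_quart cf cf cf cg))
    (integrable_inv_japTriple_pow.const_mul D)
    (integrable_inv_japTriple_pow.const_mul (D₁ + D₂ + D₃ + D₄)) hD (fun t z => ?_) hab
    (fun t ht z => hasDerivAt_quart (hd t ht) (hd t ht) (hd t ht) (hd t ht) z)
  refine (norm_add_le _ _).trans ?_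
  have h1 := norm_add_le (quart (g t) (f t) (f t) (f t) z + quart (f t) (g t) (f t) (f t) z)
    (quart (f t) (f t) (g t) (f t) z)
  have h2 := norm_add_le (quart (g t) (f t) (f t) (f t) z) (quart (f t) (g t) (f t) (f t) z)
  have := hD₁ t z
  have := hD₂ t z
  have := hD₃ t z
  have := hD₄ t z
  rw [add_mul, add_mul, add_mul]
  linarith

end

/-- The multiplier `cut M p` applied on the Fourier side. -/
def cutMul (M p : ℝ) (f : Rn 3 → ℂ) (ξ : Rn 3) : ℂ := (cut M p (jap ξ) : ℂ) * f ξ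

/-- The energy of the damped profile. -/
def cutEnergy (M p : ℝ) (f : Rn 3 → ℂ) : ℝ :=
  1 / 2 * (∫ ξ, 4 * Real.pi ^ 2 * ‖ξ‖ ^ 2 * cut M p (jap ξ) ^ 2 * ‖f ξ‖ ^ 2) +
    1 / 4 * (∫ z, quart (cutMul M p f) (cutMul M p f) (cutMul M p f) (cutMul M p f) z).re

/-- The symbol of the damped Laplacian. -/
def cutLap (M p : ℝ) (ξ : Rn 3) : ℝ := 4 * Real.pi ^ 2 * ‖ξ‖ ^ 2 * cut M p (jap ξ)

/-- The symbol of the commutator of the multiplier with the nonlinearity. -/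
def cutComm (M p : ℝ) (a b c : Rn 3) : ℝ :=
  cut M p (jap (a - b + c)) - cut M p (jap a) * cut M p (jap b) * cut M p (jap c)

lemma measurable_cutComm {M p : ℝ} :
    Measurable fun z : Rn 3 × Rn 3 × Rn 3 => cutComm M p z.1 z.2.1 z.2.2 := by
  unfold cutComm
  fun_prop

lemma abs_cutComm_le {M p : ℝ} (hM : 0 < M) (hp : 0 ≤ p) (a b c : Rn 3) : |cutComm M p a b c| ≤ 1 := by
  have h (x : Rn 3) : 0 < cut M p (jap x) := cut_pos hM (jap_pos x)
  have h1 (x : Rn 3) : cut M p (jap x) ≤ 1 := cut_le_one hM (jap_pos x) hp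
  have e : cut M p (jap a) * cut M p (jap b) * cut M p (jap c) ≤ 1 :=
    mul_le_one₀ (mul_le_one₀ (h1 a) (h b).le (h1 b)) (h c).le (h1 c)
  have e0 : 0 < cut M p (jap a) * cut M p (jap b) * cut M p (jap c) :=
    mul_pos (mul_pos (h a) (h b)) (h c)
  rw [cutComm, abs_le]
  constructor <;> linarith [h (a - b + c), h1 (a - b + c)]

lemma integrable_conj_mul {f g : ℝ → Rn 3 → ℂ} (cf : Continuous fun p : ℝ × Rn 3 => f p.1 p.2)
    (df : Decays f) (cg : Continuous fun p : ℝ × Rn 3 => g p.1 p.2) (dg : Decays g) (t : ℝ) :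
    Integrable fun ξ => conj (f t ξ) * g t ξ := by
  obtain ⟨D, -, hD⟩ := df.mul_bound dg 0
  refine (integrable_inv_jap_pow.const_mul D).mono'
    ((continuous_conj.comp (continuous_slice cf t)).mul (continuous_slice cg t)).aestronglyMeasurable
    (.of_forall fun ξ => ?_)
  rw [norm_mul, RCLike.norm_conj]
  simpa using hD t ξ

lemma continuous_integral_conj_mul {f g : ℝ → Rn 3 → ℂ}
    (cf : Continuous fun p : ℝ × Rn 3 => f p.1 p.2) (df : Decays f)
    (cg : Continuous fun p : ℝ × Rn 3 => g p.1 p.2) (dg : Decays g) :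
    Continuous fun t => ∫ ξ, conj (f t ξ) * g t ξ := by
  obtain ⟨D, -, hD⟩ := df.mul_bound dg 0
  refine continuous_of_dominated (bound := fun ξ => D * (jap ξ ^ 4)⁻¹)
    (fun t => (integrable_conj_mul cf df cg dg t).aestronglyMeasurable)
    (fun t => .of_forall fun ξ => ?_) (integrable_inv_jap_pow.const_mul D) (.of_forall fun ξ => ?_)
  · rw [norm_mul, RCLike.norm_conj]
    simpa using hD t ξ
  · exact (continuous_conj.comp (cf.comp (f := fun t => (t, ξ)) (by fun_prop))).mul
      (cg.comp (f := fun t => (t, ξ)) (by fun_prop))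

lemma continuous_integral_quart {f₁ f₂ f₃ f₄ : ℝ → Rn 3 → ℂ}
    (c₁ : Continuous fun p : ℝ × Rn 3 => f₁ p.1 p.2)
    (c₂ : Continuous fun p : ℝ × Rn 3 => f₂ p.1 p.2)
    (c₃ : Continuous fun p : ℝ × Rn 3 => f₃ p.1 p.2)
    (c₄ : Continuous fun p : ℝ × Rn 3 => f₄ p.1 p.2)
    (d₁ : Decays f₁) (d₂ : Decays f₂) (d₃ : Decays f₃) (d₄ : Decays f₄) :
    Continuous fun t => ∫ z, quart (f₁ t) (f₂ t) (f₃ t) (f₄ t) z := by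
  obtain ⟨D, -, hD⟩ := d₁.quart d₂ d₃ d₄ 0
  have hc := continuous_quart c₁ c₂ c₃ c₄
  refine continuous_of_dominated (bound := fun z => D * (japTriple z ^ 4)⁻¹)
    (fun t => (hc.comp (f := fun z => (t, z)) (by fun_prop)).aestronglyMeasurable)
    (fun t => .of_forall fun z => by simpa using hD t z) (integrable_inv_japTriple_pow.const_mul D)
    (.of_forall fun z => hc.comp (f := fun t => (t, z)) (by fun_prop))

section
variable {T M p : ℝ} {u : ℝ → Rn 3 → ℂ}

lemma continuous_cutMul (hM : 0 < M) (hc : Continuous fun q : ℝ × Rn 3 => u q.1 q.2) :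
    Continuous fun q : ℝ × Rn 3 => cutMul M p (u q.1) q.2 := by
  have := (continuous_cut_jap (e := p) hM).comp (f := fun q : ℝ × Rn 3 => q.2) (by fun_prop)
  exact (continuous_ofReal.comp this).mul hc

lemma Decays.cutMul (hM : 0 < M) (hp : 0 ≤ p) (hd : Decays u) : Decays fun t => cutMul M p (u t) :=
  hd.mul_left (L := 1) (n := 0) fun ξ => by
    rw [abs_of_pos (cut_pos hM (jap_pos ξ)), pow_zero, one_mul]
    exact cut_le_one hM (jap_pos ξ) hp

lemma continuous_cutLap (hM : 0 < M) : Continuous (cutLap M p) := by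
  have := continuous_cut_jap (e := p) hM
  unfold cutLap
  fun_prop

lemma abs_cutLap_le (hM : 0 < M) (hp : 0 ≤ p) (ξ : Rn 3) :
    |cutLap M p ξ| ≤ 4 * Real.pi ^ 2 * jap ξ ^ 2 := by
  rw [cutLap, abs_mul, abs_of_pos (cut_pos hM (jap_pos ξ))]
  exact (mul_le_of_le_one_right (abs_nonneg _) (cut_le_one hM (jap_pos ξ) hp)).trans
    (abs_laplace_le ξ)

lemma triSym_cutComm (hM : 0 < M) (hp : 0 ≤ p) (hc : Continuous fun q : ℝ × Rn 3 => u q.1 q.2)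
    (hd : Decays u) (t : ℝ) (ξ : Rn 3) :
    triSym (cutComm M p) (u t) ξ = cutMul M p (cubicN (u t)) ξ - cubicN (cutMul M p (u t)) ξ := by
  have h1 (x : Rn 3) : |cut M p (jap x)| ≤ 1 := by
    rw [abs_of_pos (cut_pos hM (jap_pos x))]
    exact cut_le_one hM (jap_pos x) hp
  have hj (a b c : Rn 3) : (1 : ℝ) ≤ 1 * (jap a * jap b * jap c) := by
    rw [one_mul]
    exact one_le_mul_of_one_le_of_one_le (one_le_mul_of_one_le_of_one_le (one_le_jap a)
      (one_le_jap b)) (one_le_jap c)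
  have key := triSym_add hc hd (σ₁ := cutComm M p)
    (σ₂ := fun a b c => cut M p (jap a) * cut M p (jap b) * cut M p (jap c)) measurable_cutComm
    (by fun_prop) (fun a b c => (abs_cutComm_le hM hp a b c).trans (hj a b c)) (fun a b c => by
      refine le_trans ?_ (hj a b c)
      rw [abs_mul, abs_mul]
      exact mul_le_one₀ (mul_le_one₀ (h1 a) (abs_nonneg _) (h1 b)) (abs_nonneg _) (h1 c)) t ξ
  have e1 : triSym (fun a b c => cut M p (jap a) * cut M p (jap b) * cut M p (jap c)) (u t) ξ
      = cubicN (cutMul M p (u t)) ξ := by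
    refine integral_congr_ae (.of_forall fun w => ?_)
    simp only [cutMul, map_mul, conj_ofReal]
    push_cast
    ring
  have e2 : triSym (fun a b c => cutComm M p a b c +
      cut M p (jap a) * cut M p (jap b) * cut M p (jap c)) (u t) ξ = cutMul M p (cubicN (u t)) ξ := by
    rw [cutMul, cubicN, triSym, triSym, ← integral_const_mul]
    refine integral_congr_ae (.of_forall fun w => ?_)
    simp only [cutComm, sub_add_cancel]
    rw [show w.1 - (w.1 + w.2 - ξ) + w.2 = ξ by abel]
    push_cast
    ring
  rw [e1, e2] at key
  rw [key, add_sub_cancel_right]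

theorem CubicProfile.cutEnergy_sub (h : CubicProfile T u) (hM : 0 < M) (hp : 0 ≤ p) {a b : ℝ}
    (ha : 0 ≤ a) (hab : a ≤ b) (hbT : b ≤ T) :
    cutEnergy M p (u b) - cutEnergy M p (u a)
      = (∫ t in a..b, (∫ ξ, conj ((cutLap M p ξ : ℂ) * u t ξ) * triSym (cutComm M p) (u t) ξ).im) +
        ∫ t in a..b, (∫ ξ, conj (cutMul M p (cubicN (u t)) ξ) * triSym (cutComm M p) (u t) ξ).im := by
  have cv := continuous_cutMul (p := p) hM h.cont
  have dv := h.decays.cutMul hM hp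
  have cNv := continuous_triSym_one cv dv
  have dNv : Decays fun t => cubicN (cutMul M p (u t)) :=
    decays_triSym (L := 1) dv fun a b c => by
      rw [abs_one, one_mul]
      exact one_le_mul_of_one_le_of_one_le (one_le_mul_of_one_le_of_one_le (one_le_jap a)
        (one_le_jap b)) (one_le_jap c)
  have cQ := continuous_cutMul (p := p) (u := fun t => cubicN (u t)) hM h.cont_cubicN
  have dQ := h.decays_cubicN.cutMul hM hp
  have cg := continuous_cutMul (p := p) (u := velo u) hM h.cont_velo
  have dg := h.decays_velo.cutMul hM hp
  have cP : Continuous fun q : ℝ × Rn 3 => (cutLap M p q.2 : ℂ) * u q.1 q.2 :=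
    (continuous_ofReal.comp ((continuous_cutLap hM).comp continuous_snd)).mul h.cont
  have dP := h.decays.mul_left (abs_cutLap_le hM hp)
  set P : ℝ → Rn 3 → ℂ := fun t ξ => (cutLap M p ξ : ℂ) * u t ξ with hP
  set Q : ℝ → Rn 3 → ℂ := fun t => cutMul M p (cubicN (u t)) with hQ
  set N : ℝ → Rn 3 → ℂ := fun t => cubicN (cutMul M p (u t)) with hN
  set v : ℝ → Rn 3 → ℂ := fun t => cutMul M p (u t) with hv
  set g : ℝ → Rn 3 → ℂ := fun t => cutMul M p (velo u t) with hg
  have cR : Continuous fun q : ℝ × Rn 3 => Q q.1 q.2 - N q.1 q.2 := cQ.sub cNv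
  have dR : Decays fun t ξ => Q t ξ - N t ξ := by
    have := dQ.add (dNv.const_mul (-1))
    simpa only [neg_one_mul, ← sub_eq_add_neg] using this
  have kin := h.integral_weight_sub (w := fun ξ => 4 * Real.pi ^ 2 * ‖ξ‖ ^ 2 * cut M p (jap ξ) ^ 2)
    (by have := continuous_cut_jap (e := p) hM; fun_prop) (L := 4 * Real.pi ^ 2) (n := 2)
    (fun ξ => by
      rw [abs_mul, abs_of_nonneg (sq_nonneg (cut M p (jap ξ)))]
      exact (mul_le_of_le_one_right (abs_nonneg _) (pow_le_one₀ (cut_pos hM (jap_pos ξ)).le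
        (cut_le_one hM (jap_pos ξ) hp))).trans (abs_laplace_le ξ)) ha hab hbT
  have pot := integral_quart_sub cv dv cg dg hab fun t ht ξ =>
    (h.deriv t ⟨ha.trans_lt ht.1, ht.2.trans_le hbT⟩ ξ).const_mul (cut M p (jap ξ) : ℂ)
  have cPQ := continuous_integral_conj_mul cP dP cQ dQ
  have cgN := continuous_integral_conj_mul cg dg cNv dNv
  have cPR := continuous_integral_conj_mul cP dP cR dR
  have cQR := continuous_integral_conj_mul cQ dQ cR dR
  have pot' : (∫ z, quart (v b) (v b) (v b) (v b) z).re - (∫ z, quart (v a) (v a) (v a) (v a) z).re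
      = ∫ t in a..b, 4 * (∫ ξ, conj (g t ξ) * N t ξ).re := by
    have i₁ := integrable_quart_mixed cg cv cv cv dg dv dv dv
    have i₂ := integrable_quart_mixed cv cg cv cv dv dg dv dv
    have i₃ := integrable_quart_mixed cv cv cg cv dv dv dg dv
    have i₄ := integrable_quart_mixed cv cv cv cg dv dv dv dg
    have cont : Continuous fun t => ∫ z, (quart (g t) (v t) (v t) (v t) z
      + quart (v t) (g t) (v t) (v t) z
      + quart (v t) (v t) (g t) (v t) z + quart (v t) (v t) (v t) (g t) z) := by
      have e (t : ℝ) : ∫ z, (quart (g t) (v t) (v t) (v t) z + quart (v t) (g t) (v t) (v t) z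
          + quart (v t) (v t) (g t) (v t) z + quart (v t) (v t) (v t) (g t) z)
          = (∫ z, quart (g t) (v t) (v t) (v t) z) + (∫ z, quart (v t) (g t) (v t) (v t) z)
          + (∫ z, quart (v t) (v t) (g t) (v t) z) + ∫ z, quart (v t) (v t) (v t) (g t) z :=
        (integral_add (((i₁ t).add (i₂ t)).add (i₃ t)) (i₄ t)).trans (congrArg (· + _)
          ((integral_add ((i₁ t).add (i₂ t)) (i₃ t)).trans (congrArg (· + _)
            (integral_add (i₁ t) (i₂ t)))))
      simp only [e]
      exact (((continuous_integral_quart cg cv cv cv dg dv dv dv).add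
        (continuous_integral_quart cv cg cv cv dv dg dv dv)).add
        (continuous_integral_quart cv cv cg cv dv dv dg dv)).add
        (continuous_integral_quart cv cv cv cg dv dv dv dg)
    rw [← sub_re, pot, ← reCLM_apply, ← reCLM.intervalIntegral_comp_comm
      (cont.intervalIntegrable a b)]
    refine intervalIntegral.integral_congr fun t _ => ?_
    simp only [reCLM_apply]
    rw [integral_quart_derivative cv dv cg dg]
    have := integral_mul_quart_eq_triSym cv dv cg dg (σ := fun _ _ _ => 1) measurable_const
      (fun _ _ _ => by simp) t
    simp only [ofReal_one, one_mul] at this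
    rw [this]
  rw [cutEnergy, cutEnergy]
  have hsplit : ∀ x y z w : ℝ, 1 / 2 * x + 1 / 4 * y - (1 / 2 * z + 1 / 4 * w)
      = 1 / 2 * (x - z) + 1 / 4 * (y - w) := fun x y z w => by ring
  rw [hsplit, kin]
  change _ + 1 / 4 * ((∫ z, quart (v b) (v b) (v b) (v b) z).re
    - (∫ z, quart (v a) (v a) (v a) (v a) z).re) = _
  have hR : ∀ t ξ, triSym (cutComm M p) (u t) ξ = Q t ξ - N t ξ :=
    fun t ξ => triSym_cutComm hM hp h.cont h.decays t ξ
  simp only [hR]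
  rw [pot', ← intervalIntegral.integral_const_mul, ← intervalIntegral.integral_const_mul]
  have hA : ∀ t, (∫ ξ, ((4 * Real.pi ^ 2 * ‖ξ‖ ^ 2 * cut M p (jap ξ) ^ 2 : ℝ) : ℂ) *
      (conj (u t ξ) * cubicN (u t) ξ)) = ∫ ξ, conj (P t ξ) * Q t ξ := fun t => by
    refine integral_congr_ae (.of_forall fun ξ => ?_)
    simp only [hP, hQ, cutMul, cutLap, map_mul, conj_ofReal]
    push_cast
    ring
  simp only [hA]
  have cim : ∀ {F : ℝ → ℂ}, Continuous F → Continuous fun t => (F t).im :=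
    fun hF => continuous_im.comp hF
  have cre : ∀ {F : ℝ → ℂ}, Continuous F → Continuous fun t => (F t).re :=
    fun hF => continuous_re.comp hF
  have k₁ : Continuous fun t => 1 / 2 * (2 * (∫ ξ, conj (P t ξ) * Q t ξ).im) :=
    continuous_const.mul (continuous_const.mul (cim cPQ))
  have k₂ : Continuous fun t => 1 / 4 * (4 * (∫ ξ, conj (g t ξ) * N t ξ).re) :=
    continuous_const.mul (continuous_const.mul (cre cgN))
  have k₃ : Continuous fun t => (∫ ξ, conj (P t ξ) * (Q t ξ - N t ξ)).im := cim cPR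
  have k₄ : Continuous fun t => (∫ ξ, conj (Q t ξ) * (Q t ξ - N t ξ)).im := cim cQR
  refine (intervalIntegral.integral_add (k₁.intervalIntegrable a b)
    (k₂.intervalIntegrable a b)).symm.trans (Eq.trans ?_ (intervalIntegral.integral_add
    (k₃.intervalIntegrable a b) (k₄.intervalIntegrable a b)))
  refine intervalIntegral.integral_congr fun t _ => ?_
  have iPQ := integrable_conj_mul cP dP cQ dQ t
  have igN := integrable_conj_mul cg dg cNv dNv t
  have iPR := integrable_conj_mul cP dP cR dR t
  have iQR := integrable_conj_mul cQ dQ cR dR t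
  have im_eq : ∀ {F : Rn 3 → ℂ}, Integrable F → (∫ ξ, F ξ).im = ∫ ξ, RCLike.im (F ξ) :=
    fun hF => (integral_im hF).symm
  have re_eq : ∀ {F : Rn 3 → ℂ}, Integrable F → (∫ ξ, F ξ).re = ∫ ξ, RCLike.re (F ξ) :=
    fun hF => (integral_re hF).symm
  rw [im_eq iPQ, re_eq igN, im_eq iPR, im_eq iQR, ← integral_add iPR.im iQR.im]
  have e : ∀ x y : ℝ, 1 / 2 * (2 * x) + 1 / 4 * (4 * y) = x + y := fun x y => by ring
  rw [e, ← integral_add iPQ.im igN.re]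
  refine integral_congr_ae (.of_forall fun ξ => ?_)
  have hgξ : g t ξ = -I * (P t ξ + Q t ξ) := by
    simp only [hg, hP, hQ, cutMul, velo, cutLap]
    push_cast
    ring
  simp only [hgξ, RCLike.im_to_complex, RCLike.re_to_complex]
  simp only [mul_re, mul_im, neg_re, neg_im, I_re, I_im, conj_re, conj_im, add_re, add_im, sub_re,
    sub_im]
  ring

end

lemma lintegral_cubic_sq_le {g κ : Rn 3 → ENNReal} (hg : Measurable g) (hκ : Measurable κ)
    {W : Rn 3 → Rn 3 × Rn 3 → ENNReal} (hW : ∀ ξ, Measurable (W ξ))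
    (hWκ : ∀ ξ w, W ξ w ^ 2 ≤ κ w.1 * κ w.2 + κ w.1 * κ (w.1 + w.2 - ξ) + κ w.2 * κ (w.1 + w.2 - ξ)) :
    ∫⁻ ξ, (∫⁻ w : Rn 3 × Rn 3, g w.1 * g (w.1 + w.2 - ξ) * g w.2 * W ξ w) ^ 2
      ≤ 3 * (∫⁻ x, κ x) ^ 2 * (∫⁻ x, g x ^ 2) ^ 3 := by
  have hs : ∀ a ξ : Rn 3, ∫⁻ c, κ (a + c - ξ) = ∫⁻ x, κ x := fun a ξ => by
    rw [← lintegral_add_left_eq_self κ (a - ξ)]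
    refine lintegral_congr fun c => ?_
    congr 1; abel
  have hWi (ξ : Rn 3) : ∫⁻ w, W ξ w ^ 2 ≤ 3 * (∫⁻ x, κ x) ^ 2 := by
    have e1 : ∫⁻ w : Rn 3 × Rn 3, κ w.1 * κ w.2 = (∫⁻ x, κ x) ^ 2 := by
      rw [Measure.volume_eq_prod, lintegral_prod _ (by fun_prop)]
      simp_rw [lintegral_const_mul _ hκ]
      rw [lintegral_mul_const _ hκ, sq]
    have e2 : ∫⁻ w : Rn 3 × Rn 3, κ w.1 * κ (w.1 + w.2 - ξ) = (∫⁻ x, κ x) ^ 2 := by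
      rw [Measure.volume_eq_prod, lintegral_prod _ (by fun_prop)]
      have (x : Rn 3) : ∫⁻ y, κ x * κ (x + y - ξ) = κ x * ∫⁻ x, κ x := by
        rw [lintegral_const_mul _ (by fun_prop), hs]
      simp_rw [this]
      rw [lintegral_mul_const _ hκ, sq]
    have e3 : ∫⁻ w : Rn 3 × Rn 3, κ w.2 * κ (w.1 + w.2 - ξ) = (∫⁻ x, κ x) ^ 2 := by
      rw [Measure.volume_eq_prod, lintegral_prod_symm' _ (by fun_prop)]
      have (x : Rn 3) : ∫⁻ y, κ x * κ (y + x - ξ) = κ x * ∫⁻ x, κ x := by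
        rw [lintegral_const_mul _ (by fun_prop), ← hs x ξ]
        simp_rw [add_comm]
      simp_rw [this]
      rw [lintegral_mul_const _ hκ, sq]
    refine (lintegral_mono (hWκ ξ)).trans_eq ?_
    rw [lintegral_add_left (by fun_prop), lintegral_add_left (by fun_prop), e1, e2, e3]
    ring
  have hgi : ∫⁻ ξ, ∫⁻ w : Rn 3 × Rn 3, (g w.1 * g (w.1 + w.2 - ξ) * g w.2) ^ 2
      = (∫⁻ x, g x ^ 2) ^ 3 := by
    rw [lintegral_lintegral_swap (Measurable.aemeasurable (by fun_prop))]
    have (w : Rn 3 × Rn 3) : ∫⁻ ξ, (g w.1 * g (w.1 + w.2 - ξ) * g w.2) ^ 2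
        = g w.1 ^ 2 * g w.2 ^ 2 * ∫⁻ x, g x ^ 2 := by
      rw [← lintegral_shift_sq g (w.1 + w.2), ← lintegral_const_mul _ (by fun_prop)]
      exact lintegral_congr fun ξ => by ring
    simp_rw [this]
    rw [lintegral_mul_const _ (by fun_prop), Measure.volume_eq_prod, lintegral_prod _ (by fun_prop)]
    simp_rw [lintegral_const_mul _ (hg.pow_const 2)]
    rw [lintegral_mul_const _ (by fun_prop)]
    ring
  calc _ ≤ ∫⁻ ξ, (∫⁻ w : Rn 3 × Rn 3, (g w.1 * g (w.1 + w.2 - ξ) * g w.2) ^ 2) *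
        (3 * (∫⁻ x, κ x) ^ 2) := by
        refine lintegral_mono fun ξ => (lintegral_mul_sq_le _ (Measurable.aemeasurable (by fun_prop))
          (hW ξ).aemeasurable).trans ?_
        gcongr
        exact hWi ξ
    _ = _ := by
        rw [lintegral_mul_const _ (Measurable.lintegral_prod_right' (f := fun q : Rn 3 × Rn 3 × Rn 3 =>
          (g q.2.1 * g (q.2.1 + q.2.2 - q.1) * g q.2.2) ^ 2) (by fun_prop)), hgi]
        ring

lemma inv_mul_sq_le_of_max {κ : ℝ → ℝ} {x y z : ℝ} (hx : 0 < x) (hy : 0 < y) (hz : 0 < z)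
    (h1 : (x ^ 3)⁻¹ ≤ κ x) (h2 : (y ^ 3)⁻¹ ≤ κ y) (h3 : (z ^ 3)⁻¹ ≤ κ z) :
    ((x * y * z)⁻¹) ^ 2 ≤ κ x * κ z + κ x * κ y + κ z * κ y := by
  have key : ∀ {p q r : ℝ}, 0 < p → 0 < q → 0 < r → p ≤ r → q ≤ r →
      ((p * q * r)⁻¹) ^ 2 ≤ (p ^ 3)⁻¹ * (q ^ 3)⁻¹ := fun {p q r} hp hq hr h h' => by
    rw [inv_pow, ← mul_inv]
    refine inv_anti₀ (by positivity) ?_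
    have : p * q ≤ r ^ 2 := by nlinarith
    calc p ^ 3 * q ^ 3 = (p * q) ^ 2 * (p * q) := by ring
      _ ≤ (p * q) ^ 2 * r ^ 2 := by gcongr
      _ = _ := by ring
  have i1 : 0 < (x ^ 3)⁻¹ := by positivity
  have i2 : 0 < (y ^ 3)⁻¹ := by positivity
  have i3 : 0 < (z ^ 3)⁻¹ := by positivity
  have m1 := mul_le_mul h1 h2 i2.le (i1.le.trans h1)
  have m2 := mul_le_mul h1 h3 i3.le (i1.le.trans h1)
  have m3 := mul_le_mul h3 h2 i2.le (i3.le.trans h3)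
  have n1 := mul_pos i1 i2
  have n2 := mul_pos i1 i3
  have n3 := mul_pos i3 i2
  rcases le_total x y with hxy | hxy
  · rcases le_total y z with hyz | hyz
    · linarith [key hx hy hz (hxy.trans hyz) hyz]
    · have := key hx hz hy hxy hyz
      rw [mul_right_comm] at this
      linarith
  · rcases le_total x z with hxz | hxz
    · linarith [key hx hy hz hxz (hxy.trans hxz)]
    · have := key hz hy hx hxz hxy
      rw [show z * y * x = x * y * z by ring] at this
      linarith

lemma exists_lintegral_triSym_low_le {d : ℝ} (hd : 0 < d) :
    ∃ C < (⊤ : ENNReal), ∀ (M p : ℝ) (f : Rn 3 → ℂ) (σ : Rn 3 → Rn 3 → Rn 3 → ℝ), 0 < M →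
    Continuous f → (∀ x y z, |σ x y z| ≤ 1) → (∀ x y z, M < max3 x y z → σ x y z = 0) →
    ∫⁻ ξ, ‖triSym σ f ξ‖ₑ ^ 2
      ≤ C * ENNReal.ofReal (M ^ (2 * d)) * wnormSq (cutW M p) (absE f) ^ 3 := by
  refine ⟨3 * (∫⁻ ξ : Rn 3, ENNReal.ofReal (jap ξ ^ (-(3 + d)))) ^ 2, ?_, ?_⟩
  · have := lintegral_jap_rpow_lt_top (r := 3 + d) (by linarith)
    finiteness
  intro M p f σ hM hf hσ hσ0
  set κ : Rn 3 → ENNReal := fun x => ENNReal.ofReal (M ^ d * jap x ^ (-(3 + d))) with hκ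
  set g : Rn 3 → ENNReal := fun x => ENNReal.ofReal (cutW M p x) * absE f x with hg
  set S : Rn 3 → Set (Rn 3 × Rn 3) := fun ξ => {w | max3 w.1 (w.1 + w.2 - ξ) w.2 ≤ M} with hS
  have hSm (ξ : Rn 3) : MeasurableSet (S ξ) :=
    measurableSet_le (measurable_max3.comp (f := fun w : Rn 3 × Rn 3 =>
      (w.1, w.1 + w.2 - ξ, w.2)) (by fun_prop)) measurable_const
  set W : Rn 3 → Rn 3 × Rn 3 → ENNReal := fun ξ => (S ξ).indicator fun w =>
    ENNReal.ofReal ((jap w.1 * jap (w.1 + w.2 - ξ) * jap w.2)⁻¹) with hW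
  have mj : Measurable (jap : Rn 3 → ℝ) := measurable_jap
  have mκ : Measurable κ := by fun_prop
  have mg : Measurable g := by
    have : Measurable (absE f) := hf.measurable.enorm
    fun_prop
  have mW (ξ : Rn 3) : Measurable (W ξ) := Measurable.indicator (by fun_prop) (hSm ξ)
  have hcube {x : Rn 3} (h : jap x ≤ M) : (jap x ^ 3)⁻¹ ≤ M ^ d * jap x ^ (-(3 + d)) := by
    have h0 := jap_pos x
    have : (1 : ℝ) ≤ (M / jap x) ^ d := Real.one_le_rpow ((one_le_div h0).2 h) hd.le
    rw [Real.rpow_neg h0.le, Real.rpow_add h0, mul_inv, mul_left_comm, ← div_eq_mul_inv (M ^ d),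
      ← Real.div_rpow hM.le h0.le, show (3 : ℝ) = (3 : ℕ) by norm_num, Real.rpow_natCast]
    exact le_mul_of_one_le_right (by positivity) this
  have hWκ (ξ : Rn 3) (w : Rn 3 × Rn 3) : W ξ w ^ 2
      ≤ κ w.1 * κ w.2 + κ w.1 * κ (w.1 + w.2 - ξ) + κ w.2 * κ (w.1 + w.2 - ξ) := by
    by_cases hw : w ∈ S ξ
    · have h1 : jap w.1 ≤ M := ((le_max_left _ _).trans (le_max_left _ _)).trans hw
      have h2 : jap (w.1 + w.2 - ξ) ≤ M := ((le_max_right _ _).trans (le_max_left _ _)).trans hw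
      have h3 : jap w.2 ≤ M := (le_max_right _ _).trans hw
      have j1 := jap_pos w.1
      have j2 := jap_pos (w.1 + w.2 - ξ)
      have j3 := jap_pos w.2
      simp only [hW, hκ, indicator_of_mem hw]
      rw [← ENNReal.ofReal_pow (by positivity), ← ENNReal.ofReal_mul (by positivity),
        ← ENNReal.ofReal_mul (by positivity), ← ENNReal.ofReal_mul (by positivity),
        ← ENNReal.ofReal_add (by positivity) (by positivity),
        ← ENNReal.ofReal_add (by positivity) (by positivity)]
      exact ENNReal.ofReal_le_ofReal (inv_mul_sq_le_of_max (κ := fun x => M ^ d * x ^ (-(3 + d)))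
        j1 j2 j3 (hcube h1) (hcube h2) (hcube h3))
    · simp [hW, indicator_of_notMem hw]
  have hpt (ξ : Rn 3) : ‖triSym σ f ξ‖ₑ
      ≤ ∫⁻ w : Rn 3 × Rn 3, g w.1 * g (w.1 + w.2 - ξ) * g w.2 * W ξ w := by
    refine (enorm_integral_le_lintegral_enorm _).trans (lintegral_mono fun w => ?_)
    by_cases hw : w ∈ S ξ
    · have h1 : jap w.1 ≤ M := ((le_max_left _ _).trans (le_max_left _ _)).trans hw
      have h2 : jap (w.1 + w.2 - ξ) ≤ M := ((le_max_right _ _).trans (le_max_left _ _)).trans hw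
      have h3 : jap w.2 ≤ M := (le_max_right _ _).trans hw
      have j1 := jap_pos w.1
      have j2 := jap_pos (w.1 + w.2 - ξ)
      have j3 := jap_pos w.2
      have e : g w.1 * g (w.1 + w.2 - ξ) * g w.2 * W ξ w
          = ‖f w.1‖ₑ * ‖f (w.1 + w.2 - ξ)‖ₑ * ‖f w.2‖ₑ := by
        simp only [hg, hW, indicator_of_mem hw, cutW, cut_eq_one j1 h1, cut_eq_one j2 h2,
          cut_eq_one j3 h3, mul_one, absE]
        have : ENNReal.ofReal (jap w.1) * ENNReal.ofReal (jap (w.1 + w.2 - ξ)) *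
            ENNReal.ofReal (jap w.2) *
            ENNReal.ofReal ((jap w.1 * jap (w.1 + w.2 - ξ) * jap w.2)⁻¹) = 1 := by
          rw [← ENNReal.ofReal_mul (by positivity), ← ENNReal.ofReal_mul (by positivity),
            ← ENNReal.ofReal_mul (by positivity), mul_inv_cancel₀ (by positivity),
            ENNReal.ofReal_one]
        rw [← mul_one (‖f w.1‖ₑ * ‖f (w.1 + w.2 - ξ)‖ₑ * ‖f w.2‖ₑ), ← this]
        ring
      rw [e, enorm_mul, enorm_mul, enorm_mul, RCLike.enorm_conj]
      refine mul_le_of_le_one_left' ?_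
      rw [← ofReal_norm, norm_real, Real.norm_eq_abs]
      exact ENNReal.ofReal_le_one.2 (hσ _ _ _)
    · rw [hσ0 _ _ _ (not_le.1 hw)]
      simp
  refine (lintegral_mono fun ξ => pow_le_pow_left' (hpt ξ) 2).trans
    ((lintegral_cubic_sq_le mg mκ mW hWκ).trans_eq ?_)
  have e : ∫⁻ x, κ x = ENNReal.ofReal (M ^ d) * ∫⁻ x : Rn 3, ENNReal.ofReal (jap x ^ (-(3 + d))) := by
    rw [← lintegral_const_mul _ (by fun_prop)]
    exact lintegral_congr fun x => ENNReal.ofReal_mul (by positivity)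
  rw [e, wnormSq, show 2 * d = d * 2 by ring, Real.rpow_mul hM.le, Real.rpow_two,
    ENNReal.ofReal_pow (by positivity)]
  ring

lemma lintegral_lintegral_mul_sq_le {μ : Measure ℝ} [SFinite μ] {f g : ℝ × Rn 3 → ENNReal}
    (hf : Measurable f) (hg : Measurable g) :
    (∫⁻ t, ∫⁻ ξ, f (t, ξ) * g (t, ξ) ∂volume ∂μ) ^ 2
      ≤ (∫⁻ t, ∫⁻ ξ, f (t, ξ) ^ 2 ∂volume ∂μ) * ∫⁻ t, ∫⁻ ξ, g (t, ξ) ^ 2 ∂volume ∂μ := by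
  rw [← lintegral_prod (fun q : ℝ × Rn 3 => f q * g q) (by fun_prop),
    ← lintegral_prod (fun q : ℝ × Rn 3 => f q ^ 2) (by fun_prop),
    ← lintegral_prod (fun q : ℝ × Rn 3 => g q ^ 2) (by fun_prop)]
  exact lintegral_mul_sq_le _ hf.aemeasurable hg.aemeasurable

section
variable {M p : ℝ}

lemma cutComm_eq_zero {a b c : Rn 3} (h : jap (a - b + c) ≤ M) (ha : jap a ≤ M)
    (hb : jap b ≤ M) (hc : jap c ≤ M) : cutComm M p a b c = 0 := by
  rw [cutComm, cut_eq_one (jap_pos _) h, cut_eq_one (jap_pos _) ha, cut_eq_one (jap_pos _) hb,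
    cut_eq_one (jap_pos _) hc]
  norm_num

lemma sq_mul_cut_sq_le {d X : ℝ} (hM : 0 < M) (h : 6 * p + 3 * d ≤ 1) (hX : M ≤ X) :
    X ^ 2 * cut M p X ^ 2
      ≤ M ^ (-(1 - d)) * (X ^ (3 - d) * (cut M p X ^ 3 * cut M (5 * p + 2 * d) X)) := by
  have hX0 : 0 < X := hM.trans_le hX
  have hm := cut_pos (e := p) hM hX0
  have key : M ^ (1 - d) ≤ X ^ (1 - d) * (cut M p X * cut M (5 * p + 2 * d) X) := by
    rw [← cut_add hM hX0, cut_eq_rpow hX0 hX]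
    have : (M / X) ^ (1 - d) ≤ (M / X) ^ (p + (5 * p + 2 * d)) :=
      Real.rpow_le_rpow_of_exponent_ge (by positivity) ((div_le_one hX0).2 hX) (by linarith)
    calc M ^ (1 - d) = X ^ (1 - d) * (M / X) ^ (1 - d) := by
          rw [← Real.mul_rpow hX0.le (by positivity), mul_div_cancel₀ _ hX0.ne']
      _ ≤ _ := by gcongr
  have hMd : 0 < M ^ (1 - d) := by positivity
  rw [Real.rpow_neg hM.le, ← div_eq_inv_mul, le_div_iff₀ hMd, show 3 - d = 2 + (1 - d) by ring,
    Real.rpow_add hX0, Real.rpow_two]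
  calc X ^ 2 * cut M p X ^ 2 * M ^ (1 - d)
      ≤ X ^ 2 * cut M p X ^ 2 * (X ^ (1 - d) * (cut M p X * cut M (5 * p + 2 * d) X)) := by gcongr
    _ = _ := by ring

lemma abs_cutLap_mul_cutComm_le {δ : ℝ} (hM : 0 < M) (hp : 0 ≤ p) (hp1 : p ≤ 1)
    (h : 6 * p + 3 * (4 * δ) ≤ 1) (z : Rn 3 × Rn 3 × Rn 3) :
    |cutLap M p z.1 * cutComm M p z.2.1 (z.2.1 + z.2.2 - z.1) z.2.2|
      ≤ 16 * Real.pi ^ 2 * M ^ (-(1 - 4 * δ)) * cutKer δ M p (5 * p + 2 * (4 * δ)) z := by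
  obtain ⟨ξ, a, c⟩ := z
  simp only
  set b := a + c - ξ with hb
  have hξ : a - b + c = ξ := by rw [hb]; abel
  set X := maxJap ξ a c with hX
  have x1 : jap ξ ≤ X := (le_max_left _ _).trans (le_max_left _ _)
  have x2 : jap b ≤ X := (le_max_right _ _).trans (le_max_left _ _)
  have x3 : jap a ≤ X := (le_max_left _ _).trans (le_max_right _ _)
  have x4 : jap c ≤ X := (le_max_right _ _).trans (le_max_right _ _)
  rcases le_total X M with hXM | hXM
  · rw [cutComm_eq_zero (by rw [hξ]; linarith) (x3.trans hXM) (x2.trans hXM) (x4.trans hXM),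
      mul_zero, abs_zero]
    have := cutKer_nonneg (δ := δ) (p := p) (r := 5 * p + 2 * (4 * δ)) hM (ξ, a, c)
    positivity
  have hX0 : 0 < X := hM.trans_le hXM
  have m (x : Rn 3) : 0 < cut M p (jap x) := cut_pos hM (jap_pos x)
  have m1 (x : Rn 3) : cut M p (jap x) ≤ 1 := cut_le_one hM (jap_pos x) hp
  have mX : 0 < cut M p X := cut_pos hM hX0
  have ht := jap_add_sub_le a c b
  rw [show a + c - b = ξ by rw [hb]; abel] at ht
  have three : cut M p (jap a) * cut M p (jap b) * cut M p (jap c) ≤ 3 * cut M p X := by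
    have hmax : X ≤ 3 * jap a ∨ X ≤ 3 * jap b ∨ X ≤ 3 * jap c := by
      by_contra! hcon
      obtain ⟨h1, h2, h3⟩ := hcon
      have : X < X := max_lt (max_lt (by linarith) (by linarith)) (max_lt (by linarith) (by linarith))
      exact this.false
    have := m a
    have := m b
    have := m c
    rcases hmax with h1 | h1 | h1 <;>
      have e := cut_le_three_mul hM (jap_pos _) hX0 hp hp1 h1 <;> refine le_trans ?_ e
    · rw [mul_assoc]
      exact mul_le_of_le_one_right (m a).le (mul_le_one₀ (m1 b) (m c).le (m1 c))
    · rw [mul_comm (cut M p (jap a)), mul_assoc]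
      exact mul_le_of_le_one_right (m b).le (mul_le_one₀ (m1 a) (m c).le (m1 c))
    · exact mul_le_of_le_one_left (m c).le (mul_le_one₀ (m1 a) (m b).le (m1 b))
  have mono := mul_cut_mono hM (jap_pos ξ) hp hp1 x1
  have comm : |cutComm M p a b c| ≤ cut M p (jap ξ) + 3 * cut M p X := by
    have := mul_pos (mul_pos (m a) (m b)) (m c)
    have := m ξ
    rw [cutComm, hξ, abs_le]
    constructor <;> linarith
  have lap : |cutLap M p ξ| ≤ 4 * Real.pi ^ 2 * (jap ξ ^ 2 * cut M p (jap ξ)) := by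
    rw [cutLap, abs_mul, abs_of_pos (m ξ), ← mul_assoc]
    have := m ξ
    gcongr
    exact abs_laplace_le ξ
  have jξ := jap_pos ξ
  have mξ := m ξ
  calc |cutLap M p ξ * cutComm M p a b c|
      ≤ 4 * Real.pi ^ 2 * (jap ξ ^ 2 * cut M p (jap ξ)) * (cut M p (jap ξ) + 3 * cut M p X) := by
        rw [abs_mul]
        gcongr
    _ = 4 * Real.pi ^ 2 * ((jap ξ * cut M p (jap ξ)) ^ 2
          + 3 * (jap ξ * cut M p (jap ξ)) * (jap ξ * cut M p X)) := by ring
    _ ≤ 4 * Real.pi ^ 2 * ((X * cut M p X) ^ 2 + 3 * (X * cut M p X) * (X * cut M p X)) := by gcongr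
    _ = 16 * Real.pi ^ 2 * (X ^ 2 * cut M p X ^ 2) := by ring
    _ ≤ 16 * Real.pi ^ 2 * (M ^ (-(1 - 4 * δ)) * (X ^ (3 - 4 * δ) *
          (cut M p X ^ 3 * cut M (5 * p + 2 * (4 * δ)) X))) := by
        exact mul_le_mul_of_nonneg_left (sq_mul_cut_sq_le hM h hXM) (by positivity)
    _ = _ := by simp only [cutKer, hX, mul_assoc]

lemma one_le_dampW_of_lt {r : ℝ} (hM : 0 < M) (hr : 0 ≤ r) (hr1 : r ≤ 1) {x : ℝ} (h : M / 3 ≤ x) :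
    1 ≤ 3 / M * dampW M r x := by
  have hM3 : 0 < M / 3 := by positivity
  have := dampW_mono hM hr hr1 hM3 h
  rw [dampW, cut_eq_one hM3 (by linarith), mul_one] at this
  calc (1 : ℝ) = 3 / M * (M / 3) := by field_simp
    _ ≤ _ := by gcongr

lemma cutMul_cubicN_eq (f : Rn 3 → ℂ) (ξ : Rn 3) :
    cutMul M p (cubicN f) ξ = triSym (fun a b c => cut M p (jap (a - b + c))) f ξ := by
  rw [cutMul, cubicN, triSym, triSym, ← integral_const_mul]
  refine integral_congr_ae (.of_forall fun w => ?_)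
  simp only
  rw [show w.1 - (w.1 + w.2 - ξ) + w.2 = ξ by abel]
  push_cast
  ring

lemma measurable_cutMul_symbol : Measurable fun z : Rn 3 × Rn 3 × Rn 3 =>
    cut M p (jap (z.1 - z.2.1 + z.2.2)) := by
  fun_prop

end

theorem exists_cutEnergy_increment {δ : ℝ} (hδ : 0 < δ) (hδ1 : δ ≤ 1 / 4) :
    ∃ C : ℝ, 1 ≤ C ∧ ∀ (T : ℝ) (u : ℝ → Rn 3 → ℂ), CubicProfile T u →
    ∀ a b τ M p K : ℝ, 0 ≤ a → a ≤ b → b ≤ T → 0 < τ → b - a ≤ τ → τ ≤ 1 → 0 < M → 0 ≤ p →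
    6 * p + 3 * (4 * δ) ≤ 1 → 0 ≤ K → K ≤ M ^ (1 - 4 * δ) →
    C * M ^ (2 * (4 * δ)) * τ * K ^ 2 ≤ 1 / 2 →
    (∀ t ∈ Icc a b, wnormSq (cutW M p) (absE (u t)) ≤ ENNReal.ofReal K) →
    |cutEnergy M p (u b) - cutEnergy M p (u a)| ≤ C * M ^ (-(1 - 4 * δ)) * K ^ 2 := by
  obtain ⟨C, hC1, hC⟩ := exists_slab_estimates hδ hδ1
  obtain ⟨D', hD', hD⟩ := exists_lintegral_triSym_low_le (d := 4 * δ) (by positivity)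
  lift D' to NNReal using hD'.ne with D
  have hC0 : 0 < C := zero_lt_one.trans_le hC1
  have hD0 : (0 : ℝ) ≤ D := D.2
  have hpi : 0 < Real.pi ^ 2 := by positivity
  refine ⟨C * (16 * Real.pi ^ 2) + 36 * (D + 9 * C), by nlinarith, ?_⟩
  intro T u h a b τ M p K ha hab hbT hτ hτ' hτ1 hM hp h6 hK hKM hsm hw
  have hdpos : 0 < 4 * δ := by positivity
  have hp1 : p ≤ 1 := by linarith
  have hr1 : 5 * p + 2 * (4 * δ) ≤ 1 := by linarith
  have hr0 : 0 ≤ 5 * p + 2 * (4 * δ) := by positivity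
  have hM2 : 0 < M ^ (2 * (4 * δ)) := by positivity
  have hx : 0 ≤ M ^ (2 * (4 * δ)) * τ * K ^ 2 := by positivity
  have hsm1 : C * M ^ (2 * (4 * δ)) * τ * K ^ 2 ≤ 1 / 2 := by
    refine le_trans ?_ hsm
    have : C ≤ C * (16 * Real.pi ^ 2) + 36 * (D + 9 * C) := by nlinarith
    calc _ = C * (M ^ (2 * (4 * δ)) * τ * K ^ 2) := by ring
      _ ≤ (C * (16 * Real.pi ^ 2) + 36 * (D + 9 * C)) * (M ^ (2 * (4 * δ)) * τ * K ^ 2) := by gcongr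
      _ = _ := by ring
  have hsm2 : M ^ (2 * (4 * δ)) * τ * K ^ 2 ≤ 1 := by nlinarith
  obtain ⟨hA, hB⟩ := hC T u h a b τ M p K ha hab hbT hτ hτ' hτ1 hM hp hr1 hK hsm1 hw
  set N : ℝ := M ^ (-(1 - 4 * δ)) with hN
  have hN0 : 0 < N := by positivity
  have hN2 : N ^ 2 = M ^ (2 * (4 * δ)) / M ^ 2 := by
    rw [hN, ← Real.rpow_two, ← Real.rpow_mul hM.le, ← Real.rpow_two M, ← Real.rpow_sub hM]
    ring_nf
  have hNK : N * K ≤ 1 := by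
    rw [hN, Real.rpow_neg hM.le, inv_mul_le_iff₀ (by positivity), mul_one]
    exact hKM
  have cP : Continuous fun q : ℝ × Rn 3 => (cutLap M p q.2 : ℂ) * u q.1 q.2 :=
    (continuous_ofReal.comp ((continuous_cutLap hM).comp continuous_snd)).mul h.cont
  have dP := h.decays.mul_left (abs_cutLap_le hM hp)
  have first : |∫ t in a..b, (∫ ξ, conj ((cutLap M p ξ : ℂ) * u t ξ) *
      triSym (cutComm M p) (u t) ξ).im| ≤ C * (16 * Real.pi ^ 2) * N * K ^ 2 := by
    set S : Rn 3 × Rn 3 × Rn 3 → ℝ := fun z =>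
      cutLap M p z.1 * cutComm M p z.2.1 (z.2.1 + z.2.2 - z.1) z.2.2 with hS
    have mS : Measurable S := by
      have m1 := (continuous_cutLap (p := p) hM).measurable
      have m2 := (measurable_cutComm (M := M) (p := p)).comp (f := fun z : Rn 3 × Rn 3 × Rn 3 =>
        (z.2.1, z.2.1 + z.2.2 - z.1, z.2.2)) (by fun_prop)
      exact (m1.comp measurable_fst).mul m2
    have bS := abs_cutLap_mul_cutComm_le (δ := δ) hM hp hp1 h6
    have e (t : ℝ) : ∫ ξ, conj ((cutLap M p ξ : ℂ) * u t ξ) * triSym (cutComm M p) (u t) ξ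
        = ∫ z, (S z : ℂ) * quart (u t) (u t) (u t) (u t) z := by
      rw [← integral_mul_quart_eq_triSym h.cont h.decays cP dP measurable_cutComm
        (abs_cutComm_le hM hp)]
      refine integral_congr_ae (.of_forall fun z => ?_)
      simp only [hS, quart, map_mul, conj_ofReal]
      push_cast
      ring
    have hI := integrable_biSym_form h.cont h.decays mS (L := 16 * Real.pi ^ 2 * N * 27) (n := 3)
      (fun z => (bS z).trans (by
        rw [mul_assoc _ (27 : ℝ)]
        exact mul_le_mul_of_nonneg_left (cutKer_le hδ hM hp hr0 z) (by positivity))) a b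
    simp only [e]
    have e2 : (∫ t in a..b, (∫ z, (S z : ℂ) * quart (u t) (u t) (u t) (u t) z).im)
        = (∫ t in a..b, ∫ z, (S z : ℂ) * quart (u t) (u t) (u t) (u t) z).im :=
      imCLM.intervalIntegral_comp_comm hI
    rw [e2]
    refine (abs_im_le_norm _).trans ((hA (16 * Real.pi ^ 2 * N) S (by positivity) mS bS).trans_eq ?_)
    ring
  have second : |∫ t in a..b, (∫ ξ, conj (cutMul M p (cubicN (u t)) ξ) *
      triSym (cutComm M p) (u t) ξ).im| ≤ 36 * (D + 9 * C) * N * K ^ 2 := by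
    set σ₀ : Rn 3 → Rn 3 → Rn 3 → ℝ := fun x y z => cut M p (jap (x - y + z)) with hσ₀
    set σ₁ : Rn 3 → Rn 3 → Rn 3 → ℝ := fun x y z => if max3 x y z ≤ M / 3 then σ₀ x y z else 0
      with hσ₁
    set σ₂ : Rn 3 → Rn 3 → Rn 3 → ℝ := fun x y z => if max3 x y z ≤ M / 3 then 0 else σ₀ x y z
      with hσ₂
    have b₀ (x y z : Rn 3) : |σ₀ x y z| ≤ 1 := by
      rw [abs_of_pos (cut_pos hM (jap_pos _))]
      exact cut_le_one hM (jap_pos _) hp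
    have b₁ (x y z : Rn 3) : |σ₁ x y z| ≤ 1 := by
      simp only [hσ₁]
      split_ifs
      · exact b₀ x y z
      · simp
    have b₂ (x y z : Rn 3) : |σ₂ x y z| ≤ 1 := by
      simp only [hσ₂]
      split_ifs
      · simp
      · exact b₀ x y z
    have hset : MeasurableSet {z : Rn 3 × Rn 3 × Rn 3 | max3 z.1 z.2.1 z.2.2 ≤ M / 3} :=
      measurableSet_le measurable_max3 measurable_const
    have m₀ : Measurable fun z : Rn 3 × Rn 3 × Rn 3 => σ₀ z.1 z.2.1 z.2.2 := measurable_cutMul_symbol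
    have m₁ : Measurable fun z : Rn 3 × Rn 3 × Rn 3 => σ₁ z.1 z.2.1 z.2.2 :=
      Measurable.ite hset m₀ measurable_const
    have m₂ : Measurable fun z : Rn 3 × Rn 3 × Rn 3 => σ₂ z.1 z.2.1 z.2.2 :=
      Measurable.ite hset measurable_const m₀
    have h1j (x y z : Rn 3) : (1 : ℝ) ≤ 1 * (jap x * jap y * jap z) := by
      rw [one_mul]
      exact one_le_mul_of_one_le_of_one_le (one_le_mul_of_one_le_of_one_le (one_le_jap x)
        (one_le_jap y)) (one_le_jap z)
    have hQ (t : ℝ) (ξ : Rn 3) : cutMul M p (cubicN (u t)) ξ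
        = triSym σ₁ (u t) ξ + triSym σ₂ (u t) ξ := by
      rw [cutMul_cubicN_eq, ← triSym_add h.cont h.decays m₁ m₂
        (fun x y z => (b₁ x y z).trans (h1j x y z)) (fun x y z => (b₂ x y z).trans (h1j x y z))]
      congr 1
      ext x y z
      simp only [hσ₁, hσ₂]
      split_ifs <;> simp [hσ₀]
    have high (σ : Rn 3 → Rn 3 → Rn 3 → ℝ) (hσ : ∀ x y z, |σ x y z| ≤ 1)
        (hσ0 : ∀ x y z, max3 x y z ≤ M / 3 → σ x y z = 0)
        (mσ : Measurable fun z : Rn 3 × Rn 3 × Rn 3 => σ z.1 z.2.1 z.2.2) :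
        ∫⁻ t in Icc a b, ∫⁻ ξ, ‖triSym σ (u t) ξ‖ₑ ^ 2 ≤ ENNReal.ofReal (9 * C * N ^ 2 * K ^ 3) := by
      refine (hB (3 / M) σ (by positivity) mσ fun x y z => ?_).trans_eq ?_
      · by_cases hxyz : max3 x y z ≤ M / 3
        · rw [hσ0 x y z hxyz, abs_zero]
          have := dampW_pos (r := 5 * p + 2 * (4 * δ)) hM (max3_pos x y z)
          positivity
        · exact (hσ x y z).trans (one_le_dampW_of_lt hM hr0 hr1 (not_le.1 hxyz).le)
      · rw [hN2]
        congr 1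
        field_simp
        ring
    have hcomm0 (x y z : Rn 3) (hxyz : max3 x y z ≤ M / 3) : cutComm M p x y z = 0 := by
      have j1 : jap x ≤ M / 3 := ((le_max_left _ _).trans (le_max_left _ _)).trans hxyz
      have j2 : jap y ≤ M / 3 := ((le_max_right _ _).trans (le_max_left _ _)).trans hxyz
      have j3 : jap z ≤ M / 3 := (le_max_right _ _).trans hxyz
      refine cutComm_eq_zero ?_ (by linarith) (by linarith) (by linarith)
      have := jap_add_sub_le x z y
      rw [show x + z - y = x - y + z by abel] at this
      linarith
    have hR := high (cutComm M p) (abs_cutComm_le hM hp) hcomm0 measurable_cutComm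
    have hH := high σ₂ b₂ (fun x y z hxyz => by simp only [hσ₂, if_pos hxyz]) m₂
    have hL : ∫⁻ t in Icc a b, ∫⁻ ξ, ‖triSym σ₁ (u t) ξ‖ₑ ^ 2 ≤ ENNReal.ofReal (D * K) := by
      have : ∀ t ∈ Icc a b, ∫⁻ ξ, ‖triSym σ₁ (u t) ξ‖ₑ ^ 2
          ≤ ENNReal.ofReal (D * M ^ (2 * (4 * δ)) * K ^ 3) := fun t ht => by
        refine (hD M p (u t) σ₁ hM (continuous_slice h.cont t) b₁ fun x y z hxyz => ?_).trans ?_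
        · simp only [hσ₁]
          rw [if_neg (by linarith)]
        · rw [ENNReal.ofReal_mul (by positivity), ENNReal.ofReal_mul (by positivity),
            ENNReal.ofReal_coe_nnreal, ENNReal.ofReal_pow hK]
          gcongr
          exact hw t ht
      refine (setLIntegral_mono measurable_const this).trans ?_
      rw [setLIntegral_const, Real.volume_Icc, ← ENNReal.ofReal_mul (by positivity)]
      refine ENNReal.ofReal_le_ofReal ?_
      calc _ ≤ D * M ^ (2 * (4 * δ)) * K ^ 3 * τ := by gcongr
        _ = D * K * (M ^ (2 * (4 * δ)) * τ * K ^ 2) := by ring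
        _ ≤ D * K := mul_le_of_le_one_right (by positivity) hsm2
    have hQ2 : ∫⁻ t in Icc a b, ∫⁻ ξ, ‖cutMul M p (cubicN (u t)) ξ‖ₑ ^ 2
        ≤ ENNReal.ofReal (4 * ((D + 9 * C) * K)) := by
      have mT (σ : Rn 3 → Rn 3 → Rn 3 → ℝ)
          (mσ : Measurable fun z : Rn 3 × Rn 3 × Rn 3 => σ z.1 z.2.1 z.2.2) :
          Measurable fun q : ℝ × Rn 3 => ‖triSym σ (u q.1) q.2‖ₑ ^ 2 :=
        (measurable_triSym h.cont mσ).enorm.pow_const 2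
      calc ∫⁻ t in Icc a b, ∫⁻ ξ, ‖cutMul M p (cubicN (u t)) ξ‖ₑ ^ 2
          ≤ ∫⁻ t in Icc a b, 4 * ((∫⁻ ξ, ‖triSym σ₁ (u t) ξ‖ₑ ^ 2)
            + ∫⁻ ξ, ‖triSym σ₂ (u t) ξ‖ₑ ^ 2) := by
            refine lintegral_mono fun t => ?_
            have k : Measurable fun ξ : Rn 3 => ‖triSym σ₁ (u t) ξ‖ₑ ^ 2 :=
              (mT σ₁ m₁).comp (f := fun ξ : Rn 3 => (t, ξ)) (by fun_prop)
            rw [← lintegral_add_left k, ← lintegral_const_mul' _ _ (by finiteness)]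
            refine lintegral_mono fun ξ => ?_
            rw [hQ]
            exact (pow_le_pow_left' (enorm_add_le _ _) 2).trans (sq_add_le_of_sq_le le_rfl le_rfl)
        _ = 4 * ((∫⁻ t in Icc a b, ∫⁻ ξ, ‖triSym σ₁ (u t) ξ‖ₑ ^ 2)
            + ∫⁻ t in Icc a b, ∫⁻ ξ, ‖triSym σ₂ (u t) ξ‖ₑ ^ 2) := by
            rw [lintegral_const_mul' _ _ (by finiteness),
              lintegral_add_left (Measurable.lintegral_prod_right' (mT σ₁ m₁))]
        _ ≤ 4 * (ENNReal.ofReal (D * K) + ENNReal.ofReal (9 * C * N ^ 2 * K ^ 3)) := by gcongr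
        _ ≤ _ := by
            rw [← ENNReal.ofReal_add (by positivity) (by positivity), ENNReal.ofReal_mul (p := 4)
              (by norm_num), ENNReal.ofReal_ofNat]
            gcongr
            have : (N * K) ^ 2 ≤ 1 := pow_le_one₀ (by positivity) hNK
            have : 9 * C * K * (N * K) ^ 2 ≤ 9 * C * K := mul_le_of_le_one_right (by positivity) this
            linarith
    have hF : ‖∫ t in a..b, (∫ ξ, conj (cutMul M p (cubicN (u t)) ξ) *
        triSym (cutComm M p) (u t) ξ).im‖ₑ ≤ ∫⁻ t in Icc a b, ∫⁻ ξ,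
          ‖cutMul M p (cubicN (u t)) ξ‖ₑ * ‖triSym (cutComm M p) (u t) ξ‖ₑ := by
      rw [intervalIntegral.integral_of_le hab]
      refine (enorm_integral_le_lintegral_enorm _).trans
        ((lintegral_mono_set Ioc_subset_Icc_self).trans (lintegral_mono fun t => ?_))
      have : ‖(∫ ξ, conj (cutMul M p (cubicN (u t)) ξ) * triSym (cutComm M p) (u t) ξ).im‖ₑ
          ≤ ‖∫ ξ, conj (cutMul M p (cubicN (u t)) ξ) * triSym (cutComm M p) (u t) ξ‖ₑ :=
        enorm_le_iff_norm_le.2 (abs_im_le_norm _)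
      refine this.trans ((enorm_integral_le_lintegral_enorm _).trans_eq (lintegral_congr fun ξ => ?_))
      rw [enorm_mul, RCLike.enorm_conj]
    have cQ := continuous_cutMul (p := p) (u := fun t => cubicN (u t)) hM h.cont_cubicN
    have hCS := lintegral_lintegral_mul_sq_le (μ := volume.restrict (Icc a b))
      (f := fun q => ‖cutMul M p (cubicN (u q.1)) q.2‖ₑ)
      (g := fun q => ‖triSym (cutComm M p) (u q.1) q.2‖ₑ) cQ.measurable.enorm
      (measurable_triSym h.cont measurable_cutComm).enorm
    have hsq := (pow_le_pow_left' hF 2).trans (hCS.trans (mul_le_mul' hQ2 hR))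
    rw [← ENNReal.ofReal_mul (by positivity), ← ofReal_norm,
      ← ENNReal.ofReal_pow (norm_nonneg _), ENNReal.ofReal_le_ofReal_iff (by positivity),
      Real.norm_eq_abs] at hsq
    rw [sq_abs] at hsq
    refine abs_le_of_sq_le_sq (hsq.trans ?_) (by positivity)
    calc 4 * ((D + 9 * C) * K) * (9 * C * N ^ 2 * K ^ 3)
        = 36 * (D + 9 * C) * C * (N ^ 2 * K ^ 4) := by ring
      _ ≤ 36 * (D + 9 * C) * (36 * (D + 9 * C)) * (N ^ 2 * K ^ 4) := by
          gcongr
          linarith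
      _ = _ := by ring
  rw [h.cutEnergy_sub hM hp ha hab hbT]
  refine (abs_add_le _ _).trans ((add_le_add first second).trans_eq ?_)
  ring

lemma Decays.integrable_weight {f : ℝ → Rn 3 → ℂ} (df : Decays f)
    (cf : Continuous fun q : ℝ × Rn 3 => f q.1 q.2) {w : Rn 3 → ℝ} (hw : Continuous w) {L : ℝ} {n : ℕ}
    (hwb : ∀ ξ, |w ξ| ≤ L * jap ξ ^ n) (t : ℝ) : Integrable fun ξ => w ξ * ‖f t ξ‖ ^ 2 := by
  obtain ⟨D, -, hD⟩ := df.mul_bound df n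
  refine (integrable_inv_jap_pow.const_mul (L * D)).mono'
    (hw.mul ((continuous_slice cf t).norm.pow 2)).aestronglyMeasurable (.of_forall fun ξ => ?_)
  have hj := jap_pos ξ
  have hL : 0 ≤ L := nonneg_of_mul_nonneg_left ((abs_nonneg _).trans (hwb ξ)) (by positivity)
  rw [norm_mul, norm_pow, norm_norm, Real.norm_eq_abs]
  calc _ ≤ L * jap ξ ^ n * ‖f t ξ‖ ^ 2 := by gcongr; exact hwb ξ
    _ = L * (jap ξ ^ n * (‖f t ξ‖ * ‖f t ξ‖)) := by ring
    _ ≤ L * (D * (jap ξ ^ 4)⁻¹) := mul_le_mul_of_nonneg_left (hD t ξ) hL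
    _ = _ := by ring

lemma wnormSq_absE {w : Rn 3 → ℝ} (hw : ∀ ξ, 0 ≤ w ξ) {f : Rn 3 → ℂ}
    (hi : Integrable fun ξ => w ξ ^ 2 * ‖f ξ‖ ^ 2) :
    wnormSq w (absE f) = ENNReal.ofReal (∫ ξ, w ξ ^ 2 * ‖f ξ‖ ^ 2) := by
  rw [ofReal_integral_eq_lintegral_ofReal hi (.of_forall fun ξ => by positivity)]
  refine lintegral_congr fun ξ => ?_
  rw [absE, ← ofReal_norm, ← ENNReal.ofReal_mul (hw ξ), ← ENNReal.ofReal_pow (by have := hw ξ; positivity),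
    mul_pow]

/-- Conservation of mass. -/
lemma CubicProfile.mass_eq {T : ℝ} {u : ℝ → Rn 3 → ℂ} (h : CubicProfile T u) {b : ℝ} (hb : 0 ≤ b)
    (hbT : b ≤ T) : ∫ ξ, ‖u b ξ‖ ^ 2 = ∫ ξ, ‖u 0 ξ‖ ^ 2 := by
  have key := h.integral_weight_sub (w := fun _ => 1) continuous_const (L := 1) (n := 0) (by simp)
    le_rfl hb hbT
  have im0 (t : ℝ) : (∫ ξ, ((1 : ℝ) : ℂ) * (conj (u t ξ) * cubicN (u t) ξ)).im = 0 := by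
    obtain ⟨q, -, hq, -⟩ := lintegral_biSym_sq h.cont h.decays (k := fun _ _ => 1) measurable_const
      (fun a b => by
        rw [abs_one]
        exact one_le_mul_of_one_le_of_one_le (one_le_jap a) (one_le_jap b)) t
    have e := integral_mul_quart_eq_triSym h.cont h.decays h.cont h.decays (σ := fun _ _ _ => 1)
      measurable_const (by simp) t
    simp only [mul_one, ofReal_one, one_mul] at hq e ⊢
    rw [← e, hq, ofReal_im]
  simp only [im0, one_mul, mul_zero, intervalIntegral.integral_zero] at key
  linarith

lemma re_integral_quart_nonneg {f : ℝ → Rn 3 → ℂ} (cf : Continuous fun q : ℝ × Rn 3 => f q.1 q.2)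
    (df : Decays f) (t : ℝ) : 0 ≤ (∫ z, quart (f t) (f t) (f t) (f t) z).re := by
  obtain ⟨q, hq0, hq, -⟩ := lintegral_biSym_sq cf df (k := fun _ _ => 1) measurable_const
    (fun a b => by
      rw [abs_one]
      exact one_le_mul_of_one_le_of_one_le (one_le_jap a) (one_le_jap b)) t
  simp only [mul_one, ofReal_one, one_mul] at hq
  rw [hq, ofReal_re]
  exact hq0

section

variable {T M p : ℝ} {u : ℝ → Rn 3 → ℂ}

lemma cutW_nonneg (hM : 0 < M) (ξ : Rn 3) : 0 ≤ cutW M p ξ :=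
  mul_nonneg (jap_pos ξ).le (cut_pos hM (jap_pos ξ)).le

lemma continuous_cutW (hM : 0 < M) : Continuous (cutW M p) := continuous_jap.mul (continuous_cut_jap hM)

lemma abs_cutW_sq_le (hM : 0 < M) (hp : 0 ≤ p) (ξ : Rn 3) : |cutW M p ξ ^ 2| ≤ 1 * jap ξ ^ 2 := by
  rw [abs_pow, one_mul]
  exact pow_le_pow_left₀ (abs_nonneg _) (abs_cutW_le hM hp ξ) 2

/-- The damped `H¹` norm is controlled by the mass and the damped energy. -/
lemma CubicProfile.integral_cutW_le (h : CubicProfile T u) (hM : 0 < M) (hp : 0 ≤ p) (t : ℝ) :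
    ∫ ξ, cutW M p ξ ^ 2 * ‖u t ξ‖ ^ 2 ≤ (∫ ξ, ‖u t ξ‖ ^ 2) + 2 * cutEnergy M p (u t) := by
  have h1 : Integrable fun ξ => ‖u t ξ‖ ^ 2 := by
    simpa using h.decays.integrable_weight h.cont (w := fun _ => 1) continuous_const (L := 1) (n := 0)
      (by simp) t
  have h2 : Integrable fun ξ => 4 * Real.pi ^ 2 * ‖ξ‖ ^ 2 * cut M p (jap ξ) ^ 2 * ‖u t ξ‖ ^ 2 := by
    refine h.decays.integrable_weight h.cont (w := fun ξ => 4 * Real.pi ^ 2 * ‖ξ‖ ^ 2 *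
      cut M p (jap ξ) ^ 2) ?_ (L := 4 * Real.pi ^ 2) (n := 2) (fun ξ => ?_) t
    · have := continuous_cut_jap (e := p) hM
      fun_prop
    · have hc := cut_pos (e := p) hM (jap_pos ξ)
      rw [abs_of_nonneg (by positivity)]
      calc _ ≤ 4 * Real.pi ^ 2 * ‖ξ‖ ^ 2 * 1 := by
            gcongr
            exact pow_le_one₀ hc.le (cut_le_one hM (jap_pos ξ) hp)
        _ ≤ 4 * Real.pi ^ 2 * jap ξ ^ 2 * 1 := by gcongr; exact norm_le_jap ξ
        _ = _ := mul_one _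
  have hq := re_integral_quart_nonneg (continuous_cutMul (p := p) hM h.cont) (h.decays.cutMul hM hp) t
  calc _ ≤ ∫ ξ, (‖u t ξ‖ ^ 2 + 4 * Real.pi ^ 2 * ‖ξ‖ ^ 2 * cut M p (jap ξ) ^ 2 * ‖u t ξ‖ ^ 2) := by
        refine integral_mono (h.decays.integrable_weight h.cont ((continuous_cutW hM).pow 2)
          (abs_cutW_sq_le hM hp) t) (h1.add h2) fun ξ => ?_
        have hc := cut_pos (e := p) hM (jap_pos ξ)
        have hc1 : cut M p (jap ξ) ^ 2 ≤ 1 := pow_le_one₀ hc.le (cut_le_one hM (jap_pos ξ) hp)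
        have hpi : 1 ≤ 4 * Real.pi ^ 2 := by nlinarith [Real.pi_gt_three]
        have e : cutW M p ξ ^ 2 ≤ 1 + 4 * Real.pi ^ 2 * ‖ξ‖ ^ 2 * cut M p (jap ξ) ^ 2 := by
          rw [cutW, mul_pow, jap_sq, add_mul, one_mul]
          refine add_le_add hc1 ?_
          rw [mul_assoc (4 * Real.pi ^ 2)]
          exact le_mul_of_one_le_left (by positivity) hpi
        calc _ ≤ (1 + 4 * Real.pi ^ 2 * ‖ξ‖ ^ 2 * cut M p (jap ξ) ^ 2) * ‖u t ξ‖ ^ 2 := by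
              gcongr
          _ = _ := by ring
    _ = (∫ ξ, ‖u t ξ‖ ^ 2) +
        ∫ ξ, 4 * Real.pi ^ 2 * ‖ξ‖ ^ 2 * cut M p (jap ξ) ^ 2 * ‖u t ξ‖ ^ 2 := integral_add h1 h2
    _ ≤ _ := by
        rw [cutEnergy]
        linarith

lemma CubicProfile.continuous_integral_cutW (h : CubicProfile T u) (hM : 0 < M) (hp : 0 ≤ p) :
    Continuous fun t => ∫ ξ, cutW M p ξ ^ 2 * ‖u t ξ‖ ^ 2 := by
  have c : Continuous fun q : ℝ × Rn 3 => ((cutW M p q.2 : ℝ) : ℂ) * u q.1 q.2 :=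
    (continuous_ofReal.comp ((continuous_cutW hM).comp continuous_snd)).mul h.cont
  have d : Decays fun t ξ => ((cutW M p ξ : ℝ) : ℂ) * u t ξ :=
    h.decays.mul_left (L := 1) (n := 1) (fun ξ => by simpa using abs_cutW_le hM hp ξ)
  have k := continuous_re.comp (continuous_integral_conj_mul c d c d)
  refine k.congr fun t => ?_
  have e (ξ : Rn 3) : conj (((cutW M p ξ : ℝ) : ℂ) * u t ξ) * (((cutW M p ξ : ℝ) : ℂ) * u t ξ)
      = ((cutW M p ξ ^ 2 * ‖u t ξ‖ ^ 2 : ℝ) : ℂ) := by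
    rw [conj_mul', norm_mul, norm_real, Real.norm_eq_abs, abs_of_nonneg (cutW_nonneg hM ξ)]
    push_cast
    ring
  simp only [Function.comp_apply, e]
  exact (congrArg re (integral_ofReal (𝕜 := ℂ))).trans (ofReal_re _)

end

/-- The Sobolev bound for the quartic form, on the Fourier side. -/
lemma exists_norm_integral_quart_le {s : ℝ} (hs : 3 / 4 < s) : ∃ C : ℝ, 0 ≤ C ∧
    ∀ f : Rn 3 → ℂ, Measurable f → ∀ R : ℝ, 0 ≤ R →
      wnormSq (fun ξ => jap ξ ^ s) (absE f) ≤ ENNReal.ofReal R →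
      ‖∫ z, quart f f f f z‖ ≤ C * R ^ 2 := by
  set w : Rn 3 → ENNReal := fun ξ => ENNReal.ofReal (jap ξ ^ (-(2 * s))) with hwdef
  have mw : Measurable w := (measurable_jap.pow_const _).ennreal_ofReal
  have hW : ∫⁻ ξ, w ξ ^ 2 < ⊤ := by
    refine lt_of_le_of_lt (lintegral_mono fun ξ => ?_) (lintegral_jap_rpow_lt_top (r := 4 * s) (by linarith))
    rw [hwdef, ← ENNReal.ofReal_pow (Real.rpow_nonneg (jap_pos ξ).le _), ← Real.rpow_natCast,
      ← Real.rpow_mul (jap_pos ξ).le]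
    apply le_of_eq
    congr 2
    push_cast
    ring
  lift ∫⁻ ξ, w ξ ^ 2 to NNReal using hW.ne with W hWe
  refine ⟨2 * √2 * W, by positivity, fun f hf R hR hfR => ?_⟩
  set a : Rn 3 → ENNReal := fun ξ => ENNReal.ofReal (jap ξ ^ s) * absE f ξ with ha
  have mf : Measurable (absE f) := hf.enorm
  have ma : Measurable a := (measurable_jap.pow_const _).ennreal_ofReal.mul mf
  have hfa (ξ : Rn 3) : absE f ξ = ENNReal.ofReal (jap ξ ^ (-s)) * a ξ := by
    rw [ha]
    dsimp only
    rw [← mul_assoc, ← ENNReal.ofReal_mul (Real.rpow_nonneg (jap_pos ξ).le _),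
      ← Real.rpow_add (jap_pos ξ), neg_add_cancel, Real.rpow_zero, ENNReal.ofReal_one, one_mul]
  have hpt (ξ x c : Rn 3) : absE f ξ * absE f x * absE f (x + c - ξ) * absE f c
      ≤ a ξ * a x * a (x + c - ξ) * a c * (w x * w c)
        + a ξ * a x * a (x + c - ξ) * a c * (w ξ * w (x + c - ξ)) := by
    rw [← mul_add, hfa ξ, hfa x, hfa (x + c - ξ), hfa c]
    have e (y : Rn 3) : jap y ^ (-(2 * s)) = (jap y ^ (-s)) ^ 2 := by
      rw [← Real.rpow_natCast, ← Real.rpow_mul (jap_pos y).le]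
      congr 1
      push_cast
      ring
    have p0 (y : Rn 3) : 0 ≤ jap y ^ (-s) := Real.rpow_nonneg (jap_pos y).le _
    have key : ENNReal.ofReal (jap ξ ^ (-s)) * ENNReal.ofReal (jap x ^ (-s)) *
        ENNReal.ofReal (jap (x + c - ξ) ^ (-s)) * ENNReal.ofReal (jap c ^ (-s))
        ≤ w x * w c + w ξ * w (x + c - ξ) := by
      have q1 := p0 ξ
      have q2 := p0 x
      have q3 := p0 (x + c - ξ)
      have q4 := p0 c
      simp only [hwdef, e]
      rw [← ENNReal.ofReal_mul q1, ← ENNReal.ofReal_mul (by positivity),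
        ← ENNReal.ofReal_mul (by positivity), ← ENNReal.ofReal_mul (by positivity),
        ← ENNReal.ofReal_mul (by positivity), ← ENNReal.ofReal_add (by positivity) (by positivity)]
      refine ENNReal.ofReal_le_ofReal ?_
      nlinarith [sq_nonneg (jap ξ ^ (-s) * jap (x + c - ξ) ^ (-s) - jap x ^ (-s) * jap c ^ (-s)),
        mul_nonneg (mul_nonneg q1 q3) (mul_nonneg q2 q4)]
    calc _ = a ξ * a x * a (x + c - ξ) * a c * (ENNReal.ofReal (jap ξ ^ (-s)) *
          ENNReal.ofReal (jap x ^ (-s)) * ENNReal.ofReal (jap (x + c - ξ) ^ (-s)) *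
          ENNReal.ofReal (jap c ^ (-s))) := by ring
      _ ≤ _ := mul_le_mul_right key _
  have mL : Measurable fun z : Rn 3 × Rn 3 × Rn 3 => a z.1 * a z.2.1 * a (z.2.1 + z.2.2 - z.1) *
      a z.2.2 * (w z.2.1 * w z.2.2) := by fun_prop
  have mR : Measurable fun z : Rn 3 × Rn 3 × Rn 3 => a z.1 * a z.2.1 * a (z.2.1 + z.2.2 - z.1) *
      a z.2.2 * (w z.1 * w (z.2.1 + z.2.2 - z.1)) := by fun_prop
  have hA : ∫⁻ x, a x ^ 2 ≤ ENNReal.ofReal R := hfR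
  have hB : (W : ENNReal) ^ 2 * ((∫⁻ x, a x ^ 2) * (∫⁻ x, a x ^ 2) * (∫⁻ x, a x ^ 2)
      * (∫⁻ x, a x ^ 2)) ≤ ENNReal.ofReal (W ^ 2 * (R * R * R * R)) := by
    rw [ENNReal.ofReal_mul (by positivity), ENNReal.ofReal_mul (by positivity),
      ENNReal.ofReal_mul (by positivity), ENNReal.ofReal_mul hR, ENNReal.ofReal_pow (by positivity),
      ENNReal.ofReal_coe_nnreal]
    gcongr
  have h1 := (lintegral_triple_nonres_left_le ma ma ma ma mw).trans_eq (by rw [← hWe]) |>.trans hB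
  have h2 := (lintegral_triple_nonres_right_le ma ma ma ma mw).trans_eq (by rw [← hWe]) |>.trans hB
  have hI : ‖∫ z, quart f f f f z‖ₑ
      ≤ (∫⁻ ξ, ∫⁻ x, ∫⁻ c, a ξ * a x * a (x + c - ξ) * a c * (w x * w c))
        + ∫⁻ ξ, ∫⁻ x, ∫⁻ c, a ξ * a x * a (x + c - ξ) * a c * (w ξ * w (x + c - ξ)) := by
    rw [← lintegral_triple mL, ← lintegral_triple mR, ← lintegral_add_left mL]
    refine (enorm_integral_le_lintegral_enorm _).trans (lintegral_mono fun z => ?_)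
    rw [enorm_quart]
    exact hpt z.1 z.2.1 z.2.2
  have h3 := (pow_le_pow_left' hI 2).trans (sq_add_le_of_sq_le h1 h2)
  rw [← ENNReal.ofReal_add (by positivity) (by positivity), show (4 : ENNReal) = ENNReal.ofReal 4 by simp,
    ← ENNReal.ofReal_mul (by norm_num), ← ofReal_norm, ← ENNReal.ofReal_pow (norm_nonneg _),
    ENNReal.ofReal_le_ofReal_iff (by positivity)] at h3
  refine (sq_le_sq₀ (norm_nonneg _) (by positivity)).1 (h3.trans_eq ?_)
  have : √2 ^ 2 = (2 : ℝ) := Real.sq_sqrt (by norm_num)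
  linear_combination (-4 * W ^ 2 * R ^ 4) * this

lemma cutW_sq_eq {M s : ℝ} (ξ : Rn 3) : cutW M (1 - s) ξ ^ 2
    = (jap ξ ^ (1 - s) * cut M (1 - s) (jap ξ)) ^ 2 * jap ξ ^ (2 * s) := by
  have hj := jap_pos ξ
  have e1 : jap ξ ^ 2 = (jap ξ ^ (1 - s)) ^ 2 * jap ξ ^ (2 * s) := by
    rw [← Real.rpow_natCast, ← Real.rpow_natCast, ← Real.rpow_mul hj.le, ← Real.rpow_add hj]
    congr 1
    push_cast
    ring
  rw [cutW, mul_pow, e1, mul_pow]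
  ring

lemma rpow_two_mul_eq {x : ℝ} (hx : 0 ≤ x) (r : ℝ) : x ^ (2 * r) = (x ^ r) ^ 2 := by
  rw [← Real.rpow_natCast, ← Real.rpow_mul hx]
  congr 1
  push_cast
  ring

lemma cutW_sq_le {M s : ℝ} (hM : 0 < M) (hs1 : s ≤ 1) (ξ : Rn 3) :
    cutW M (1 - s) ξ ^ 2 ≤ M ^ (2 * (1 - s)) * jap ξ ^ (2 * s) := by
  have hj := jap_pos ξ
  have h := rpow_mul_cut_le hM hj (e := 1 - s) (by linarith)
  have hc := cut_pos (e := 1 - s) hM hj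
  rw [cutW_sq_eq, rpow_two_mul_eq hM.le]
  gcongr

lemma rpow_le_cutW_sq {M s : ℝ} (hM : 1 ≤ M) (hs1 : s ≤ 1) (ξ : Rn 3) :
    jap ξ ^ (2 * s) ≤ cutW M (1 - s) ξ ^ 2 := by
  have hj := jap_pos ξ
  have hM0 : 0 < M := by linarith
  have h : 1 ≤ jap ξ ^ (1 - s) * cut M (1 - s) (jap ξ) := by
    rw [cut, ← Real.mul_rpow hj.le (cut_base_pos hM0 hj).le]
    refine Real.one_le_rpow ?_ (by linarith)
    rw [mul_min_of_nonneg _ _ hj.le, mul_one, mul_div_cancel₀ _ hj.ne']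
    exact le_min (one_le_jap ξ) hM
  rw [cutW_sq_eq]
  exact le_mul_of_one_le_left (by positivity) (one_le_pow₀ h)

lemma Decays.integrable_rpow {u : ℝ → Rn 3 → ℂ} (hd : Decays u)
    (hc : Continuous fun q : ℝ × Rn 3 => u q.1 q.2) {s : ℝ} (hs1 : s ≤ 1) (t : ℝ) :
    Integrable fun ξ => jap ξ ^ (2 * s) * ‖u t ξ‖ ^ 2 := by
  refine hd.integrable_weight hc (continuous_jap.rpow_const fun ξ => .inl (jap_pos ξ).ne')
    (L := 1) (n := 2) (fun ξ => ?_) t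
  rw [abs_of_nonneg (Real.rpow_nonneg (jap_pos ξ).le _), one_mul, ← Real.rpow_natCast]
  exact Real.rpow_le_rpow_of_exponent_le (one_le_jap ξ) (by push_cast; linarith)

lemma integral_kinetic_le {s : ℝ} (hs1 : s ≤ 1) {u : ℝ → Rn 3 → ℂ}
    (hc : Continuous fun q : ℝ × Rn 3 => u q.1 q.2) (hd : Decays u) {M R t : ℝ} (hM : 0 < M)
    (hu : ∫ ξ, jap ξ ^ (2 * s) * ‖u t ξ‖ ^ 2 ≤ R) :
    ∫ ξ, 4 * Real.pi ^ 2 * ‖ξ‖ ^ 2 * cut M (1 - s) (jap ξ) ^ 2 * ‖u t ξ‖ ^ 2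
      ≤ 4 * Real.pi ^ 2 * (M ^ (2 * (1 - s)) * R) := by
  calc _ ≤ ∫ ξ, 4 * Real.pi ^ 2 * M ^ (2 * (1 - s)) * (jap ξ ^ (2 * s) * ‖u t ξ‖ ^ 2) := by
        refine integral_mono_of_nonneg (.of_forall fun ξ => by positivity)
          ((hd.integrable_rpow hc hs1 t).const_mul _) (.of_forall fun ξ => ?_)
        have hn : ‖ξ‖ ^ 2 * cut M (1 - s) (jap ξ) ^ 2 ≤ M ^ (2 * (1 - s)) * jap ξ ^ (2 * s) := by
          refine le_trans ?_ (cutW_sq_le hM hs1 ξ)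
          rw [cutW, mul_pow]
          gcongr
          exact norm_le_jap ξ
        calc _ = 4 * Real.pi ^ 2 * (‖ξ‖ ^ 2 * cut M (1 - s) (jap ξ) ^ 2) * ‖u t ξ‖ ^ 2 := by ring
          _ ≤ 4 * Real.pi ^ 2 * (M ^ (2 * (1 - s)) * jap ξ ^ (2 * s)) * ‖u t ξ‖ ^ 2 := by gcongr
          _ = _ := by ring
    _ = 4 * Real.pi ^ 2 * M ^ (2 * (1 - s)) * ∫ ξ, jap ξ ^ (2 * s) * ‖u t ξ‖ ^ 2 :=
        integral_const_mul _ _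
    _ ≤ 4 * Real.pi ^ 2 * M ^ (2 * (1 - s)) * R := by gcongr
    _ = _ := by ring

lemma wnormSq_cutMul_le {s : ℝ} (hs1 : s ≤ 1) {u : ℝ → Rn 3 → ℂ}
    (hc : Continuous fun q : ℝ × Rn 3 => u q.1 q.2) (hd : Decays u) {M R t : ℝ} (hM : 0 < M)
    (hu : ∫ ξ, jap ξ ^ (2 * s) * ‖u t ξ‖ ^ 2 ≤ R) :
    wnormSq (fun ξ => jap ξ ^ s) (absE (cutMul M (1 - s) (u t))) ≤ ENNReal.ofReal R := by
  have hjs (ξ : Rn 3) : jap ξ ^ (2 * s) = (jap ξ ^ s) ^ 2 := rpow_two_mul_eq (jap_pos ξ).le s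
  refine le_trans ?_ (ENNReal.ofReal_le_ofReal hu)
  have hi := hd.integrable_rpow hc hs1 t
  simp only [hjs] at hi ⊢
  rw [← wnormSq_absE (fun ξ => Real.rpow_nonneg (jap_pos ξ).le _) hi]
  refine lintegral_mono fun ξ => ?_
  have : absE (cutMul M (1 - s) (u t)) ξ ≤ absE (u t) ξ := by
    refine enorm_le_iff_norm_le.2 ?_
    have hm := cut_pos (e := 1 - s) hM (jap_pos ξ)
    rw [cutMul, norm_mul, norm_real, Real.norm_eq_abs, abs_of_pos hm]
    exact mul_le_of_le_one_left (norm_nonneg _) (cut_le_one hM (jap_pos ξ) (by linarith))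
  gcongr

lemma exists_cutEnergy_le {s : ℝ} (hs : 3 / 4 < s) (hs1 : s ≤ 1) : ∃ C : ℝ, 0 ≤ C ∧
    ∀ u : ℝ → Rn 3 → ℂ, (Continuous fun q : ℝ × Rn 3 => u q.1 q.2) → Decays u →
    ∀ M R t : ℝ, 0 < M → 0 ≤ R → ∫ ξ, jap ξ ^ (2 * s) * ‖u t ξ‖ ^ 2 ≤ R →
      cutEnergy M (1 - s) (u t) ≤ C * (M ^ (2 * (1 - s)) * R + R ^ 2) := by
  obtain ⟨C, hC0, hC⟩ := exists_norm_integral_quart_le hs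
  refine ⟨max (2 * Real.pi ^ 2) C, by positivity, fun u hc hd M R t hM hR hu => ?_⟩
  have hkin := integral_kinetic_le hs1 hc hd hM hu
  have hwn := wnormSq_cutMul_le hs1 hc hd hM hu
  have hm : Measurable (cutMul M (1 - s) (u t)) := (continuous_slice
    (u := fun t => cutMul M (1 - s) (u t)) (continuous_cutMul hM hc) t).measurable
  have hq := hC _ hm R hR hwn
  have hre := (re_le_norm _).trans hq
  calc cutEnergy M (1 - s) (u t)
      ≤ 1 / 2 * (4 * Real.pi ^ 2 * (M ^ (2 * (1 - s)) * R)) + 1 / 4 * (C * R ^ 2) := by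
        rw [cutEnergy]
        gcongr
    _ ≤ 2 * Real.pi ^ 2 * (M ^ (2 * (1 - s)) * R) + C * R ^ 2 := by
        have h3 : 0 ≤ C * R ^ 2 := by positivity
        linarith
    _ ≤ max (2 * Real.pi ^ 2) C * (M ^ (2 * (1 - s)) * R) + max (2 * Real.pi ^ 2) C * R ^ 2 := by
        gcongr
        · exact le_max_left _ _
        · exact le_max_right _ _
    _ = _ := by ring

/-- A continuous function which stays strictly below `K` as long as it has not exceeded `K` never
reaches `K`. -/
lemma lt_of_bootstrap {g : ℝ → ℝ} (hg : Continuous g) {T K : ℝ}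
    (h : ∀ b, 0 ≤ b → b ≤ T → (∀ t ∈ Icc 0 b, g t ≤ K) → g b < K) (h0 : g 0 < K) :
    ∀ t ∈ Icc 0 T, g t < K := by
  by_contra! hcon
  obtain ⟨t, ht, htK⟩ := hcon
  have hS : IsCompact (Icc 0 T ∩ g ⁻¹' Ici K) := isCompact_Icc.inter_right (isClosed_Ici.preimage hg)
  obtain ⟨t₀, ⟨⟨h00, h0T⟩, hK⟩, hmin⟩ := hS.exists_isLeast ⟨t, ht, htK⟩
  obtain ⟨r, ⟨hr0, hr⟩, hrK⟩ := intermediate_value_Icc h00 hg.continuousOn ⟨h0.le, hK⟩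
  have hrt : t₀ ≤ r := hmin ⟨⟨hr0, hr.trans h0T⟩, hrK.ge⟩
  obtain rfl : r = t₀ := le_antisymm hr hrt
  refine (h r h00 h0T fun x hx => ?_).ne hrK
  by_contra! hx'
  have : r ≤ x := hmin ⟨⟨hx.1, hx.2.trans h0T⟩, hx'.le⟩
  obtain rfl : x = r := le_antisymm hx.2 this
  exact hx'.ne' hrK

lemma abs_sub_le_of_slabs {E : ℝ → ℝ} {b₀ τ D : ℝ} (hτ : 0 < τ)
    (h : ∀ a b, 0 ≤ a → a ≤ b → b ≤ b₀ → b - a ≤ τ → |E b - E a| ≤ D) (n : ℕ) :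
    ∀ b, 0 ≤ b → b ≤ b₀ → b ≤ n * τ → |E b - E 0| ≤ n * D := by
  induction n with
  | zero =>
    intro b hb _ hbn
    obtain rfl : b = 0 := le_antisymm (by simpa using hbn) hb
    simp
  | succ n ih =>
    intro b hb hb0 hbn
    push_cast at hbn ⊢
    have hm : 0 ≤ max 0 (b - τ) := le_max_left _ _
    have hmb : max 0 (b - τ) ≤ b := max_le hb (by linarith)
    have h1 := h (max 0 (b - τ)) b hm hmb hb0 (by linarith [le_max_right 0 (b - τ)])
    have h2 := ih (max 0 (b - τ)) hm (hmb.trans hb0) (max_le (by positivity) (by linarith))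
    calc _ ≤ |E b - E (max 0 (b - τ))| + |E (max 0 (b - τ)) - E 0| := abs_sub_le _ _ _
      _ ≤ _ := by linarith

/-- Polynomial growth of the `H^s` norm of a profile, with the exponent given by the parameters of
the energy increment. -/
theorem exists_integral_growth {s δ : ℝ} (hs : 3 / 4 < s) (hs1 : s ≤ 1) (hδ : 0 < δ) (hδ1 : δ ≤ 1 / 4)
    (hθ : 0 < 1 - 6 * (1 - s) - 3 * (4 * δ)) {R : ℝ} (hR : 0 ≤ R) :
    ∃ C : ℝ, 0 ≤ C ∧ ∀ (T : ℝ) (u : ℝ → Rn 3 → ℂ), 1 ≤ T → CubicProfile T u →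
      ∫ ξ, jap ξ ^ (2 * s) * ‖u 0 ξ‖ ^ 2 ≤ R →
      ∫ ξ, jap ξ ^ (2 * s) * ‖u T ξ‖ ^ 2
        ≤ C * T ^ (2 * (1 - s) / (1 - 6 * (1 - s) - 3 * (4 * δ))) := by
  obtain ⟨C, hC1, hC⟩ := exists_cutEnergy_increment hδ hδ1
  obtain ⟨D, hD0, hD⟩ := exists_cutEnergy_le hs hs1
  set p := 1 - s with hp
  set d := 4 * δ with hd
  set θ := 1 - 6 * p - 3 * d with hθd
  have hp0 : 0 ≤ p := by linarith
  have hd0 : 0 < d := by linarith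
  set A : ℝ := D * (R + R ^ 2) + R + 1 with hA
  have hA1 : 1 ≤ A := by rw [hA]; linarith [show 0 ≤ D * (R + R ^ 2) by positivity]
  set L : ℝ := 4 * C ^ 2 * (6 * A) ^ 4 with hL
  have hLA : 6 * A ≤ L := by
    have h1 : (1 : ℝ) ≤ 4 * C ^ 2 := by nlinarith
    have h2 : 6 * A ≤ (6 * A) ^ 4 := le_self_pow₀ (by linarith) (by norm_num)
    calc 6 * A ≤ (6 * A) ^ 4 := h2
      _ ≤ _ := le_mul_of_one_le_left (by positivity) h1
  have hL1 : 1 ≤ L := by linarith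
  refine ⟨6 * A * L ^ (2 * p / θ), by positivity, fun T u hT h hu => ?_⟩
  have hLT : 1 ≤ L * T := one_le_mul_of_one_le_of_one_le hL1 hT
  set M : ℝ := (L * T) ^ (1 / θ) with hM
  have hM1 : 1 ≤ M := Real.one_le_rpow hLT (by positivity)
  have hM0 : 0 < M := by linarith
  have hMθ : M ^ θ = L * T := by
    rw [hM, ← Real.rpow_mul (by positivity), one_div_mul_cancel hθ.ne', Real.rpow_one]
  have hMp1 : 1 ≤ M ^ (2 * p) := Real.one_le_rpow hM1 (by positivity)
  set K : ℝ := 6 * A * M ^ (2 * p) with hK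
  have hK1 : 1 ≤ K := one_le_mul_of_one_le_of_one_le (by linarith) hMp1
  have hMd1 : 1 ≤ M ^ (2 * d) := Real.one_le_rpow hM1 (by positivity)
  have hKM : K ≤ M ^ (1 - d) := by
    calc K ≤ M ^ θ * M ^ (2 * p) := by
          rw [hMθ, hK]
          refine mul_le_mul_of_nonneg_right ?_ (by positivity)
          calc 6 * A ≤ L * 1 := by linarith
            _ ≤ _ := by gcongr
      _ = M ^ (θ + 2 * p) := (Real.rpow_add hM0 _ _).symm
      _ ≤ _ := Real.rpow_le_rpow_of_exponent_le hM1 (by linarith)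
  set Q : ℝ := 2 * C * M ^ (2 * d) * K ^ 2 with hQ
  have hQ1 : 1 ≤ Q := one_le_mul_of_one_le_of_one_le
    (one_le_mul_of_one_le_of_one_le (by linarith) hMd1) (one_le_pow₀ hK1)
  have hQ0 : 0 < Q := by linarith
  have hτ1 : Q⁻¹ ≤ 1 := inv_le_one_of_one_le₀ hQ1
  have hsm : C * M ^ (2 * d) * Q⁻¹ * K ^ 2 ≤ 1 / 2 := by
    have : C * M ^ (2 * d) * Q⁻¹ * K ^ 2 = 1 / 2 * (Q * Q⁻¹) := by
      rw [hQ]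
      ring
    rw [this, mul_inv_cancel₀ hQ0.ne', mul_one]
  have hmass0 : ∫ ξ, ‖u 0 ξ‖ ^ 2 ≤ R := by
    refine (integral_mono_of_nonneg (.of_forall fun ξ => by positivity)
      (h.decays.integrable_rpow h.cont hs1 0) (.of_forall fun ξ => ?_)).trans hu
    exact le_mul_of_one_le_left (by positivity) (Real.one_le_rpow (one_le_jap ξ) (by linarith))
  have hE0 : cutEnergy M p (u 0) ≤ A * M ^ (2 * p) := by
    refine (hD u h.cont h.decays M R 0 hM0 hR hu).trans ?_
    calc D * (M ^ (2 * p) * R + R ^ 2) ≤ D * (M ^ (2 * p) * R + M ^ (2 * p) * R ^ 2) := by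
          gcongr
          exact le_mul_of_one_le_left (by positivity) hMp1
      _ = D * (R + R ^ 2) * M ^ (2 * p) := by ring
      _ ≤ A * M ^ (2 * p) := by
          gcongr
          linarith
  have hAM : A ≤ A * M ^ (2 * p) := le_mul_of_one_le_right (by linarith) hMp1
  have hRA : R ≤ A := by linarith [show 0 ≤ D * (R + R ^ 2) by positivity]
  have hbound (b : ℝ) (hb : 0 ≤ b) (hbT : b ≤ T) (hE : cutEnergy M p (u b) ≤ 2 * (A * M ^ (2 * p))) :
      ∫ ξ, cutW M p ξ ^ 2 * ‖u b ξ‖ ^ 2 < K := by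
    have h1 := h.integral_cutW_le hM0 hp0 b
    rw [h.mass_eq hb hbT] at h1
    have : K = 6 * (A * M ^ (2 * p)) := by rw [hK]; ring
    linarith
  have hincr : (Q * T + 1) * (C * M ^ (-(1 - d)) * K ^ 2) ≤ A * M ^ (2 * p) := by
    have hQT : 1 ≤ Q * T := one_le_mul_of_one_le_of_one_le hQ1 hT
    calc _ ≤ (Q * T + Q * T) * (C * M ^ (-(1 - d)) * K ^ 2) := by gcongr
      _ = L * T * ((M ^ (2 * p)) ^ 4 * M ^ (2 * d) * M ^ (-(1 - d))) := by
          rw [hQ, hK, hL]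
          ring
      _ = M ^ (2 * p) := by
          rw [← hMθ, ← Real.rpow_natCast, ← Real.rpow_mul hM0.le, ← Real.rpow_add hM0,
            ← Real.rpow_add hM0, ← Real.rpow_add hM0]
          congr 1
          push_cast
          rw [hθd]
          ring
      _ ≤ _ := le_mul_of_one_le_left (by positivity) hA1
  have hboot := lt_of_bootstrap (h.continuous_integral_cutW hM0 hp0) (T := T) (K := K)
    (fun b hb hbT hbK => by
      refine hbound b hb hbT ?_
      have hw (t : ℝ) (ht : t ∈ Icc 0 b) : wnormSq (cutW M p) (absE (u t)) ≤ ENNReal.ofReal K := by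
        rw [wnormSq_absE (cutW_nonneg hM0) (h.decays.integrable_weight h.cont
          ((continuous_cutW hM0).pow 2) (abs_cutW_sq_le hM0 hp0) t)]
        exact ENNReal.ofReal_le_ofReal (hbK t ht)
      have hslab := abs_sub_le_of_slabs (E := fun t => cutEnergy M p (u t)) (b₀ := b) (τ := Q⁻¹)
        (D := C * M ^ (-(1 - d)) * K ^ 2) (by positivity) (fun a c ha hac hcb hτ =>
          hC T u h a c Q⁻¹ M p K ha hac (hcb.trans hbT) (by positivity) hτ hτ1 hM0 hp0 (by linarith)
            (by linarith) hKM hsm fun t ht => hw t ⟨ha.trans ht.1, ht.2.trans hcb⟩) ⌈Q * b⌉₊ b hb le_rfl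
        (by
          rw [← div_eq_mul_inv, le_div_iff₀ hQ0, mul_comm]
          exact Nat.le_ceil _)
      have hn : (⌈Q * b⌉₊ : ℝ) ≤ Q * T + 1 := by
        refine (Nat.ceil_lt_add_one (by positivity)).le.trans ?_
        gcongr
      have := (le_abs_self _).trans (hslab.trans ((mul_le_mul_of_nonneg_right hn (by positivity)).trans hincr))
      linarith)
    (hbound 0 le_rfl (by linarith) (by linarith [show 0 ≤ A * M ^ (2 * p) by positivity]))
    T ⟨by linarith, le_rfl⟩
  calc ∫ ξ, jap ξ ^ (2 * s) * ‖u T ξ‖ ^ 2 ≤ ∫ ξ, cutW M p ξ ^ 2 * ‖u T ξ‖ ^ 2 :=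
        integral_mono (h.decays.integrable_rpow h.cont hs1 T) (h.decays.integrable_weight h.cont
          ((continuous_cutW hM0).pow 2) (abs_cutW_sq_le hM0 hp0) T) fun ξ =>
          mul_le_mul_of_nonneg_right (rpow_le_cutW_sq hM1 hs1 ξ) (by positivity)
    _ ≤ K := hboot.le
    _ = 6 * A * L ^ (2 * p / θ) * T ^ (2 * p / θ) := by
        rw [hK, hM, ← Real.rpow_mul (by positivity), Real.mul_rpow (by positivity) (by positivity),
          one_div_mul_eq_div, mul_assoc _ (L ^ _)]

/-- Polynomial growth of the `H^s` norm of a profile. -/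
theorem exists_profile_growth {s ε B : ℝ} (hs : 5 / 6 < s) (hs1 : s < 1) (hε : 0 < ε) (hB : 0 ≤ B) :
    ∃ C : ℝ, 0 < C ∧ ∀ (T : ℝ) (u : ℝ → Rn 3 → ℂ), 1 ≤ T → CubicProfile T u →
      (∫ ξ, jap ξ ^ (2 * s) * ‖u 0 ξ‖ ^ 2) ^ (1 / 2 : ℝ) ≤ B →
      (∫ ξ, jap ξ ^ (2 * s) * ‖u T ξ‖ ^ 2) ^ (1 / 2 : ℝ)
        ≤ C * (1 + T) ^ ((1 - s) / (6 * (s - 5 / 6)) + ε) := by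
  set κ : ℝ := 6 * (s - 5 / 6) with hκ
  have hκ0 : 0 < κ := by linarith
  set m : ℝ := min (κ / 2) (ε * κ ^ 2 / 2) with hm
  have hm0 : 0 < m := by positivity
  have hm1 : m ≤ κ / 2 := min_le_left _ _
  have hm2 : m ≤ ε * κ ^ 2 / 2 := min_le_right _ _
  have hθe : 1 - 6 * (1 - s) - 3 * (4 * (m / 12)) = κ - m := by rw [hκ]; ring
  obtain ⟨C, hC0, hC⟩ := exists_integral_growth (s := s) (δ := m / 12) (by linarith) hs1.le
    (by positivity) (by linarith) (by linarith) (R := B ^ 2) (by positivity)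
  rw [hθe] at hC
  have hexp : (1 - s) / (κ - m) ≤ (1 - s) / κ + ε := by
    rw [div_le_iff₀ (by linarith), add_mul, div_mul_eq_mul_div, ← sub_le_iff_le_add, le_div_iff₀ hκ0]
    have h1 : ε * κ * (κ / 2) ≤ ε * κ * (κ - m) := by gcongr; linarith
    have h2 : (1 - s) * m ≤ 1 * m := by gcongr; linarith
    nlinarith
  refine ⟨C ^ (1 / 2 : ℝ) + 1, by positivity, fun T u hT h hu => ?_⟩
  have hi0 (t : ℝ) : 0 ≤ ∫ ξ, jap ξ ^ (2 * s) * ‖u t ξ‖ ^ 2 :=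
    integral_nonneg fun ξ => mul_nonneg (Real.rpow_nonneg (jap_pos ξ).le _) (by positivity)
  have hu2 : ∫ ξ, jap ξ ^ (2 * s) * ‖u 0 ξ‖ ^ 2 ≤ B ^ 2 := by
    rwa [← Real.sqrt_eq_rpow, Real.sqrt_le_left hB] at hu
  calc (∫ ξ, jap ξ ^ (2 * s) * ‖u T ξ‖ ^ 2) ^ (1 / 2 : ℝ)
      ≤ (C * T ^ (2 * (1 - s) / (κ - m))) ^ (1 / 2 : ℝ) :=
        Real.rpow_le_rpow (hi0 T) (hC T u hT h hu2) (by norm_num)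
    _ = C ^ (1 / 2 : ℝ) * T ^ ((1 - s) / (κ - m)) := by
        rw [Real.mul_rpow hC0 (by positivity), ← Real.rpow_mul (by linarith)]
        congr 2
        ring
    _ ≤ (C ^ (1 / 2 : ℝ) + 1) * (1 + T) ^ ((1 - s) / κ + ε) := by
        gcongr ?_ * ?_
        · linarith
        · calc T ^ ((1 - s) / (κ - m)) ≤ (1 + T) ^ ((1 - s) / (κ - m)) :=
                Real.rpow_le_rpow (by linarith) (by linarith) (div_nonneg (by linarith) (by linarith))
            _ ≤ _ := Real.rpow_le_rpow_of_exponent_le (by linarith) hexp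

open scoped SchwartzMap LineDeriv

/-- The complex conjugate of a Schwartz function. -/
def schwartzConj (f : 𝓢(Rn 3, ℂ)) : 𝓢(Rn 3, ℂ) :=
  SchwartzMap.postcompCLM (𝕜 := ℝ) (conjCLE : ℂ →L[ℝ] ℂ) f

lemma schwartzConj_apply (f : 𝓢(Rn 3, ℂ)) (x : Rn 3) : schwartzConj f x = conj (f x) := rfl

lemma fourier_schwartzConj (f : 𝓢(Rn 3, ℂ)) (ξ : Rn 3) :
    𝓕 (schwartzConj f) ξ = conj (𝓕 f (-ξ)) := by
  rw [SchwartzMap.fourier_coe, SchwartzMap.fourier_coe, Real.fourier_eq, Real.fourier_eq,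
    ← integral_conj]
  congr 1
  ext v
  simp only [schwartzConj_apply, Circle.smul_def, smul_eq_mul, map_mul, inner_neg_right, neg_neg]
  congr 1
  rw [← Circle.coe_inv_eq_conj, ← AddChar.map_neg_eq_inv]

/-- The Fourier transform of a product is the convolution of the Fourier transforms. -/
lemma fourier_pairing_mul (f g : 𝓢(Rn 3, ℂ)) (ξ : Rn 3) :
    𝓕 (SchwartzMap.pairing (ContinuousLinearMap.mul ℂ ℂ) f g) ξ
      = ∫ c, 𝓕 f c * 𝓕 g (ξ - c) := by
  have h : SchwartzMap.pairing (ContinuousLinearMap.mul ℂ ℂ) f g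
      = 𝓕⁻ (SchwartzMap.convolution (ContinuousLinearMap.mul ℂ ℂ) (𝓕 f) (𝓕 g)) := by
    ext x
    have e (k : 𝓢(Rn 3, ℂ)) : (𝓕⁻ k : 𝓢(Rn 3, ℂ)) x = 𝓕 k (-x) := by
      rw [SchwartzMap.fourierInv_coe, SchwartzMap.fourier_coe, Real.fourierInv_eq_fourier_neg]
    rw [e, SchwartzMap.fourier_convolution, SchwartzMap.pairing_apply_apply,
      SchwartzMap.pairing_apply_apply, ← e, ← e]
    simp
  rw [h, FourierTransform.fourier_fourierInv_eq, SchwartzMap.convolution_apply]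
  rfl

/-- The Fourier transform of the cubic nonlinearity. -/
lemma fourier_cubic (f : 𝓢(Rn 3, ℂ)) (ξ : Rn 3) :
    𝓕 (fun x => (‖f x‖ : ℂ) ^ 2 * f x) ξ
      = ∫ c, 𝓕 f c * biSym (fun _ _ => 1) (𝓕 f : 𝓢(Rn 3, ℂ)) (ξ - c) := by
  have h : (fun x => (‖f x‖ : ℂ) ^ 2 * f x)
      = SchwartzMap.pairing (ContinuousLinearMap.mul ℂ ℂ) f
        (SchwartzMap.pairing (ContinuousLinearMap.mul ℂ ℂ) (schwartzConj f) f) := by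
    ext x
    simp only [SchwartzMap.pairing_apply_apply, ContinuousLinearMap.mul_apply', schwartzConj_apply]
    rw [← Complex.conj_mul']
    ring
  rw [h, ← SchwartzMap.fourier_coe, fourier_pairing_mul]
  congr 1
  ext c
  rw [fourier_pairing_mul, biSym, ← integral_neg_eq_self]
  congr 2
  ext l
  rw [fourier_schwartzConj, neg_neg, sub_neg_eq_add, ofReal_one, one_mul, mul_comm]

lemma laplacian_eq_sum_lineDeriv (f : 𝓢(Rn 3, ℂ)) :
    laplacian f = ((∑ i : Fin 3, ∂_{(EuclideanSpace.single i 1 : Rn 3)}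
      (∂_{(EuclideanSpace.single i 1 : Rn 3)} f) : 𝓢(Rn 3, ℂ)) : Rn 3 → ℂ) := by
  ext x
  rw [sum_apply]
  rfl

lemma fourier_laplacian (f : 𝓢(Rn 3, ℂ)) (ξ : Rn 3) :
    𝓕 (laplacian f) ξ = -((4 * Real.pi ^ 2 * ‖ξ‖ ^ 2 : ℝ) : ℂ) * 𝓕 f ξ := by
  have e (g : 𝓢(Rn 3, ℂ)) (m : Rn 3) :
      𝓕 (∂_{m} g) ξ = 2 * Real.pi * I * (inner ℝ ξ m * 𝓕 g ξ) := by
    rw [SchwartzMap.fourier_lineDerivOp_eq]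
    have : (inner ℝ · m : Rn 3 → ℝ).HasTemperateGrowth := by fun_prop
    simp [this]
  rw [laplacian_eq_sum_lineDeriv, ← SchwartzMap.fourier_coe, FourierTransform.fourier_sum, sum_apply]
  simp only [e]
  rw [EuclideanSpace.norm_sq_eq]
  simp only [EuclideanSpace.inner_single_right, Fin.sum_univ_three]
  simp
  ring_nf
  simp
  ring

/-- A family of Schwartz functions whose seminorms are all bounded uniformly. -/
def UnifSchwartz {ι : Type*} (F : ι → 𝓢(Rn 3, ℂ)) : Prop :=
  ∀ k l : ℕ, ∃ C : ℝ, ∀ t, SchwartzMap.seminorm ℝ k l (F t) ≤ C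

lemma UnifSchwartz.finset_sup {ι : Type*} {F : ι → 𝓢(Rn 3, ℂ)} (h : UnifSchwartz F)
    (s : Finset (ℕ × ℕ)) :
    ∃ C : ℝ, ∀ t, s.sup (schwartzSeminormFamily ℝ (Rn 3) ℂ) (F t) ≤ C := by
  choose C hC using h
  refine ⟨∑ m ∈ s, |C m.1 m.2|, fun t => Seminorm.finset_sup_apply_le
    (Finset.sum_nonneg fun _ _ => abs_nonneg _) fun m hm => ?_⟩
  exact ((hC m.1 m.2 t).trans (le_abs_self _)).trans
    (Finset.single_le_sum (f := fun m : ℕ × ℕ => |C m.1 m.2|) (fun _ _ => abs_nonneg _) hm)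

lemma UnifSchwartz.map {ι : Type*} {F : ι → 𝓢(Rn 3, ℂ)} (h : UnifSchwartz F)
    (L : 𝓢(Rn 3, ℂ) →L[ℝ] 𝓢(Rn 3, ℂ)) : UnifSchwartz fun t => L (F t) := by
  intro k l
  obtain ⟨s, D, -, hD⟩ := Seminorm.bound_of_continuous (schwartz_withSeminorms ℝ (Rn 3) ℂ)
    ((schwartzSeminormFamily ℝ (Rn 3) ℂ (k, l)).comp L.toLinearMap)
    (((schwartz_withSeminorms ℝ (Rn 3) ℂ).continuous_seminorm (k, l)).comp L.continuous)
  obtain ⟨C, hC⟩ := h.finset_sup s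
  refine ⟨D * C, fun t => (hD (F t)).trans ?_⟩
  exact mul_le_mul_of_nonneg_left (hC t) D.2

lemma UnifSchwartz.jap_pow_mul_norm_le {ι : Type*} {F : ι → 𝓢(Rn 3, ℂ)} (h : UnifSchwartz F)
    (k : ℕ) : ∃ C : ℝ, ∀ t x, jap x ^ k * ‖F t x‖ ≤ C := by
  obtain ⟨C, hC⟩ := h.finset_sup (Finset.Iic (k, 0))
  refine ⟨2 ^ k * C, fun t x => ?_⟩
  have h1 := SchwartzMap.one_add_le_sup_seminorm_apply (𝕜 := ℝ) (m := (k, 0)) le_rfl le_rfl (F t) x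
  rw [norm_iteratedFDeriv_zero] at h1
  have h2 : jap x ≤ 1 + ‖x‖ := by
    rw [jap, Real.sqrt_le_left (by positivity)]
    nlinarith [norm_nonneg x]
  have h3 : 0 ≤ jap x := Real.sqrt_nonneg _
  calc jap x ^ k * ‖F t x‖ ≤ (1 + ‖x‖) ^ k * ‖F t x‖ := by gcongr
    _ ≤ _ := h1.trans (mul_le_mul_of_nonneg_left (hC t) (by positivity))

lemma UnifSchwartz.norm_le_inv_jap_pow {ι : Type*} {F : ι → 𝓢(Rn 3, ℂ)} (h : UnifSchwartz F) :
    ∃ C : ℝ, 0 ≤ C ∧ ∀ t x, ‖F t x‖ ≤ C * (jap x ^ 4)⁻¹ := by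
  obtain ⟨C, hC⟩ := h.jap_pow_mul_norm_le 4
  refine ⟨|C|, abs_nonneg _, fun t x => ?_⟩
  have h3 : 0 < jap x := Real.sqrt_pos.2 (by positivity)
  rw [← div_eq_mul_inv, le_div_iff₀ (by positivity), mul_comm]
  exact (hC t x).trans (le_abs_self _)

/-- The solution at time `t`, frozen outside `[0, T]`, as a Schwartz function. -/
def IsNLSSolution.slice {T : ℝ} {φ : Rn 3 → ℝ → ℂ} {φ₀ : Rn 3 → ℂ} (h : IsNLSSolution 3 T φ φ₀)
    (hT : 0 ≤ T) (t : ℝ) : 𝓢(Rn 3, ℂ) where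
  toFun x := φ x (max 0 (min T t))
  smooth' := h.1.comp (f := fun x : Rn 3 => (x, max 0 (min T t))) (by fun_prop)
  decay' k n := (h.2.1 k n).imp fun _ hC x =>
    hC _ ⟨le_max_left _ _, max_le hT (min_le_left _ _)⟩ x

section
variable {T : ℝ} {φ : Rn 3 → ℝ → ℂ} {φ₀ : Rn 3 → ℂ} (h : IsNLSSolution 3 T φ φ₀) (hT : 0 ≤ T)

lemma IsNLSSolution.slice_apply (t : ℝ) (x : Rn 3) :
    h.slice hT t x = φ x (max 0 (min T t)) := rfl

lemma IsNLSSolution.slice_of_mem {t : ℝ} (ht : t ∈ Icc 0 T) (x : Rn 3) :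
    h.slice hT t x = φ x t := by
  rw [h.slice_apply hT, min_eq_right ht.2, max_eq_right ht.1]

lemma IsNLSSolution.unifSchwartz_slice : UnifSchwartz (h.slice hT) := by
  intro k l
  obtain ⟨C, hC⟩ := h.2.1 k l
  refine ⟨|C|, fun t => SchwartzMap.seminorm_le_bound ℝ k l _ (abs_nonneg _) fun x => ?_⟩
  exact (hC _ ⟨le_max_left _ _, max_le hT (min_le_left _ _)⟩ x).trans (le_abs_self _)

lemma IsNLSSolution.decays_fourier :
    Decays fun t ξ => (𝓕 (h.slice hT t) : 𝓢(Rn 3, ℂ)) ξ :=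
  ((h.unifSchwartz_slice hT).map (FourierTransform.fourierCLM ℝ 𝓢(Rn 3, ℂ))).jap_pow_mul_norm_le

lemma IsNLSSolution.continuous_fourier :
    Continuous fun p : ℝ × Rn 3 => (𝓕 (h.slice hT p.1) : 𝓢(Rn 3, ℂ)) p.2 := by
  obtain ⟨C, -, hC⟩ := (h.unifSchwartz_slice hT).norm_le_inv_jap_pow
  simp only [SchwartzMap.fourier_coe, Real.fourier_eq]
  have hφ : Continuous fun p : Rn 3 × ℝ => φ p.1 p.2 := h.1.continuous
  refine continuous_of_dominated (bound := fun x => C * (jap x ^ 4)⁻¹) (fun p => ?_) (fun p => ?_)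
    (integrable_inv_jap_pow.const_mul C) (Filter.Eventually.of_forall fun x => ?_)
  · exact (Continuous.smul (Real.continuous_fourierChar.comp (f := fun x => -inner ℝ x p.2)
      (by fun_prop)) (h.slice hT p.1).continuous).aestronglyMeasurable
  · exact Filter.Eventually.of_forall fun x => by
      rw [Circle.norm_smul]; exact hC _ _
  · have he : Continuous fun p : ℝ × Rn 3 => Real.fourierChar (-inner ℝ x p.2) :=
      Real.continuous_fourierChar.comp (f := fun p : ℝ × Rn 3 => -inner ℝ x p.2) (by fun_prop)
    refine he.smul ?_
    exact hφ.comp (f := fun p : ℝ × Rn 3 => (x, max 0 (min T p.1))) (by fun_prop)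

lemma IsNLSSolution.hasDerivAt_slice {t : ℝ} (ht : t ∈ Ioo 0 T) (x : Rn 3) :
    HasDerivAt (fun t => h.slice hT t x)
      (I * (laplacian (h.slice hT t) x - (‖h.slice hT t x‖ : ℂ) ^ 2 * h.slice hT t x)) t := by
  have h1 : DifferentiableAt ℝ (fun t => φ x t) t :=
    ((h.1.comp (f := fun t : ℝ => (x, t)) (by fun_prop)).differentiable (by simp)) t
  have h2 := h.2.2.1 x t (Ioo_subset_Icc_self ht)
  have h3 : (h.slice hT t : Rn 3 → ℂ) = fun y => φ y t :=
    funext fun y => h.slice_of_mem hT (Ioo_subset_Icc_self ht) y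
  have h4 : I * (laplacian (h.slice hT t) x - (‖h.slice hT t x‖ : ℂ) ^ 2 * h.slice hT t x)
      = deriv (fun t => φ x t) t := by
    rw [h3]
    linear_combination I * h2 - (deriv (fun t => φ x t) t) * I_mul_I
  rw [h4]
  refine h1.hasDerivAt.congr_of_eventuallyEq ?_
  filter_upwards [Ioo_mem_nhds ht.1 ht.2] with r hr
  exact h.slice_of_mem hT (Ioo_subset_Icc_self hr) x

lemma IsNLSSolution.exists_norm_laplacian_le : ∃ C : ℝ, ∀ t x,
    ‖laplacian (h.slice hT t) x‖ ≤ C * (jap x ^ 4)⁻¹ := by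
  have h1 (i : Fin 3) := (((h.unifSchwartz_slice hT).map (LineDeriv.lineDerivOpCLM ℝ 𝓢(Rn 3, ℂ)
    (EuclideanSpace.single i 1 : Rn 3))).map (LineDeriv.lineDerivOpCLM ℝ 𝓢(Rn 3, ℂ)
    (EuclideanSpace.single i 1 : Rn 3))).norm_le_inv_jap_pow
  choose A _ hA using h1
  refine ⟨∑ i, A i, fun t x => ?_⟩
  rw [Finset.sum_mul]
  exact (norm_sum_le _ _).trans (Finset.sum_le_sum fun i _ => hA i t x)

lemma IsNLSSolution.exists_norm_cubic_le : ∃ C : ℝ, ∀ t x,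
    ‖(‖h.slice hT t x‖ : ℂ) ^ 2 * h.slice hT t x‖ ≤ C * (jap x ^ 4)⁻¹ := by
  have hu := h.unifSchwartz_slice hT
  obtain ⟨B, hB0, hB⟩ := hu.norm_le_inv_jap_pow
  obtain ⟨D, hD⟩ := hu.jap_pow_mul_norm_le 0
  refine ⟨D ^ 2 * B, fun t x => ?_⟩
  have hD' := hD t x
  rw [pow_zero, one_mul] at hD'
  rw [norm_mul, norm_pow, norm_real, norm_norm, mul_assoc]
  gcongr
  exact hB t x

lemma IsNLSSolution.hasDerivAt_fourier {t : ℝ} (ht : t ∈ Ioo 0 T) (ξ : Rn 3) :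
    HasDerivAt (fun t => (𝓕 (h.slice hT t) : 𝓢(Rn 3, ℂ)) ξ)
      (I * (𝓕 (laplacian (h.slice hT t)) ξ
        - 𝓕 (fun x => (‖h.slice hT t x‖ : ℂ) ^ 2 * h.slice hT t x) ξ)) t := by
  obtain ⟨A, -, hA⟩ := (h.unifSchwartz_slice hT).norm_le_inv_jap_pow
  obtain ⟨L, hL⟩ := h.exists_norm_laplacian_le hT
  obtain ⟨N, hN⟩ := h.exists_norm_cubic_le hT
  have he : Continuous fun x : Rn 3 => Real.fourierChar (-inner ℝ x ξ) :=
    Real.continuous_fourierChar.comp (f := fun x : Rn 3 => -inner ℝ x ξ) (by fun_prop)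
  have hm (t : ℝ) : Continuous fun x => Real.fourierChar (-inner ℝ x ξ) • h.slice hT t x :=
    he.smul (h.slice hT t).continuous
  have hlc : Continuous (laplacian (h.slice hT t)) := by
    rw [laplacian_eq_sum_lineDeriv]
    exact SchwartzMap.continuous _
  have hcc : Continuous fun x => (‖h.slice hT t x‖ : ℂ) ^ 2 * h.slice hT t x := by
    have := (h.slice hT t).continuous
    fun_prop
  have key := hasDerivAt_integral_of_dominated_loc_of_deriv_le (𝕜 := ℝ) (E := ℂ) (μ := volume)
    (F := fun t x => Real.fourierChar (-inner ℝ x ξ) • h.slice hT t x)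
    (F' := fun t x => Real.fourierChar (-inner ℝ x ξ) • (I * (laplacian (h.slice hT t) x
      - (‖h.slice hT t x‖ : ℂ) ^ 2 * h.slice hT t x)))
    (bound := fun x => (L + N) * (jap x ^ 4)⁻¹) (Ioo_mem_nhds ht.1 ht.2)
    (Filter.Eventually.of_forall fun t => (hm t).aestronglyMeasurable)
    ((integrable_inv_jap_pow.const_mul A).mono' (hm t).aestronglyMeasurable
      (Filter.Eventually.of_forall fun x => by rw [Circle.norm_smul]; exact hA t x))
    (he.smul (continuous_const.mul (hlc.sub hcc))).aestronglyMeasurable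
    (Filter.Eventually.of_forall fun x t _ => by
      rw [Circle.norm_smul, norm_mul, norm_I, one_mul, add_mul]
      exact (norm_sub_le _ _).trans (add_le_add (hL t x) (hN t x)))
    (integrable_inv_jap_pow.const_mul (L + N))
    (Filter.Eventually.of_forall fun x t ht' => by
      simp only [Circle.smul_def, smul_eq_mul]
      exact (h.hasDerivAt_slice hT ht' x).const_mul _)
  have hli : Integrable (laplacian (h.slice hT t)) :=
    (integrable_inv_jap_pow.const_mul L).mono' hlc.aestronglyMeasurable
      (Filter.Eventually.of_forall (hL t))
  have hci : Integrable fun x => (‖h.slice hT t x‖ : ℂ) ^ 2 * h.slice hT t x :=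
    (integrable_inv_jap_pow.const_mul N).mono' hcc.aestronglyMeasurable
      (Filter.Eventually.of_forall (hN t))
  refine key.2.congr_deriv ?_
  rw [Real.fourier_eq, Real.fourier_eq, ← integral_sub
    ((Real.fourierIntegral_convergent_iff ξ).2 hli)
    ((Real.fourierIntegral_convergent_iff ξ).2 hci), ← integral_const_mul]
  congr 1
  ext x
  simp only [Circle.smul_def, smul_eq_mul]
  ring

lemma IsNLSSolution.cubicProfile :
    CubicProfile T fun t ξ => (𝓕 (h.slice hT t) : 𝓢(Rn 3, ℂ)) ξ where
  cont := h.continuous_fourier hT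
  decays := h.decays_fourier hT
  deriv t ht ξ := by
    convert h.hasDerivAt_fourier hT ht ξ using 1
    rw [fourier_laplacian, fourier_cubic,
      triSym_eq_integral_biSym (h.continuous_fourier hT) (h.decays_fourier hT)
        (σ := fun _ _ _ => 1) measurable_const (L := 1) ?_ t ξ]
    · ring
    · intro a b c
      have h1 (x : Rn 3) : 1 ≤ jap x := by
        rw [jap, Real.one_le_sqrt]; nlinarith [norm_nonneg x]
      rw [abs_one, one_mul]
      exact one_le_mul_of_one_le_of_one_le
        (one_le_mul_of_one_le_of_one_le (h1 a) (h1 b)) (h1 c)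

end

theorem IsNLSSolution.exists_cubicProfile {T : ℝ} {φ : Rn 3 → ℝ → ℂ} {φ₀ : Rn 3 → ℂ}
    (h : IsNLSSolution 3 T φ φ₀) (hT : 0 ≤ T) :
    ∃ u : ℝ → Rn 3 → ℂ, CubicProfile T u ∧ u 0 = 𝓕 φ₀ ∧ u T = 𝓕 fun x => φ x T := by
  refine ⟨_, h.cubicProfile hT, ?_, ?_⟩
  · ext ξ
    rw [SchwartzMap.fourier_coe, show (h.slice hT 0 : Rn 3 → ℂ) = φ₀ from funext fun x => by
      rw [h.slice_of_mem hT (left_mem_Icc.2 hT), h.2.2.2]]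
  · ext ξ
    rw [SchwartzMap.fourier_coe, show (h.slice hT T : Rn 3 → ℂ) = fun x => φ x T from
      funext (h.slice_of_mem hT (right_mem_Icc.2 hT))]

/-- Main theorem, n = 3: global-in-time polynomial bound on the H^s norm for s > 5/6. -/
theorem statement_1 :
    ∀ s : ℝ, 5/6 < s → s < 1 →
    ∃ ε₀ > (0:ℝ), ∀ ε : ℝ, 0 < ε → ε < ε₀ →
    ∀ B : ℝ, 0 < B →
    ∃ C > (0:ℝ),
    ∀ T : ℝ, 1 ≤ T →
    ∀ φ₀ : SchwartzMap (Rn 3) ℂ, sobNorm 3 s ⇑φ₀ ≤ B →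
    ∀ φ : Rn 3 → ℝ → ℂ, IsNLSSolution 3 T φ ⇑φ₀ →
    sobNorm 3 s (fun x => φ x T)
      ≤ C * (1 + T) ^ ((1 - s) / (6 * (s - 5/6)) + ε) := by
  intro s hs hs1
  refine ⟨1, one_pos, fun ε hε _ B hB => ?_⟩
  obtain ⟨C, hC, hgrowth⟩ := exists_profile_growth hs hs1 hε hB.le
  refine ⟨C, hC, fun T hT φ₀ hφ₀ φ hφ => ?_⟩
  obtain ⟨u, hu, hu0, huT⟩ := hφ.exists_cubicProfile (zero_le_one.trans hT)
  have key := hgrowth T u hT hu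
  rw [hu0, huT] at key
  exact key hφ₀

end
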